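/- arXiv:1409.2034 — 2 statements merged into one kernel-verified Lean document; each statement's English description precedes it below -/
import Mathlib

section
/- Assume condition (C) and μ({0}) = 0. Let σ² = Var(ξ_0) and define the sequence L_n by: L_n = 8√3/(π σ²) if E(ξ_0) = 0 and n+1 is divisible by 4; L_n = 4√3/(π σ²) if E(ξ_0) ≠ 0 and n+1 is divisible by 4; and L_n = 0 if n+1 is not divisible by 4. Then n² · P(P_n has a double root in ℂ) − L_n → 0 as n → ∞. -/
open Filter MeasureTheory

/-- The polynomial `∑_{j=0}^n a_j z^j` with integer coefficients, viewed over `ℂ`. -/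
noncomputable def polyOf (n : ℕ) (a : Fin (n + 1) → ℤ) : Polynomial ℂ :=
  ∑ j : Fin (n + 1), Polynomial.C (a j : ℂ) * Polynomial.X ^ (j : ℕ)

/-- The polynomial with coefficients `a` has a double root in `ℂ`. -/
def hasDoubleRoot (n : ℕ) (a : Fin (n + 1) → ℤ) : Prop :=
  ∃ z : ℂ, (polyOf n a).eval z = 0 ∧ (Polynomial.derivative (polyOf n a)).eval z = 0

/-- The mean `E(ξ₀)` of a coefficient with distribution `μ`. -/
noncomputable def coeffMean (μ : MeasureTheory.Measure ℤ) : ℝ :=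
  ∫ x, (x : ℝ) ∂μ

/-- The variance `Var(ξ₀)` of a coefficient with distribution `μ`. -/
noncomputable def coeffVar (μ : MeasureTheory.Measure ℤ) : ℝ :=
  ∫ x, ((x : ℝ) - coeffMean μ) ^ 2 ∂μ

open scoped Classical in
/-- The periodic sequence `L_n` of Theorem 1.2. -/
noncomputable def Lseq (μ : MeasureTheory.Measure ℤ) (n : ℕ) : ℝ :=
  if 4 ∣ n + 1 then
    (if coeffMean μ = 0 then 8 * Real.sqrt 3 / (Real.pi * coeffVar μ)
     else 4 * Real.sqrt 3 / (Real.pi * coeffVar μ))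
  else 0

section


/-- weight of a sign -/
noncomputable def wt (p : ℝ) (u : ℤˣ) : ℝ := if u = 1 then p else 1 - p

/-- weighted probability on sign vectors -/
noncomputable def Pr (p : ℝ) {ι : Type} [Fintype ι] [DecidableEq ι] (A : Set (ι → ℤˣ)) : ℝ :=
  ∑ a : ι → ℤˣ, A.indicator (fun a => ∏ i, wt p (a i)) a

section prob
set_option linter.unusedSectionVars false
variable {ι κ : Type} [Fintype ι] [DecidableEq ι] [Fintype κ] [DecidableEq κ] {p : ℝ}

lemma wt_nonneg (h0 : 0 ≤ p) (h1 : p ≤ 1) (u : ℤˣ) : 0 ≤ wt p u := by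
  unfold wt; split_ifs <;> linarith

lemma units_sum {R : Type} [AddCommMonoid R] (F : ℤˣ → R) : ∑ u : ℤˣ, F u = F 1 + F (-1) := by
  rw [show (Finset.univ : Finset ℤˣ) = {1, -1} from rfl]
  rw [Finset.sum_pair (by decide)]

lemma wt_total : ∑ u : ℤˣ, wt p u = 1 := by
  rw [units_sum]; simp [wt]

lemma wt_one : wt p 1 = p := by simp [wt]
lemma wt_neg_one : wt p (-1) = 1 - p := by
  unfold wt; rw [if_neg (by decide)]

lemma prod_wt_nonneg (h0 : 0 ≤ p) (h1 : p ≤ 1) (a : ι → ℤˣ) : 0 ≤ ∏ i, wt p (a i) :=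
  Finset.prod_nonneg fun _ _ => wt_nonneg h0 h1 _

lemma Pr_nonneg (h0 : 0 ≤ p) (h1 : p ≤ 1) (A : Set (ι → ℤˣ)) : 0 ≤ Pr p A :=
  Finset.sum_nonneg fun _ _ => Set.indicator_nonneg (fun a _ => prod_wt_nonneg h0 h1 a) _

lemma Pr_mono (h0 : 0 ≤ p) (h1 : p ≤ 1) {A B : Set (ι → ℤˣ)} (h : A ⊆ B) : Pr p A ≤ Pr p B :=
  Finset.sum_le_sum fun a _ =>
    Set.indicator_le_indicator_of_subset h (fun a => prod_wt_nonneg h0 h1 a) a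

lemma Pr_union_add_inter (A B : Set (ι → ℤˣ)) :
    Pr p (A ∪ B) + Pr p (A ∩ B) = Pr p A + Pr p B := by
  unfold Pr
  rw [← Finset.sum_add_distrib, ← Finset.sum_add_distrib]
  refine Finset.sum_congr rfl fun a _ => ?_
  exact congrFun (Set.indicator_union_add_inter (fun a => ∏ i, wt p (a i)) A B) a

lemma Pr_union_le (h0 : 0 ≤ p) (h1 : p ≤ 1) (A B : Set (ι → ℤˣ)) :
    Pr p (A ∪ B) ≤ Pr p A + Pr p B := by
  have := Pr_union_add_inter (p := p) A B
  have := Pr_nonneg h0 h1 (A ∩ B)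
  linarith

lemma Pr_empty : Pr p (∅ : Set (ι → ℤˣ)) = 0 := by simp [Pr]

lemma sum_prod_units {R : Type} [CommSemiring R] (g : ι → ℤˣ → R) :
    ∑ a : ι → ℤˣ, ∏ i, g i (a i) = ∏ i, (g i 1 + g i (-1)) := by
  have := Finset.sum_prod_piFinset (ι := ι) (Finset.univ : Finset ℤˣ) g
  rw [Fintype.piFinset_univ] at this
  rw [this]
  simp only [units_sum]

lemma Pr_univ : Pr p (Set.univ : Set (ι → ℤˣ)) = 1 := by
  simp only [Pr, Set.indicator_univ]
  rw [sum_prod_units (fun _ u => wt p u)]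
  simp [wt_one, wt_neg_one]

lemma Pr_biUnion_le (h0 : 0 ≤ p) (h1 : p ≤ 1) {β : Type} (s : Finset β)
    (A : β → Set (ι → ℤˣ)) : Pr p (⋃ b ∈ s, A b) ≤ ∑ b ∈ s, Pr p (A b) := by
  classical
  induction s using Finset.induction_on with
  | empty => simp [Pr_empty]
  | insert b s hb ih =>
    rw [Finset.set_biUnion_insert, Finset.sum_insert hb]
    exact (Pr_union_le h0 h1 _ _).trans (by linarith)

lemma prod_extend (e : κ → ι) (he : Function.Injective e) (x : κ → ℤˣ) (y : ι → ℤˣ) :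
    (∏ i, wt p (Function.extend e x y i)) * ∏ k, wt p (y (e k)) =
      (∏ k, wt p (x k)) * ∏ i, wt p (y i) := by
  classical
  have key : ∀ z : ι → ℤˣ, ∏ i, wt p (z i) =
      (∏ k, wt p (z (e k))) * ∏ i ∈ (Finset.univ.image e)ᶜ, wt p (z i) := by
    intro z
    rw [← Finset.prod_mul_prod_compl (Finset.univ.image e) (fun i => wt p (z i))]
    rw [Finset.prod_image (fun a _ b _ h => he h)]
  rw [key (Function.extend e x y), key y]
  have h1 : ∀ k, Function.extend e x y (e k) = x k := fun k => he.extend_apply x y k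
  have h2 : ∏ i ∈ (Finset.univ.image e)ᶜ, wt p (Function.extend e x y i) =
      ∏ i ∈ (Finset.univ.image e)ᶜ, wt p (y i) := by
    refine Finset.prod_congr rfl fun i hi => ?_
    rw [Function.extend_apply']
    rintro ⟨k, rfl⟩
    simp at hi
  simp only [h1, h2]
  ring

lemma Pr_resample (e : κ → ι) (he : Function.Injective e) (A : Set (ι → ℤˣ)) :
    Pr p A = ∑ y : ι → ℤˣ, (∏ i, wt p (y i)) * Pr p {x : κ → ℤˣ | Function.extend e x y ∈ A} := by
  classical
  have hL : Pr p A = ∑ q : (ι → ℤˣ) × (κ → ℤˣ),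
      (∏ k, wt p (q.2 k)) * A.indicator (fun a => ∏ i, wt p (a i)) q.1 := by
    rw [Fintype.sum_prod_type]
    simp only [← Finset.sum_mul]
    have := Pr_univ (ι := κ) (p := p)
    simp only [Pr, Set.indicator_univ] at this
    rw [this]; simp [Pr]
  have hR : (∑ y : ι → ℤˣ, (∏ i, wt p (y i)) *
      Pr p {x : κ → ℤˣ | Function.extend e x y ∈ A}) = ∑ q : (ι → ℤˣ) × (κ → ℤˣ),
      (∏ i, wt p (q.1 i)) * {x : κ → ℤˣ | Function.extend e x q.1 ∈ A}.indicator
        (fun a => ∏ i, wt p (a i)) q.2 := by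
    rw [Fintype.sum_prod_type]
    simp only [Pr, Finset.mul_sum]
  rw [hL, hR]
  let inv : (ι → ℤˣ) × (κ → ℤˣ) → (ι → ℤˣ) × (κ → ℤˣ) :=
    fun q => (Function.extend e q.2 q.1, q.1 ∘ e)
  have hinv : Function.Involutive inv := by
    rintro ⟨y, x⟩
    simp only [inv, Prod.mk.injEq]
    refine ⟨?_, ?_⟩
    · funext i
      by_cases hi : ∃ k, e k = i
      · obtain ⟨k, rfl⟩ := hi
        rw [he.extend_apply]; rfl
      · rw [Function.extend_apply' _ _ _ hi, Function.extend_apply' _ _ _ hi]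
    · funext k
      simp [he.extend_apply]
  refine (Fintype.sum_equiv hinv.toPerm _ _ ?_).symm
  rintro ⟨y, x⟩
  have := prod_extend (p := p) e he x y
  simp only [Function.Involutive.coe_toPerm, inv, Set.indicator_apply, Set.mem_setOf_eq,
    Function.comp]
  split_ifs
  · linarith
  · simp

lemma Pr_extend_le (h0 : 0 ≤ p) (h1 : p ≤ 1) (e : κ → ι) (he : Function.Injective e)
    (A : Set (ι → ℤˣ)) (C : ℝ)
    (h : ∀ y : ι → ℤˣ, Pr p {x : κ → ℤˣ | Function.extend e x y ∈ A} ≤ C) : Pr p A ≤ C := by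
  rw [Pr_resample e he A]
  calc _ ≤ ∑ y : ι → ℤˣ, (∏ i, wt p (y i)) * C :=
        Finset.sum_le_sum fun y _ => mul_le_mul_of_nonneg_left (h y) (prod_wt_nonneg h0 h1 y)
    _ = C := by
        rw [← Finset.sum_mul]
        have := Pr_univ (ι := ι) (p := p)
        simp only [Pr, Set.indicator_univ] at this
        rw [this, one_mul]

lemma Pr_subsingleton_le (h0 : 0 ≤ p) (h1 : p ≤ 1) {M : ℝ} (hp : p ≤ M) (hq : 1 - p ≤ M)
    (A : Set (ι → ℤˣ)) (hA : A.Subsingleton) : Pr p A ≤ M ^ Fintype.card ι := by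
  classical
  have hM : 0 ≤ M := h0.trans hp
  rcases A.eq_empty_or_nonempty with rfl | ⟨a, ha⟩
  · rw [Pr_empty]; positivity
  · rw [hA.eq_singleton_of_mem ha]
    simp only [Pr, Set.indicator_apply, Set.mem_singleton_iff, Finset.sum_ite_eq', Finset.mem_univ,
      if_true]
    calc _ ≤ ∏ i : ι, M := Finset.prod_le_prod (fun i _ => wt_nonneg h0 h1 _) fun i _ => by
            unfold wt; split_ifs <;> assumption
      _ = _ := by simp

lemma Pr_sum_prod (B₁ : Set (ι → ℤˣ)) (B₂ : Set (κ → ℤˣ)) :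
    Pr p {x : ι ⊕ κ → ℤˣ | x ∘ Sum.inl ∈ B₁ ∧ x ∘ Sum.inr ∈ B₂} = Pr p B₁ * Pr p B₂ := by
  classical
  unfold Pr
  rw [Finset.sum_mul_sum, ← Finset.sum_product', Finset.univ_product_univ]
  refine Fintype.sum_equiv (Equiv.sumArrowEquivProdArrow ι κ ℤˣ) _ _ ?_
  intro x
  simp only [Equiv.sumArrowEquivProdArrow, Equiv.coe_fn_mk, Set.indicator_apply, Set.mem_setOf_eq,
    Fintype.prod_sum_type]
  by_cases h1 : x ∘ Sum.inl ∈ B₁ <;> by_cases h2 : x ∘ Sum.inr ∈ B₂ <;> simp [h1, h2]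

end prob

end

section


section fourier
open Complex

/-- characteristic function of a signed coefficient -/
noncomputable def cf (p : ℝ) (e : ℤˣ) (θ : ℝ) : ℂ :=
  p * exp (I * (((e : ℤ) : ℝ) * θ : ℝ)) + (1 - p) * exp (-(I * (((e : ℤ) : ℝ) * θ : ℝ)))

lemma fourier_single (k : ℤ) (hk : Even k) :
    ∫ s in (-(Real.pi/2))..(Real.pi/2), exp (I * ((s * k : ℝ) : ℂ)) =
      if k = 0 then (Real.pi : ℂ) else 0 := by
  split_ifs with h
  · subst h
    simp
  · have hc : (I * (k : ℂ)) ≠ 0 := by simp [h]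
    have : ∀ s : ℝ, exp (I * ((s * k : ℝ) : ℂ)) = exp ((I * k) * s) := by
      intro s; congr 1; push_cast; ring
    simp only [this]
    rw [integral_exp_mul_complex hc]
    obtain ⟨m, rfl⟩ := hk
    rw [div_eq_zero_iff]; left
    rw [sub_eq_zero, Complex.exp_eq_exp_iff_exists_int]
    exact ⟨m, by push_cast; ring⟩

lemma fourier_double (k l : ℤ) (c : ℝ) (hk : Even k) (hl : Even l) :
    ∫ t in (-(Real.pi/2))..(Real.pi/2), ∫ s in (-(Real.pi/2))..(Real.pi/2),
      exp (I * ((s * k + t * (l - c * k) : ℝ) : ℂ)) =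
      if k = 0 ∧ l = 0 then (Real.pi : ℂ) ^ 2 else 0 := by
  have h1 : ∀ t s : ℝ, exp (I * ((s * k + t * (l - c * k) : ℝ) : ℂ)) =
      exp (I * ((s * k : ℝ) : ℂ)) * exp (I * ((t * (l - c * k) : ℝ) : ℂ)) := by
    intro t s; rw [← exp_add]; congr 1; push_cast; ring
  simp only [h1, intervalIntegral.integral_mul_const, fourier_single k hk]
  by_cases hk0 : k = 0
  · subst hk0
    simp only [if_true, intervalIntegral.integral_const_mul]
    have := fourier_single l hl
    simp only [Int.cast_zero, mul_zero, sub_zero, true_and]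
    rw [this]
    split_ifs <;> simp [sq]
  · simp [hk0]

/-- first moment -/
def Ssum (N : ℕ) (e : ℕ → ℤˣ) (a : Fin N → ℤˣ) : ℤ := ∑ j : Fin N, (a j : ℤ) * (e j : ℤ)
/-- second moment -/
def Tsum (N : ℕ) (e : ℕ → ℤˣ) (a : Fin N → ℤˣ) : ℤ :=
  ∑ j : Fin N, (j : ℤ) * ((a j : ℤ) * (e j : ℤ))

lemma cf_sum (p : ℝ) (N : ℕ) (e : ℕ → ℤˣ) (θ : ℕ → ℝ) :
    ∑ a : Fin N → ℤˣ, ((∏ j, wt p (a j) : ℝ) : ℂ) *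
      exp (I * ((∑ j : Fin N, (((a j : ℤ) : ℝ) * ((e j : ℤ) : ℝ)) * θ j : ℝ) : ℂ)) =
    ∏ j : Fin N, cf p (e j) (θ j) := by
  have := sum_prod_units (ι := Fin N) (R := ℂ) (fun j u => ((wt p u : ℝ) : ℂ) *
    exp (I * (((((u : ℤ) : ℝ) * ((e j : ℤ) : ℝ)) * θ j : ℝ) : ℂ)))
  calc _ = ∑ a : Fin N → ℤˣ, ∏ j, (((wt p (a j) : ℝ) : ℂ) *
    exp (I * (((((a j : ℤ) : ℝ) * ((e j : ℤ) : ℝ)) * θ j : ℝ) : ℂ))) := by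
        refine Finset.sum_congr rfl fun a _ => ?_
        rw [Finset.prod_mul_distrib, ← exp_sum]
        push_cast
        rw [Finset.mul_sum]
    _ = _ := by
        rw [this]
        refine Finset.prod_congr rfl fun j _ => ?_
        rw [wt_one, wt_neg_one, cf]
        push_cast
        congr 2
        · congr 2; ring
        · congr 1; ring

lemma fourier_Pr (p : ℝ) (N : ℕ) (e : ℕ → ℤˣ) (A B : ℤ) (c : ℝ)
    (hpar : ∀ a : Fin N → ℤˣ, Even (Ssum N e a - A) ∧ Even (Tsum N e a - B)) :
    ((Pr p {a : Fin N → ℤˣ | Ssum N e a = A ∧ Tsum N e a = B} : ℝ) : ℂ) * (Real.pi : ℂ) ^ 2 =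
    ∫ t in (-(Real.pi/2))..(Real.pi/2), ∫ s in (-(Real.pi/2))..(Real.pi/2),
      exp (-(I * ((s * A + t * (B - c * A) : ℝ) : ℂ))) *
        ∏ j : Fin N, cf p (e j) (s + (j - c) * t) := by
  classical
  have h1 : ∀ s t : ℝ, exp (-(I * ((s * A + t * (B - c * A) : ℝ) : ℂ))) *
        ∏ j : Fin N, cf p (e j) (s + (j - c) * t) =
      ∑ a : Fin N → ℤˣ, ((∏ j, wt p (a j) : ℝ) : ℂ) *
        exp (I * ((s * (Ssum N e a - A : ℤ) + t * ((Tsum N e a - B : ℤ) -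
          c * (Ssum N e a - A : ℤ)) : ℝ) : ℂ)) := by
    intro s t
    rw [← cf_sum p N e (fun j => s + (j - c) * t), Finset.mul_sum]
    refine Finset.sum_congr rfl fun a _ => ?_
    rw [mul_left_comm, ← exp_add]
    congr 2
    have : (∑ j : Fin N, (((a j : ℤ) : ℝ) * ((e j : ℤ) : ℝ)) * (s + (j - c) * t) : ℝ) =
        s * (Ssum N e a : ℝ) + t * (Tsum N e a - c * Ssum N e a) := by
      simp only [Ssum, Tsum]
      push_cast
      simp only [Finset.mul_sum, ← Finset.sum_sub_distrib, ← Finset.sum_add_distrib]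
      refine Finset.sum_congr rfl fun j _ => ?_
      ring
    rw [this]
    push_cast
    ring
  simp only [h1]
  have h2 : ∀ t : ℝ, ∫ s in (-(Real.pi/2))..(Real.pi/2), (∑ a : Fin N → ℤˣ,
      ((∏ j, wt p (a j) : ℝ) : ℂ) *
        exp (I * ((s * (Ssum N e a - A : ℤ) + t * ((Tsum N e a - B : ℤ) -
          c * (Ssum N e a - A : ℤ)) : ℝ) : ℂ))) = ∑ a : Fin N → ℤˣ,
      ((∏ j, wt p (a j) : ℝ) : ℂ) * ∫ s in (-(Real.pi/2))..(Real.pi/2),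
        exp (I * ((s * (Ssum N e a - A : ℤ) + t * ((Tsum N e a - B : ℤ) -
          c * (Ssum N e a - A : ℤ)) : ℝ) : ℂ)) := by
    intro t
    rw [intervalIntegral.integral_finsetSum]
    · simp only [intervalIntegral.integral_const_mul]
    · intro a _
      apply Continuous.intervalIntegrable
      fun_prop
  simp only [h2]
  rw [intervalIntegral.integral_finsetSum]
  · simp only [intervalIntegral.integral_const_mul]
    have h3 : ∀ a : Fin N → ℤˣ, _ := fun a =>
      fourier_double (Ssum N e a - A) (Tsum N e a - B) c (hpar a).1 (hpar a).2
    simp only [h3, sub_eq_zero]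
    rw [Pr]
    push_cast
    rw [Finset.sum_mul]
    refine Finset.sum_congr rfl fun a _ => ?_
    by_cases h : Ssum N e a = A ∧ Tsum N e a = B
    · rw [if_pos h, Set.indicator_of_mem (by exact h)]; push_cast; ring
    · rw [if_neg h, Set.indicator_of_notMem (by exact h)]; simp
  · intro a _
    apply Continuous.intervalIntegrable
    have : ∀ t s : ℝ, exp (I * ((s * (Ssum N e a - A : ℤ) + t * ((Tsum N e a - B : ℤ) -
          c * (Ssum N e a - A : ℤ)) : ℝ) : ℂ)) =
        exp (I * ((s * (Ssum N e a - A : ℤ) : ℝ) : ℂ)) *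
        exp (I * ((t * ((Tsum N e a - B : ℤ) - c * (Ssum N e a - A : ℤ)) : ℝ) : ℂ)) := by
      intro t s; rw [← exp_add]; congr 1; push_cast; ring
    simp only [this, intervalIntegral.integral_mul_const]
    fun_prop

lemma cf_norm_sq (p : ℝ) (e : ℤˣ) (θ : ℝ) :
    ‖cf p e θ‖ ^ 2 = 1 - 4 * p * (1 - p) * Real.sin θ ^ 2 := by
  have h : cf p e θ = Real.cos θ + (((e : ℤ) : ℝ) * (2 * p - 1) * Real.sin θ : ℝ) * I := by
    unfold cf
    rw [mul_comm I, ← neg_mul, exp_mul_I, ← ofReal_neg, exp_mul_I]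
    rcases Int.units_eq_one_or e with rfl | rfl <;> simp <;> ring
  rw [h, Complex.sq_norm, normSq_add_mul_I]
  have he : (((e : ℤ) : ℝ)) ^ 2 = 1 := by
    rcases Int.units_eq_one_or e with rfl | rfl <;> simp
  have := Real.sin_sq_add_cos_sq θ
  rw [mul_pow, mul_pow, he]
  rw [Real.cos_sq']; ring

lemma cf_norm_le (p : ℝ) (e : ℤˣ) (θ : ℝ) :
    ‖cf p e θ‖ ≤ Real.exp (-(2 * p * (1 - p) * Real.sin θ ^ 2)) := by
  have h := cf_norm_sq p e θ
  have h2 : ‖cf p e θ‖ ^ 2 ≤ (Real.exp (-(2 * p * (1 - p) * Real.sin θ ^ 2))) ^ 2 := by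
    rw [h, ← Real.exp_nat_mul]
    have := Real.add_one_le_exp (-(4 * p * (1 - p) * Real.sin θ ^ 2))
    calc _ ≤ _ := by linarith
      _ ≤ _ := this
      _ = _ := by congr 1; push_cast; ring
  exact (pow_le_pow_iff_left₀ (norm_nonneg _) (Real.exp_nonneg _) two_ne_zero).1 h2

end fourier

end

section


section trig
open Real

lemma trig_tele (N : ℕ) (x t : ℝ) :
    (∑ j ∈ Finset.range N, cos (x + 2 * j * t)) * (2 * sin t) =
      sin (x + (2 * N - 1) * t) - sin (x - t) := by
  induction N with
  | zero => simp; ring_nf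
  | succ N ih =>
    rw [Finset.sum_range_succ, add_mul, ih]
    have h1 : sin (x + (2 * (N + 1 : ℕ) - 1) * t) = sin ((x + 2 * N * t) + t) := by
      congr 1; push_cast; ring
    have h2 : sin (x + (2 * N - 1) * t) = sin ((x + 2 * N * t) - t) := by
      congr 1; ring
    rw [h1, h2, sin_add, sin_sub]; ring

/-- Dirichlet kernel -/
noncomputable def Dk (N : ℕ) (t : ℝ) : ℝ :=
  ∑ j ∈ Finset.range N, cos (2 * ((j - (N - 1) / 2) * t))

lemma Dk_mul_sin (N : ℕ) (t : ℝ) : Dk N t * sin t = sin (N * t) := by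
  have h := trig_tele N (-((N - 1) * t)) t
  have e : Dk N t = ∑ j ∈ Finset.range N, cos (-((N - 1) * t) + 2 * j * t) := by
    refine Finset.sum_congr rfl fun j _ => ?_
    congr 1; ring
  rw [← e] at h
  have h1 : sin (-(((N:ℝ) - 1) * t) + (2 * N - 1) * t) = sin (N * t) := by congr 1; ring
  have h2 : sin (-(((N:ℝ) - 1) * t) - t) = - sin (N * t) := by rw [← sin_neg]; congr 1; ring
  rw [h1, h2] at h
  linarith

lemma sin_sum_zero (N : ℕ) (t : ℝ) :
    ∑ j ∈ Finset.range N, sin (2 * ((j - ((N:ℝ) - 1) / 2) * t)) = 0 := by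
  have h := Finset.sum_range_reflect (fun j : ℕ => sin (2 * ((j - ((N:ℝ) - 1) / 2) * t))) N
  have h2 : ∑ j ∈ Finset.range N, sin (2 * (((N - 1 - j : ℕ) - ((N:ℝ) - 1) / 2) * t)) =
      - ∑ j ∈ Finset.range N, sin (2 * ((j - ((N:ℝ) - 1) / 2) * t)) := by
    rw [← Finset.sum_neg_distrib]
    refine Finset.sum_congr rfl fun j hj => ?_
    rw [← sin_neg]
    have hj' : j + 1 ≤ N := Finset.mem_range.1 hj
    congr 1
    rw [Nat.sub_sub, Nat.cast_sub (by omega)]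
    push_cast; ring
  rw [h2] at h
  linarith

lemma sinsq_sum (N : ℕ) (s t : ℝ) :
    ∑ j ∈ Finset.range N, sin (s + (j - ((N:ℝ) - 1) / 2) * t) ^ 2 =
      (N - cos (2 * s) * Dk N t) / 2 := by
  have h1 : ∀ j : ℕ, sin (s + (j - ((N:ℝ) - 1) / 2) * t) ^ 2 =
      1 / 2 - (cos (2 * s) * cos (2 * ((j - ((N:ℝ) - 1) / 2) * t)) -
        sin (2 * s) * sin (2 * ((j - ((N:ℝ) - 1) / 2) * t))) / 2 := by
    intro j
    rw [sin_sq_eq_half_sub, ← cos_add]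
    have : 2 * (s + (j - ((N:ℝ) - 1) / 2) * t) = 2 * s + 2 * ((j - ((N:ℝ) - 1) / 2) * t) := by ring
    rw [this]
  simp only [h1]
  rw [Finset.sum_sub_distrib, ← Finset.sum_div, ← Finset.sum_div, Finset.sum_sub_distrib, ← Finset.mul_sum,
    ← Finset.mul_sum, sin_sum_zero]
  simp [Dk]; ring

lemma sq_sum (N : ℕ) : ∑ j ∈ Finset.range N, ((j : ℝ) - ((N:ℝ) - 1) / 2) ^ 2 =
    N * ((N:ℝ) ^ 2 - 1) / 12 := by
  have h : ∀ (M : ℕ) (c : ℝ), ∑ j ∈ Finset.range M, ((j : ℝ) - c) ^ 2 =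
      M * (M - 1) * (2 * M - 1) / 6 - c * M * (M - 1) + c ^ 2 * M := by
    intro M c
    induction M with
    | zero => simp
    | succ M ih => rw [Finset.sum_range_succ, ih]; push_cast; ring
  rw [h]; ring

lemma sin_sq_ge {x : ℝ} (hx : |x| ≤ π / 2) : (4 / π ^ 2) * x ^ 2 ≤ sin x ^ 2 := by
  have h := mul_abs_le_abs_sin hx
  have : (2 / π * |x|) ^ 2 ≤ |sin x| ^ 2 := by
    apply pow_le_pow_left₀ _ h
    positivity
  rw [sq_abs, mul_pow, sq_abs, div_pow] at this
  linarith

lemma sinsq_lower (N : ℕ) (hN : 2 ≤ N) (s t : ℝ) (hs : |s| ≤ π / 2) (ht : |t| ≤ π / 2) :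
    (N : ℝ) / 4 ≤ ∑ j ∈ Finset.range N, sin (s + (j - ((N:ℝ) - 1) / 2) * t) ^ 2 ∨
    (N * s ^ 2 + N ^ 3 * t ^ 2) / (4 * π ^ 2) ≤
      ∑ j ∈ Finset.range N, sin (s + (j - ((N:ℝ) - 1) / 2) * t) ^ 2 := by
  have hN' : (2 : ℝ) ≤ N := by exact_mod_cast hN
  have hpi := pi_pos
  have hD := Dk_mul_sin N t
  by_cases hsmall : |Dk N t| ≤ N / 2
  · left
    rw [sinsq_sum]
    have h1 : |cos (2 * s) * Dk N t| ≤ N / 2 := by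
      rw [abs_mul]
      calc _ ≤ 1 * (N / 2 : ℝ) := mul_le_mul (abs_cos_le_one _) hsmall (abs_nonneg _) zero_le_one
        _ = _ := one_mul _
    have := (abs_le.1 h1).2
    linarith
  · right
    push Not at hsmall
    have htN : |t| ≤ π / N := by
      by_contra hcon
      push Not at hcon
      have h1 := mul_abs_le_abs_sin ht
      have h2 : 2 / (N:ℝ) < |sin t| := by
        calc 2 / (N:ℝ) = 2 / π * (π / N) := by field_simp
          _ < 2 / π * |t| := by gcongr
          _ ≤ _ := h1
      have h3 : |Dk N t| * |sin t| ≤ 1 := by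
        rw [← abs_mul, hD]; exact abs_sin_le_one _
      have h4 : (N / 2 : ℝ) * (2 / N) < |Dk N t| * |sin t| :=
        mul_lt_mul'' hsmall h2 (by positivity) (by positivity)
      have h5 : (N / 2 : ℝ) * (2 / N) = 1 := by field_simp
      linarith
    have hNt : |N * t| ≤ π := by
      rw [abs_mul, Nat.abs_cast]
      calc (N:ℝ) * |t| ≤ N * (π / N) := by gcongr
        _ = π := by field_simp
    have hpos : 0 ≤ Dk N t := by
      rcases lt_trichotomy t 0 with h | h | h
      · have s1 : sin t < 0 := sin_neg_of_neg_of_neg_pi_lt h (by have := (abs_le.1 ht).1; linarith)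
        have s2 : sin (N * t) ≤ 0 := sin_nonpos_of_nonpos_of_neg_pi_le
          (by apply mul_nonpos_of_nonneg_of_nonpos (by positivity) h.le) (abs_le.1 hNt).1
        by_contra hc
        push Not at hc
        nlinarith [mul_pos_of_neg_of_neg hc s1]
      · subst h; simp [Dk]
      · have s1 : 0 < sin t := sin_pos_of_pos_of_lt_pi h (by have := (abs_le.1 ht).2; linarith)
        have s2 : 0 ≤ sin (N * t) := sin_nonneg_of_nonneg_of_le_pi (by positivity) (abs_le.1 hNt).2
        by_contra hc
        push Not at hc
        nlinarith [mul_neg_of_neg_of_pos hc s1]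
    rw [abs_of_nonneg hpos] at hsmall
    have e1 : (N - cos (2 * s) * Dk N t) / 2 = (N - Dk N t) / 2 + Dk N t * sin s ^ 2 := by
      rw [cos_two_mul, cos_sq']; ring
    have e2 : (N - Dk N t) / 2 = ∑ j ∈ Finset.range N, sin (0 + (j - ((N:ℝ) - 1) / 2) * t) ^ 2 := by
      rw [sinsq_sum]; simp
    have e3 : (4 / π ^ 2) * t ^ 2 * (N * ((N:ℝ) ^ 2 - 1) / 12) ≤
        ∑ j ∈ Finset.range N, sin (0 + (j - ((N:ℝ) - 1) / 2) * t) ^ 2 := by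
      rw [← sq_sum, Finset.mul_sum]
      refine Finset.sum_le_sum fun j hj => ?_
      rw [zero_add]
      have hb : |(j - ((N:ℝ) - 1) / 2) * t| ≤ π / 2 := by
        rw [abs_mul]
        have hj' : (j : ℝ) + 1 ≤ N := by exact_mod_cast Finset.mem_range.1 hj
        have : |(j - ((N:ℝ) - 1) / 2)| ≤ N / 2 := by
          rw [abs_le]; constructor <;> linarith [Nat.cast_nonneg (α := ℝ) j]
        calc _ ≤ (N / 2 : ℝ) * (π / N) := by gcongr
          _ = π / 2 := by field_simp
      calc _ = (4 / π ^ 2) * ((j - ((N:ℝ) - 1) / 2) * t) ^ 2 := by ring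
        _ ≤ _ := sin_sq_ge hb
    rw [sinsq_sum, e1, e2]
    have e4 : (N / 2 : ℝ) * ((4 / π ^ 2) * s ^ 2) ≤ Dk N t * sin s ^ 2 :=
      mul_le_mul hsmall.le (sin_sq_ge hs) (by positivity) hpos
    have e5 : (N : ℝ) ^ 3 * t ^ 2 / (4 * π ^ 2) ≤ (4 / π ^ 2) * t ^ 2 * (N * ((N:ℝ) ^ 2 - 1) / 12) := by
      have : (4 / π ^ 2) * t ^ 2 * (N * ((N:ℝ) ^ 2 - 1) / 12) - (N : ℝ) ^ 3 * t ^ 2 / (4 * π ^ 2) =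
        t ^ 2 / π ^ 2 * (N * ((N ^ 2 - 4) / 12)) := by field_simp; ring
      have h4 : 0 ≤ ((N:ℝ) ^ 2 - 4) / 12 := by nlinarith
      have : 0 ≤ t ^ 2 / π ^ 2 * (N * (((N:ℝ) ^ 2 - 4) / 12)) := by positivity
      linarith
    have e6 : (N : ℝ) * s ^ 2 / (4 * π ^ 2) ≤ (N / 2 : ℝ) * ((4 / π ^ 2) * s ^ 2) := by
      have : (N / 2 : ℝ) * ((4 / π ^ 2) * s ^ 2) - (N : ℝ) * s ^ 2 / (4 * π ^ 2) =
        N * s ^ 2 / π ^ 2 * (7 / 4) := by field_simp; ring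
      have : 0 ≤ N * s ^ 2 / π ^ 2 * (7 / 4) := by positivity
      linarith
    rw [add_div]
    linarith

end trig

end

section


section scaling
open Complex

/-- raw integrand -/
noncomputable def Kraw (p : ℝ) (N : ℕ) (e : ℕ → ℤˣ) (A B : ℤ) (s t : ℝ) : ℂ :=
  exp (-(I * ((s * A + t * (B - (((N:ℝ) - 1) / 2) * A) : ℝ) : ℂ))) *
        ∏ j : Fin N, cf p (e j) (s + (j - ((N:ℝ) - 1) / 2) * t)

/-- truncated integrand -/
noncomputable def Kcut (p : ℝ) (N : ℕ) (e : ℕ → ℤˣ) (A B : ℤ) (s t : ℝ) : ℂ :=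
  if |s| ≤ Real.pi / 2 ∧ |t| ≤ Real.pi / 2 then Kraw p N e A B s t else 0

lemma interval_eq_cut (f : ℝ → ℂ) :
    ∫ s in (-(Real.pi/2))..(Real.pi/2), f s = ∫ s, if |s| ≤ Real.pi / 2 then f s else 0 := by
  have hpi := Real.pi_pos
  rw [intervalIntegral.integral_of_le (by linarith), ← integral_Icc_eq_integral_Ioc,
    ← integral_indicator measurableSet_Icc]
  congr 1
  funext s
  simp only [Set.indicator_apply, Set.mem_Icc, abs_le]

lemma fourier_cut (p : ℝ) (N : ℕ) (e : ℕ → ℤˣ) (A B : ℤ)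
    (hpar : ∀ a : Fin N → ℤˣ, Even (Ssum N e a - A) ∧ Even (Tsum N e a - B)) :
    ((Pr p {a : Fin N → ℤˣ | Ssum N e a = A ∧ Tsum N e a = B} : ℝ) : ℂ) * (Real.pi : ℂ) ^ 2 =
    ∫ t, ∫ s, Kcut p N e A B s t := by
  rw [fourier_Pr p N e A B (((N:ℝ) - 1) / 2) hpar, interval_eq_cut]
  congr 1; funext t
  rw [interval_eq_cut]
  split_ifs with h
  · congr 1; funext s; simp [Kcut, Kraw, h]
  · simp [Kcut, h]

lemma fourier_scaled (p : ℝ) (N : ℕ) (hN : 1 ≤ N) (e : ℕ → ℤˣ) (A B : ℤ)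
    (hpar : ∀ a : Fin N → ℤˣ, Even (Ssum N e a - A) ∧ Even (Tsum N e a - B)) :
    (((N : ℝ) ^ 2 * Pr p {a : Fin N → ℤˣ | Ssum N e a = A ∧ Tsum N e a = B} * Real.pi ^ 2 : ℝ) : ℂ) =
    ∫ v : ℝ, ∫ u : ℝ, Kcut p N e A B (u / √N) (v / (N * √N)) := by
  have hN0 : (0:ℝ) < N := by exact_mod_cast hN
  have hs : (0:ℝ) < √N := Real.sqrt_pos.2 hN0
  have h1 : ∀ v : ℝ, ∫ u : ℝ, Kcut p N e A B (u / √N) (v / (N * √N)) =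
      (√N : ℝ) • ∫ s : ℝ, Kcut p N e A B s (v / (N * √N)) := by
    intro v
    rw [Measure.integral_comp_div (fun s => Kcut p N e A B s (v / (N * √N))), abs_of_pos hs]
  simp only [h1]
  rw [integral_smul, Measure.integral_comp_div (fun t => ∫ s : ℝ, Kcut p N e A B s t),
    ← fourier_cut p N e A B hpar, abs_of_pos (by positivity), smul_smul]
  rw [Complex.real_smul]
  have : √(N:ℝ) * (N * √N) = N ^ 2 := by
    have := Real.mul_self_sqrt hN0.le
    calc _ = N * (√(N:ℝ) * √N) := by ring
      _ = _ := by rw [this]; ring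
  rw [this]; push_cast; ring

lemma Kraw_norm_le (p : ℝ) (N : ℕ) (e : ℕ → ℤˣ) (A B : ℤ) (s t : ℝ) :
    ‖Kraw p N e A B s t‖ ≤ Real.exp (-(2 * p * (1 - p) *
      ∑ j ∈ Finset.range N, Real.sin (s + (j - ((N:ℝ) - 1) / 2) * t) ^ 2)) := by
  unfold Kraw
  rw [norm_mul]
  have h1 : ‖exp (-(I * ((s * A + t * (B - (((N:ℝ) - 1) / 2) * A) : ℝ) : ℂ)))‖ = 1 := by
    rw [mul_comm, ← neg_mul, ← ofReal_neg, norm_exp_ofReal_mul_I]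
  rw [h1, one_mul, norm_prod, ← Fin.sum_univ_eq_sum_range
    (fun j : ℕ => Real.sin (s + (j - ((N:ℝ) - 1) / 2) * t) ^ 2), Finset.mul_sum,
    ← Finset.sum_neg_distrib, Real.exp_sum]
  exact Finset.prod_le_prod (fun _ _ => norm_nonneg _) fun j _ => cf_norm_le _ _ _

lemma Kcut_bound (p : ℝ) (h0 : 0 < p) (h1 : p < 1) : ∃ C : ℝ, 0 < C ∧ ∀ (N : ℕ), 2 ≤ N →
    ∀ (e : ℕ → ℤˣ) (A B : ℤ) (u v : ℝ), ‖Kcut p N e A B (u / √N) (v / (N * √N))‖ ≤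
      C * ((1 + u ^ 2)⁻¹ * (1 + v ^ 2)⁻¹) := by
  have hpi := Real.pi_pos
  have hpi3 := Real.pi_gt_three
  have hpi4 := Real.pi_lt_d2
  set q : ℝ := 2 * p * (1 - p) with hq
  have hq0 : 0 < q := by have : 0 < 1 - p := by linarith
                         positivity
  have hq1 : q ≤ 1 := by nlinarith [sq_nonneg (p - 1/2)]
  set κ : ℝ := q / (4 * Real.pi ^ 2) with hκ
  have hκ0 : 0 < κ := by positivity
  have hκ1 : κ ≤ 1 := by rw [hκ, div_le_one (by positivity)]; nlinarith
  refine ⟨(κ⁻¹) ^ 2 + 16 * 24 * (4 / q) ^ 4, by positivity, ?_⟩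
  intro N hN e A B u v
  have hN2 : (2:ℝ) ≤ N := by exact_mod_cast hN
  have hN0 : (0:ℝ) < N := by linarith
  have hs : (0:ℝ) < √N := Real.sqrt_pos.2 hN0
  have hss := Real.sq_sqrt hN0.le
  have hden : 0 < (1 + u ^ 2) * (1 + v ^ 2) := by positivity
  rw [← mul_inv, ← div_eq_mul_inv, le_div_iff₀ hden]
  unfold Kcut
  split_ifs with h
  swap
  · simp; positivity
  obtain ⟨hu, hv⟩ := h
  have hK := Kraw_norm_le p N e A B (u / √N) (v / (N * √N))
  rw [← hq] at hK
  have eu : N * (u / √N) ^ 2 = u ^ 2 := by rw [div_pow, hss]; field_simp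
  have ev : (N:ℝ) ^ 3 * (v / (N * √N)) ^ 2 = v ^ 2 := by rw [div_pow, mul_pow, hss]; field_simp
  rcases sinsq_lower N hN _ _ hu hv with hc | hc
  · have b1 : ‖Kraw p N e A B (u / √N) (v / (N * √N))‖ ≤ Real.exp (-(q * (N / 4))) := by
      refine hK.trans (Real.exp_le_exp.2 ?_)
      have := mul_le_mul_of_nonneg_left hc hq0.le
      linarith
    have b2 : Real.exp (-(q * (N / 4))) * (16 * N ^ 4) ≤ 16 * 24 * (4 / q) ^ 4 := by
      rw [Real.exp_neg]
      have := Real.pow_div_factorial_le_exp (q * (N / 4)) (by positivity) 4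
      have hf : ((Nat.factorial 4 : ℕ) : ℝ) = 24 := by norm_num [Nat.factorial]
      rw [hf] at this
      rw [inv_mul_le_iff₀ (Real.exp_pos _)]
      calc (16 * (N:ℝ) ^ 4) = ((q * (N / 4)) ^ 4 / 24) * (16 * 24 * (4 / q) ^ 4) := by field_simp
        _ ≤ _ := by gcongr
    have b3 : (1 + u ^ 2) * (1 + v ^ 2) ≤ 16 * N ^ 4 := by
      have u2 : u ^ 2 ≤ 3 * N := by
        rw [← eu]
        have : (u / √N) ^ 2 ≤ (Real.pi / 2) ^ 2 := by
          rw [← sq_abs (u / √N)]; exact pow_le_pow_left₀ (abs_nonneg _) hu 2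
        have h3 : (Real.pi / 2) ^ 2 ≤ 3 := by nlinarith
        have : (u / √N) ^ 2 ≤ 3 := by linarith
        nlinarith
      have v2 : v ^ 2 ≤ 3 * N ^ 3 := by
        rw [← ev]
        have : (v / (N * √N)) ^ 2 ≤ (Real.pi / 2) ^ 2 := by
          rw [← sq_abs (v / (N * √N))]; exact pow_le_pow_left₀ (abs_nonneg _) hv 2
        have h3 : (Real.pi / 2) ^ 2 ≤ 3 := by nlinarith
        have : (v / (N * √N)) ^ 2 ≤ 3 := by linarith
        have hn3 : (0:ℝ) ≤ (N:ℝ)^3 := by positivity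
        nlinarith
      have a1 : 1 + u ^ 2 ≤ 4 * N := by linarith
      have a2 : 1 + v ^ 2 ≤ 4 * N ^ 3 := by
        have : (1:ℝ) ≤ (N:ℝ)^3 := one_le_pow₀ (by linarith)
        linarith
      calc _ ≤ (4 * N : ℝ) * (4 * N ^ 3) := by gcongr
        _ = _ := by ring
    calc _ ≤ Real.exp (-(q * (N / 4))) * (16 * N ^ 4) := by gcongr
      _ ≤ _ := b2
      _ ≤ _ := by have : 0 ≤ κ⁻¹ ^ 2 := by positivity
                  linarith
  · rw [eu, ev] at hc
    have b1 : ‖Kraw p N e A B (u / √N) (v / (N * √N))‖ ≤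
        Real.exp (-(κ * u ^ 2)) * Real.exp (-(κ * v ^ 2)) := by
      rw [← Real.exp_add]
      refine hK.trans (Real.exp_le_exp.2 ?_)
      have := mul_le_mul_of_nonneg_left hc hq0.le
      have e : q * ((u ^ 2 + v ^ 2) / (4 * Real.pi ^ 2)) = κ * u ^ 2 + κ * v ^ 2 := by
        rw [hκ]; field_simp
      linarith
    have b2 : ∀ x : ℝ, Real.exp (-(κ * x ^ 2)) * (1 + x ^ 2) ≤ κ⁻¹ := by
      intro x
      rw [Real.exp_neg, inv_mul_le_iff₀ (Real.exp_pos _), ← div_eq_mul_inv, le_div_iff₀ hκ0]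
      have := Real.add_one_le_exp (κ * x ^ 2)
      nlinarith
    calc _ ≤ (Real.exp (-(κ * u ^ 2)) * Real.exp (-(κ * v ^ 2))) * ((1 + u ^ 2) * (1 + v ^ 2)) := by
          gcongr
      _ = (Real.exp (-(κ * u ^ 2)) * (1 + u ^ 2)) * (Real.exp (-(κ * v ^ 2)) * (1 + v ^ 2)) := by ring
      _ ≤ κ⁻¹ * κ⁻¹ := mul_le_mul (b2 u) (b2 v) (by positivity) (by positivity)
      _ ≤ _ := by have : 0 ≤ 16 * 24 * (4 / q) ^ 4 := by positivity
                  nlinarith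

lemma parity_S (N : ℕ) (e : ℕ → ℤˣ) (a b : Fin N → ℤˣ) : Even (Ssum N e a - Ssum N e b) := by
  unfold Ssum
  rw [← Finset.sum_sub_distrib]
  refine Finset.even_sum _ fun j _ => ?_
  rcases Int.units_eq_one_or (a j) with h | h <;> rcases Int.units_eq_one_or (b j) with h' | h' <;>
  rcases Int.units_eq_one_or (e j) with h'' | h'' <;> rw [h, h', h''] <;> decide

lemma parity_T (N : ℕ) (e : ℕ → ℤˣ) (a b : Fin N → ℤˣ) : Even (Tsum N e a - Tsum N e b) := by
  unfold Tsum
  rw [← Finset.sum_sub_distrib]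
  refine Finset.even_sum _ fun j _ => ?_
  rw [← mul_sub]
  apply Even.mul_left
  rcases Int.units_eq_one_or (a j) with h | h <;> rcases Int.units_eq_one_or (b j) with h' | h' <;>
  rcases Int.units_eq_one_or (e j) with h'' | h'' <;> rw [h, h', h''] <;> decide

/-- concentration -/
lemma Pr_conc (p : ℝ) (h0 : 0 < p) (h1 : p < 1) : ∃ C : ℝ, 0 < C ∧ ∀ (N : ℕ), 2 ≤ N →
    ∀ (e : ℕ → ℤˣ) (A B : ℤ),
      Pr p {a : Fin N → ℤˣ | Ssum N e a = A ∧ Tsum N e a = B} ≤ C / (N : ℝ) ^ 2 := by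
  obtain ⟨C, hC, hb⟩ := Kcut_bound p h0 h1
  refine ⟨C, hC, fun N hN e A B => ?_⟩
  have hN2 : (2:ℝ) ≤ N := by exact_mod_cast hN
  rcases Set.eq_empty_or_nonempty {a : Fin N → ℤˣ | Ssum N e a = A ∧ Tsum N e a = B} with he | he
  · rw [he, Pr_empty]; positivity
  obtain ⟨b, hbA, hbB⟩ := he
  have hpar : ∀ a : Fin N → ℤˣ, Even (Ssum N e a - A) ∧ Even (Tsum N e a - B) := fun a => by
    rw [← hbA, ← hbB]; exact ⟨parity_S N e a b, parity_T N e a b⟩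
  have h := fourier_scaled p N (by omega) e A B hpar
  have hi := integrable_inv_one_add_sq
  have hval := integral_univ_inv_one_add_sq
  have n1 : ∀ v : ℝ, ‖∫ u : ℝ, Kcut p N e A B (u / √N) (v / (N * √N))‖ ≤
      C * Real.pi * (1 + v ^ 2)⁻¹ := by
    intro v
    refine (norm_integral_le_of_norm_le ((hi.mul_const ((1 + v ^ 2)⁻¹)).const_mul C)
      (ae_of_all _ fun u => hb N hN e A B u v)).trans (le_of_eq ?_)
    rw [integral_const_mul, integral_mul_const, hval]; ring
  have n2 : ‖∫ v : ℝ, ∫ u : ℝ, Kcut p N e A B (u / √N) (v / (N * √N))‖ ≤ C * Real.pi * Real.pi := by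
    refine (norm_integral_le_of_norm_le (hi.const_mul (C * Real.pi)) (ae_of_all _ n1)).trans
      (le_of_eq ?_)
    rw [integral_const_mul, hval]
  rw [← h, Complex.norm_real, Real.norm_eq_abs] at n2
  have n3 := (le_abs_self _).trans n2
  have hpi := Real.pi_pos
  rw [le_div_iff₀ (by positivity)]
  have : (N:ℝ) ^ 2 * Pr p {a : Fin N → ℤˣ | Ssum N e a = A ∧ Tsum N e a = B} ≤ C := by
    apply le_of_mul_le_mul_right _ (by positivity : 0 < Real.pi ^ 2)
    linarith
  linarith

end scaling

end

section


section llt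
open Complex

lemma norm_prod_sub_le {ι : Type} (s : Finset ι) (x y : ι → ℂ)
    (hx : ∀ i ∈ s, ‖x i‖ ≤ 1) (hy : ∀ i ∈ s, ‖y i‖ ≤ 1) :
    ‖∏ i ∈ s, x i - ∏ i ∈ s, y i‖ ≤ ∑ i ∈ s, ‖x i - y i‖ := by
  classical
  induction s using Finset.induction_on with
  | empty => simp
  | insert a s ha ih =>
    rw [Finset.prod_insert ha, Finset.prod_insert ha, Finset.sum_insert ha]
    have ih' := ih (fun i hi => hx i (Finset.mem_insert_of_mem hi))
      (fun i hi => hy i (Finset.mem_insert_of_mem hi))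
    have e : x a * ∏ i ∈ s, x i - y a * ∏ i ∈ s, y i =
      (x a - y a) * ∏ i ∈ s, x i + y a * (∏ i ∈ s, x i - ∏ i ∈ s, y i) := by ring
    rw [e]
    have h1 : ‖∏ i ∈ s, x i‖ ≤ 1 := by
      rw [norm_prod]
      exact Finset.prod_le_one (fun _ _ => norm_nonneg _)
        (fun i hi => hx i (Finset.mem_insert_of_mem hi))
    calc _ ≤ ‖x a - y a‖ * ‖∏ i ∈ s, x i‖ + ‖y a‖ * ‖∏ i ∈ s, x i - ∏ i ∈ s, y i‖ := by
          refine (norm_add_le _ _).trans ?_; rw [norm_mul, norm_mul]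
      _ ≤ ‖x a - y a‖ * 1 + 1 * ∑ i ∈ s, ‖x i - y i‖ := by
          gcongr
          exact hy a (Finset.mem_insert_self _ _)
      _ = _ := by ring

lemma exp_taylor (z : ℂ) (hz : ‖z‖ ≤ 1) : ‖exp z - (1 + z + z ^ 2 / 2)‖ ≤ ‖z‖ ^ 3 := by
  have h := Complex.exp_bound hz (n := 3) (by norm_num)
  have e : ∑ m ∈ Finset.range 3, z ^ m / (m.factorial : ℂ) = 1 + z + z ^ 2 / 2 := by
    simp [Finset.sum_range_succ, Nat.factorial]
  rw [e] at h
  refine h.trans ?_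
  have : ((Nat.succ 3 : ℕ) : ℝ) * (((Nat.factorial 3 : ℕ) : ℝ) * ((3:ℕ):ℝ))⁻¹ ≤ 1 := by
    norm_num [Nat.factorial]
  calc _ ≤ ‖z‖ ^ 3 * 1 := by gcongr
    _ = _ := mul_one _

/-- gaussian approximation to `cf` -/
noncomputable def gf (p : ℝ) (e : ℤˣ) (θ : ℝ) : ℂ :=
  exp (I * (((e : ℤ) : ℝ) * (2 * p - 1) * θ : ℝ) - (2 * p * (1 - p) * θ ^ 2 : ℝ))

lemma cf_taylor (p : ℝ) (h0 : 0 < p) (h1 : p < 1) (e : ℤˣ) (θ : ℝ) (hθ : |θ| ≤ 1 / 2) :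
    ‖cf p e θ - gf p e θ‖ ≤ 12 * |θ| ^ 3 := by
  obtain ⟨x, hx⟩ : ∃ x : ℝ, x = ((e : ℤ) : ℝ) * θ := ⟨_, rfl⟩
  have hxa : |x| = |θ| := by
    rw [hx, abs_mul]; rcases Int.units_eq_one_or e with rfl | rfl <;> simp
  have hx2 : θ ^ 2 = x ^ 2 := by rw [← sq_abs, ← hxa, sq_abs]
  obtain ⟨q, hq⟩ : ∃ q : ℝ, q = 2 * p * (1 - p) := ⟨_, rfl⟩
  have hq0 : 0 < q := by
    have : 0 < 1 - p := by linarith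
    rw [hq]; positivity
  have hq1 : q ≤ 1 / 2 := by nlinarith [sq_nonneg (p - 1/2)]
  have hm : |2 * p - 1| ≤ 1 := by rw [abs_le]; constructor <;> linarith
  have hw : (((e : ℤ) : ℝ) * (2 * p - 1) * θ) = (2 * p - 1) * x := by rw [hx]; ring
  set z : ℂ := I * (((2 * p - 1) * x : ℝ)) - ((q * x ^ 2 : ℝ) : ℂ) with hz
  have hg : gf p e θ = exp z := by unfold gf; rw [hw, hx2, ← hq]
  have hax : |x| ≤ 1 / 2 := by rw [hxa]; exact hθ
  have hx0 := abs_nonneg x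
  have nz : ‖z‖ ≤ 2 * |x| := by
    refine (norm_sub_le _ _).trans ?_
    rw [norm_mul, norm_I, one_mul, Complex.norm_real, Complex.norm_real, Real.norm_eq_abs,
      Real.norm_eq_abs, abs_mul, abs_mul, abs_of_pos hq0, abs_pow]
    nlinarith [mul_le_mul_of_nonneg_right hm hx0, mul_nonneg hx0 hx0, pow_two_nonneg |x|]
  have T1 := exp_taylor (I * (x : ℝ)) (by rw [norm_mul, norm_I, Complex.norm_real, Real.norm_eq_abs]; linarith)
  have T2 := exp_taylor (-(I * (x : ℝ))) (by rw [norm_neg, norm_mul, norm_I, Complex.norm_real, Real.norm_eq_abs]; linarith)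
  have T3 := exp_taylor z (by linarith)
  rw [norm_mul, norm_I, Complex.norm_real, Real.norm_eq_abs, one_mul] at T1
  rw [norm_neg, norm_mul, norm_I, Complex.norm_real, Real.norm_eq_abs, one_mul] at T2
  have T3' : ‖exp z - (1 + z + z ^ 2 / 2)‖ ≤ 8 * |x| ^ 3 := T3.trans (by
    calc ‖z‖ ^ 3 ≤ (2 * |x|) ^ 3 := by gcongr
      _ = _ := by ring)
  have hI : (I : ℂ) ^ 2 = -1 := I_sq
  have key : cf p e θ - gf p e θ =
      p * (exp (I * (x : ℝ)) - (1 + I * (x:ℝ) + (I * (x:ℝ)) ^ 2 / 2)) +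
      (1 - p) * (exp (-(I * (x : ℝ))) - (1 + -(I * (x:ℝ)) + (-(I * (x:ℝ))) ^ 2 / 2)) -
      (exp z - (1 + z + z ^ 2 / 2)) +
      (I * (((2 * p - 1) * q * x ^ 3 : ℝ) : ℂ) - ((q ^ 2 * x ^ 4 / 2 : ℝ) : ℂ)) := by
    rw [hg, cf, hz, hq, ← hx]
    push_cast
    linear_combination ((1 / 2) * (x:ℂ) ^ 2 * (1 - (2 * (p:ℂ) - 1) ^ 2)) * hI
  have R : ‖(I * (((2 * p - 1) * q * x ^ 3 : ℝ) : ℂ) - ((q ^ 2 * x ^ 4 / 2 : ℝ) : ℂ))‖ ≤ 2 * |x| ^ 3 := by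
    refine (norm_sub_le _ _).trans ?_
    rw [norm_mul, norm_I, one_mul, Complex.norm_real, Complex.norm_real, Real.norm_eq_abs,
      Real.norm_eq_abs, abs_mul, abs_mul, abs_of_pos hq0, abs_pow, abs_div, abs_mul, abs_pow, abs_pow,
      abs_of_pos hq0, abs_of_pos (by norm_num : (0:ℝ) < 2)]
    have a1 : |2 * p - 1| * q ≤ 1 := by
      calc _ ≤ 1 * (1/2 : ℝ) := mul_le_mul hm hq1 hq0.le zero_le_one
        _ ≤ 1 := by norm_num
    have a2 : q ^ 2 ≤ 1 := pow_le_one₀ hq0.le (by linarith)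
    have a3 : |x| ^ 4 ≤ |x| ^ 3 := pow_le_pow_of_le_one hx0 (by linarith) (by norm_num)
    have a4 : 0 ≤ |x| ^ 4 := by positivity
    have a5 : 0 ≤ |x| ^ 3 := by positivity
    nlinarith [mul_le_mul_of_nonneg_right a1 a5, mul_le_mul_of_nonneg_right a2 a4]
  rw [key, ← hxa]
  have n1 : ‖(p:ℂ) * (exp (I * (x : ℝ)) - (1 + I * (x:ℝ) + (I * (x:ℝ)) ^ 2 / 2))‖ ≤ |x| ^ 3 := by
    rw [norm_mul, Complex.norm_real, Real.norm_eq_abs, abs_of_pos h0]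
    calc _ ≤ 1 * |x| ^ 3 := mul_le_mul h1.le T1 (norm_nonneg _) zero_le_one
      _ = _ := one_mul _
  have n2 : ‖(1 - p:ℂ) * (exp (-(I * (x : ℝ))) - (1 + -(I * (x:ℝ)) + (-(I * (x:ℝ))) ^ 2 / 2))‖ ≤
      |x| ^ 3 := by
    rw [norm_mul, show (1 - p : ℂ) = ((1 - p : ℝ) : ℂ) by push_cast; rfl, Complex.norm_real,
      Real.norm_eq_abs, abs_of_pos (by linarith)]
    calc _ ≤ 1 * |x| ^ 3 := mul_le_mul (by linarith) T2 (norm_nonneg _) zero_le_one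
      _ = _ := one_mul _
  refine (norm_add_le _ _).trans ?_
  have := norm_sub_le (p * (exp (I * (x : ℝ)) - (1 + I * (x:ℝ) + (I * (x:ℝ)) ^ 2 / 2)) +
      (1 - p) * (exp (-(I * (x : ℝ))) - (1 + -(I * (x:ℝ)) + (-(I * (x:ℝ))) ^ 2 / 2)))
      (exp z - (1 + z + z ^ 2 / 2))
  have := norm_add_le (p * (exp (I * (x : ℝ)) - (1 + I * (x:ℝ) + (I * (x:ℝ)) ^ 2 / 2)))
      ((1 - p) * (exp (-(I * (x : ℝ))) - (1 + -(I * (x:ℝ)) + (-(I * (x:ℝ))) ^ 2 / 2)))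
  linarith

lemma cf_norm_le_one (p : ℝ) (h0 : 0 < p) (h1 : p < 1) (e : ℤˣ) (θ : ℝ) : ‖cf p e θ‖ ≤ 1 := by
  refine (cf_norm_le p e θ).trans (Real.exp_le_one_iff.2 ?_)
  have : 0 < 1 - p := by linarith
  have : 0 ≤ (2 * p * (1 - p) * Real.sin θ ^ 2) := by positivity
  linarith

lemma gf_norm_le_one (p : ℝ) (h0 : 0 < p) (h1 : p < 1) (e : ℤˣ) (θ : ℝ) : ‖gf p e θ‖ ≤ 1 := by
  unfold gf
  rw [Complex.norm_exp]
  apply Real.exp_le_one_iff.2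
  have : 0 < 1 - p := by linarith
  have : 0 ≤ (2 * p * (1 - p) * θ ^ 2) := by positivity
  simp only [sub_re, mul_re, I_re, I_im, ofReal_re, ofReal_im]
  linarith

/-- alternating signs -/
def alt (j : ℕ) : ℤˣ := (-1) ^ j

lemma alt_sum (N : ℕ) (c : ℝ) :
    |∑ j ∈ Finset.range N, (((alt j : ℤˣ) : ℤ) : ℝ) * (j - c)| ≤ N + |c| := by
  have h : ∀ M : ℕ, ∑ j ∈ Finset.range M, (((alt j : ℤˣ) : ℤ) : ℝ) * (j - c) =
      if Even M then -(M : ℝ) / 2 else ((M:ℝ) - 1) / 2 - c := by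
    intro M
    induction M with
    | zero => simp
    | succ M ih =>
      rw [Finset.sum_range_succ, ih]
      by_cases hM : Even M
      · have h2 : ¬ Even (M + 1) := by rw [Nat.even_add_one]; simpa using hM
        rw [if_pos hM, if_neg h2]
        simp only [alt, hM.neg_one_pow]; push_cast; ring
      · have h2 : Even (M + 1) := Nat.even_add_one.2 hM
        rw [if_neg hM, if_pos h2]
        simp only [alt, (Nat.not_even_iff_odd.1 hM).neg_one_pow]; push_cast; ring
  rw [h]
  have hn := Nat.cast_nonneg (α := ℝ) N
  have hc := abs_nonneg c
  split_ifs with hN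
  · rw [abs_le]; constructor <;> linarith
  · have h1 : 1 ≤ N := by
      rcases Nat.eq_zero_or_pos N with rfl | h
      · simp at hN
      · exact h
    have h1' : (1:ℝ) ≤ N := by exact_mod_cast h1
    have := neg_abs_le c
    have := le_abs_self c
    rw [abs_le]; constructor <;> linarith

lemma alt_sum0 (N : ℕ) : |∑ j ∈ Finset.range N, (((alt j : ℤˣ) : ℤ) : ℝ)| ≤ 1 := by
  have h : ∀ M : ℕ, ∑ j ∈ Finset.range M, (((alt j : ℤˣ) : ℤ) : ℝ) =
      if Even M then 0 else 1 := by
    intro M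
    induction M with
    | zero => simp
    | succ M ih =>
      rw [Finset.sum_range_succ, ih]
      by_cases hM : Even M
      · have h2 : ¬ Even (M + 1) := by rw [Nat.even_add_one]; simpa using hM
        rw [if_pos hM, if_neg h2]
        simp only [alt, hM.neg_one_pow]; simp
      · have h2 : Even (M + 1) := Nat.even_add_one.2 hM
        rw [if_neg hM, if_pos h2]
        simp only [alt, (Nat.not_even_iff_odd.1 hM).neg_one_pow]; simp
  rw [h]; split_ifs <;> simp

end llt

end

section


section llt2
open Complex

lemma lin_sum (N : ℕ) : ∑ j ∈ Finset.range N, ((j : ℝ) - ((N:ℝ) - 1) / 2) = 0 := by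
  have h : ∀ (M : ℕ) (c : ℝ), ∑ j ∈ Finset.range M, ((j : ℝ) - c) =
      M * (M - 1) / 2 - c * M := by
    intro M c
    induction M with
    | zero => simp
    | succ M ih => rw [Finset.sum_range_succ, ih]; push_cast; ring
  rw [h]; ring

lemma theta_sq_sum (N : ℕ) (s t : ℝ) :
    ∑ j ∈ Finset.range N, (s + ((j : ℝ) - ((N:ℝ) - 1) / 2) * t) ^ 2 =
      N * s ^ 2 + t ^ 2 * (N * ((N:ℝ) ^ 2 - 1) / 12) := by
  have : ∀ j : ℕ, (s + ((j : ℝ) - ((N:ℝ) - 1) / 2) * t) ^ 2 =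
    s ^ 2 + 2 * s * t * ((j : ℝ) - ((N:ℝ) - 1) / 2) + t ^ 2 * ((j : ℝ) - ((N:ℝ) - 1) / 2) ^ 2 := by
    intro j; ring
  simp only [this]
  rw [Finset.sum_add_distrib, Finset.sum_add_distrib, ← Finset.mul_sum, ← Finset.mul_sum, lin_sum,
    sq_sum]
  simp

lemma Kcut_tendsto (p : ℝ) (h0 : 0 < p) (h1 : p < 1) (u v : ℝ) :
    Tendsto (fun N : ℕ => Kcut p N alt 0 0 (u / √N) (v / (N * √N))) atTop
      (nhds ((Real.exp (-(2 * p * (1 - p) * (u ^ 2 + v ^ 2 / 12))) : ℝ) : ℂ)) := by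
  have hpi := Real.pi_gt_three
  have hsq : Tendsto (fun N : ℕ => √(N:ℝ)) atTop atTop :=
    Real.tendsto_sqrt_atTop.comp tendsto_natCast_atTop_atTop
  have hz : ∀ C : ℝ, Tendsto (fun N : ℕ => C / √(N:ℝ)) atTop (nhds 0) := fun C =>
    tendsto_const_nhds.div_atTop hsq
  set q : ℝ := 2 * p * (1 - p) with hq
  let X : ℕ → ℝ := fun N => ∑ j ∈ Finset.range N, (((alt j : ℤˣ) : ℤ) : ℝ) *
    (u / √N + (j - ((N:ℝ) - 1) / 2) * (v / (N * √N)))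
  let Y : ℕ → ℝ := fun N => ∑ j ∈ Finset.range N,
    (u / √N + (j - ((N:ℝ) - 1) / 2) * (v / (N * √N))) ^ 2
  have hX : Tendsto X atTop (nhds 0) := by
    apply squeeze_zero_norm' _ (hz (|u| + 2 * |v|))
    filter_upwards [eventually_ge_atTop 1] with N hN
    have hN1 : (1:ℝ) ≤ N := by exact_mod_cast hN
    have hN0 : (0:ℝ) < N := by linarith
    have hs : (0:ℝ) < √N := Real.sqrt_pos.2 hN0
    have e : X N = (u / √N) * ∑ j ∈ Finset.range N, (((alt j : ℤˣ) : ℤ) : ℝ) +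
        (v / (N * √N)) * ∑ j ∈ Finset.range N, (((alt j : ℤˣ) : ℤ) : ℝ) * (j - ((N:ℝ) - 1) / 2) := by
      simp only [X]
      rw [Finset.mul_sum, Finset.mul_sum, ← Finset.sum_add_distrib]
      exact Finset.sum_congr rfl fun j _ => by ring
    rw [e, Real.norm_eq_abs]
    refine (abs_add_le _ _).trans ?_
    rw [abs_mul, abs_mul]
    have hc : |((N:ℝ) - 1) / 2| ≤ N := by rw [abs_le]; constructor <;> linarith
    calc _ ≤ |u / √N| * 1 + |v / (N * √N)| * (N + N) := by
          gcongr
          · exact alt_sum0 N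
          · exact (alt_sum N _).trans (by linarith)
      _ = _ := by
          rw [abs_div, abs_div, abs_of_pos hs, abs_of_pos (by positivity : 0 < (N:ℝ) * √N)]
          field_simp; ring
  have hY : Tendsto Y atTop (nhds (u ^ 2 + v ^ 2 / 12)) := by
    have e : ∀ᶠ N : ℕ in atTop, u ^ 2 + v ^ 2 / 12 * (1 - 1 / (N:ℝ) * (1 / (N:ℝ))) = Y N := by
      filter_upwards [eventually_ge_atTop 1] with N hN
      have hN1 : (1:ℝ) ≤ N := by exact_mod_cast hN
      have hN0 : (0:ℝ) < N := by linarith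
      have hss := Real.sq_sqrt hN0.le
      simp only [Y]
      rw [theta_sq_sum, div_pow, div_pow, mul_pow, hss]
      field_simp
    refine Tendsto.congr' e ?_
    have h := tendsto_one_div_atTop_nhds_zero_nat (𝕜 := ℝ)
    have := ((tendsto_const_nhds (x := (1:ℝ))).sub (h.mul h)).const_mul (v ^ 2 / 12)
    have := (tendsto_const_nhds (x := u ^ 2)).add this
    simpa using this
  have hlim : Tendsto (fun N : ℕ => exp (I * (((2 * p - 1) * X N : ℝ) : ℂ) - ((q * Y N : ℝ) : ℂ)))
      atTop (nhds ((Real.exp (-(q * (u ^ 2 + v ^ 2 / 12))) : ℝ) : ℂ)) := by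
    have hA : Tendsto (fun N : ℕ => (((2 * p - 1) * X N : ℝ) : ℂ)) atTop (nhds (0 : ℂ)) := by
      have := (continuous_ofReal.tendsto _).comp (hX.const_mul (2 * p - 1))
      simpa [Function.comp_def] using this
    have hB : Tendsto (fun N : ℕ => ((q * Y N : ℝ) : ℂ)) atTop
        (nhds ((q * (u ^ 2 + v ^ 2 / 12) : ℝ) : ℂ)) :=
      (continuous_ofReal.tendsto _).comp (hY.const_mul q)
    have := (continuous_exp.tendsto _).comp ((hA.const_mul I).sub hB)
    simpa [Function.comp_def] using this
  have hdiff : Tendsto (fun N : ℕ => Kcut p N alt 0 0 (u / √N) (v / (N * √N)) -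
      exp (I * (((2 * p - 1) * X N : ℝ) : ℂ) - ((q * Y N : ℝ) : ℂ))) atTop (nhds 0) := by
    apply squeeze_zero_norm' _ (hz (12 * (|u| + |v|) ^ 3))
    filter_upwards [eventually_ge_atTop 1, (hz (|u| + |v|)).eventually_le_const
      (by norm_num : (0:ℝ) < 1 / 2)] with N hN hsm
    have hN1 : (1:ℝ) ≤ N := by exact_mod_cast hN
    have hN0 : (0:ℝ) < N := by linarith
    have hs : (0:ℝ) < √N := Real.sqrt_pos.2 hN0
    have hss := Real.sq_sqrt hN0.le
    have hu : |u / √N| ≤ (|u| + |v|) / √N := by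
      rw [abs_div, abs_of_pos hs]; gcongr; linarith [abs_nonneg v]
    have hv' : |v / (N * √N)| * N ≤ |v| / √N := by
      rw [abs_div, abs_of_pos (by positivity : 0 < (N:ℝ) * √N)]
      apply le_of_eq; field_simp
    have hv : |v / (N * √N)| ≤ (|u| + |v|) / √N := by
      have : |v / (N * √N)| * 1 ≤ |v / (N * √N)| * N := by gcongr
      have : |v| / √N ≤ (|u| + |v|) / √N := by gcongr; linarith [abs_nonneg u]
      linarith
    have hK : Kcut p N alt 0 0 (u / √N) (v / (N * √N)) =
        ∏ j ∈ Finset.range N, cf p (alt j) (u / √N + (j - ((N:ℝ) - 1) / 2) * (v / (N * √N))) := by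
      rw [Kcut, if_pos ⟨by linarith, by linarith⟩, Kraw]
      rw [← Fin.prod_univ_eq_prod_range
        (fun j => cf p (alt j) (u / √N + (j - ((N:ℝ) - 1) / 2) * (v / (N * √N))))]
      simp
    have hG : exp (I * (((2 * p - 1) * X N : ℝ) : ℂ) - ((q * Y N : ℝ) : ℂ)) =
        ∏ j ∈ Finset.range N, gf p (alt j) (u / √N + (j - ((N:ℝ) - 1) / 2) * (v / (N * √N))) := by
      simp only [gf, ← exp_sum, X, Y, Finset.mul_sum, Finset.sum_sub_distrib, ofReal_sum]
      congr 3
      funext j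
      congr 2
      ring
    rw [hK, hG]
    refine (norm_prod_sub_le _ _ _ (fun j _ => cf_norm_le_one p h0 h1 _ _)
      (fun j _ => gf_norm_le_one p h0 h1 _ _)).trans ?_
    have hth : ∀ j ∈ Finset.range N, |u / √N + (j - ((N:ℝ) - 1) / 2) * (v / (N * √N))| ≤
        (|u| + |v|) / √N := by
      intro j hj
      refine (abs_add_le _ _).trans ?_
      rw [abs_mul, add_div]
      have hj' : (j : ℝ) + 1 ≤ N := by exact_mod_cast Finset.mem_range.1 hj
      have hjc : |(j - ((N:ℝ) - 1) / 2)| ≤ N := by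
        rw [abs_le]; constructor <;> linarith [Nat.cast_nonneg (α := ℝ) j]
      have e1 : |u / √N| = |u| / √N := by rw [abs_div, abs_of_pos hs]
      have e2 : |(j - ((N:ℝ) - 1) / 2)| * |v / (N * √N)| ≤ N * |v / (N * √N)| := by gcongr
      linarith
    calc _ ≤ ∑ j ∈ Finset.range N, 12 * ((|u| + |v|) / √N) ^ 3 := by
          refine Finset.sum_le_sum fun j hj => ?_
          refine (cf_taylor p h0 h1 _ _ ((hth j hj).trans hsm)).trans ?_
          gcongr
          exact hth j hj
      _ = _ := by
          rw [Finset.sum_const, Finset.card_range, nsmul_eq_mul, div_pow]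
          have : √(N:ℝ) ^ 3 = N * √N := by rw [pow_succ, hss]
          rw [this]; field_simp
  have := hdiff.add hlim
  simpa using this

lemma cf_continuous (p : ℝ) (e : ℤˣ) : Continuous (cf p e) := by
  unfold cf; fun_prop

lemma Kcut_measurable (p : ℝ) (N : ℕ) (e : ℕ → ℤˣ) (A B : ℤ) :
    Measurable (fun z : ℝ × ℝ => Kcut p N e A B (z.2 / √N) (z.1 / (N * √N))) := by
  unfold Kcut
  apply Measurable.ite
  · have a1 : Measurable (fun z : ℝ × ℝ => |z.2 / √(N:ℝ)|) := by fun_prop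
    have a2 : Measurable (fun z : ℝ × ℝ => |z.1 / (N * √(N:ℝ))|) := by fun_prop
    exact (measurableSet_le a1 measurable_const).inter (measurableSet_le a2 measurable_const)
  · apply Continuous.measurable
    unfold Kraw
    have := cf_continuous p
    fun_prop
  · exact measurable_const

lemma llt_integral (p : ℝ) (h0 : 0 < p) (h1 : p < 1) :
    Tendsto (fun N : ℕ => ∫ v : ℝ, ∫ u : ℝ, Kcut p N alt 0 0 (u / √N) (v / (N * √N))) atTop
      (nhds ((4 * √3 * Real.pi / (4 * p * (1 - p)) : ℝ) : ℂ)) := by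
  obtain ⟨C, hC, hb⟩ := Kcut_bound p h0 h1
  have hp1 : 0 < 1 - p := by linarith
  have hi := integrable_inv_one_add_sq
  have hval := integral_univ_inv_one_add_sq
  have hmeas := fun N => (Kcut_measurable p N alt 0 0)
  have hinner : ∀ v : ℝ, Tendsto (fun N : ℕ => ∫ u : ℝ, Kcut p N alt 0 0 (u / √N) (v / (N * √N)))
      atTop (nhds (∫ u : ℝ, ((Real.exp (-(2 * p * (1 - p) * (u ^ 2 + v ^ 2 / 12))) : ℝ) : ℂ))) := by
    intro v
    apply tendsto_integral_filter_of_dominated_convergence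
      (fun u => C * ((1 + u ^ 2)⁻¹ * (1 + v ^ 2)⁻¹))
    · refine Eventually.of_forall fun N => ?_
      exact ((hmeas N).comp (measurable_prodMk_left (x := v))).aestronglyMeasurable
    · filter_upwards [eventually_ge_atTop 2] with N hN
      exact ae_of_all _ fun u => hb N hN alt 0 0 u v
    · exact (hi.mul_const ((1 + v ^ 2)⁻¹)).const_mul C
    · exact ae_of_all _ fun u => Kcut_tendsto p h0 h1 u v
  have houter : Tendsto (fun N : ℕ => ∫ v : ℝ, ∫ u : ℝ, Kcut p N alt 0 0 (u / √N) (v / (N * √N)))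
      atTop (nhds (∫ v : ℝ, ∫ u : ℝ,
        ((Real.exp (-(2 * p * (1 - p) * (u ^ 2 + v ^ 2 / 12))) : ℝ) : ℂ))) := by
    apply tendsto_integral_filter_of_dominated_convergence
      (fun v => C * Real.pi * (1 + v ^ 2)⁻¹)
    · refine Eventually.of_forall fun N => ?_
      exact ((hmeas N).stronglyMeasurable.integral_prod_right).aestronglyMeasurable
    · filter_upwards [eventually_ge_atTop 2] with N hN
      refine ae_of_all _ fun v => ?_
      refine (norm_integral_le_of_norm_le ((hi.mul_const ((1 + v ^ 2)⁻¹)).const_mul C)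
        (ae_of_all _ fun u => hb N hN alt 0 0 u v)).trans (le_of_eq ?_)
      rw [integral_const_mul, integral_mul_const, hval]; ring
    · exact hi.const_mul (C * Real.pi)
    · exact ae_of_all _ hinner
  convert houter using 2
  have e : ∀ v u : ℝ, Real.exp (-(2 * p * (1 - p) * (u ^ 2 + v ^ 2 / 12))) =
      Real.exp (-(2 * p * (1 - p)) * u ^ 2) * Real.exp (-(p * (1 - p) / 6) * v ^ 2) := by
    intro v u; rw [← Real.exp_add]; congr 1; ring
  simp only [e, integral_complex_ofReal, integral_mul_const, integral_const_mul, integral_gaussian]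
  congr 1
  rw [← Real.sqrt_mul (by positivity)]
  have : Real.pi / (2 * p * (1 - p)) * (Real.pi / (p * (1 - p) / 6)) =
    (Real.pi / (p * (1 - p))) ^ 2 * 3 := by field_simp; norm_num
  rw [this, Real.sqrt_mul (by positivity), Real.sqrt_sq (by positivity)]
  field_simp

end llt2

end

section


lemma ref_S (N : ℕ) : Ssum N alt (fun j => alt j) = N := by
  unfold Ssum
  have : ∀ j : Fin N, ((alt j : ℤˣ) : ℤ) * ((alt j : ℤˣ) : ℤ) = 1 := fun j => by
    rcases Int.units_eq_one_or (alt j) with h | h <;> rw [h] <;> rfl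
  simp [this]

lemma ref_T (N : ℕ) : Tsum N alt (fun j => alt j) * 2 = N * (N - 1) := by
  unfold Tsum
  have : ∀ j : Fin N, ((alt j : ℤˣ) : ℤ) * ((alt j : ℤˣ) : ℤ) = 1 := fun j => by
    rcases Int.units_eq_one_or (alt j) with h | h <;> rw [h] <;> rfl
  simp only [this, mul_one]
  rw [Fin.sum_univ_eq_sum_range (fun j : ℕ => (j : ℤ)) N]
  induction N with
  | zero => simp
  | succ N ih =>
    have ih' := ih (fun j => by rcases Int.units_eq_one_or (alt j) with h | h <;> rw [h] <;> rfl)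
    rw [Finset.sum_range_succ, add_mul, ih']; push_cast; ring

lemma parity_iff (N : ℕ) (h : 4 ∣ N) (a : Fin N → ℤˣ) :
    Even (Ssum N alt a - 0) ∧ Even (Tsum N alt a - 0) := by
  have h1 := parity_S N alt a (fun j => alt j)
  have h2 := parity_T N alt a (fun j => alt j)
  have h3 := ref_S N
  have h4 := ref_T N
  obtain ⟨k, rfl⟩ := h
  have h5 : Tsum (4 * k) alt (fun j => alt j) = 2 * (k * (4 * k - 1)) := by
    push_cast at h4; linarith
  rw [h5] at h2
  rw [h3] at h1
  rw [sub_zero, sub_zero]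
  constructor
  · have := h1.add (show Even (((4 * k : ℕ) : ℤ)) from ⟨2 * k, by push_cast; ring⟩)
    simpa using this
  · have := h2.add (show Even (2 * ((k:ℤ) * (4 * k - 1))) from even_two_mul _)
    simpa using this

lemma parity_empty (N : ℕ) (h : ¬ 4 ∣ N) :
    {a : Fin N → ℤˣ | Ssum N alt a = 0 ∧ Tsum N alt a = 0} = ∅ := by
  rw [Set.eq_empty_iff_forall_notMem]
  rintro a ⟨hS, hT⟩
  have h1 := parity_S N alt a (fun j => alt j)
  have h2 := parity_T N alt a (fun j => alt j)
  have h3 := ref_S N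
  have h4 := ref_T N
  rw [hS, h3] at h1
  rw [hT] at h2
  obtain ⟨k, hk⟩ := h1
  obtain ⟨l, hl⟩ := h2
  have h5 : (N : ℤ) * (N - 1) = 4 * (-l) := by linarith
  have h6 : (N : ℤ) = 2 * (-k) := by linarith
  apply h
  have h7 : (4 : ℤ) ∣ N := by
    rw [h6] at h5 ⊢
    exact ⟨k ^ 2 + l, by linarith [h5, show (2 * -k) * (2 * -k - 1) = 4 * k ^ 2 + 2 * k by ring]⟩
  exact_mod_cast h7

lemma llt_Pr (p : ℝ) (h0 : 0 < p) (h1 : p < 1) :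
    Tendsto (fun n : ℕ => (n : ℝ) ^ 2 *
      Pr p {a : Fin (n + 1) → ℤˣ | Ssum (n + 1) alt a = 0 ∧ Tsum (n + 1) alt a = 0} -
      (if 4 ∣ n + 1 then 4 * √3 / (Real.pi * (4 * p * (1 - p))) else 0)) atTop (nhds 0) := by
  have hpi := Real.pi_pos
  have hp1 : 0 < 1 - p := by linarith
  let J : ℕ → ℝ := fun N => (∫ v : ℝ, ∫ u : ℝ, Kcut p N alt 0 0 (u / √N) (v / (N * √N))).re
  have hJ : Tendsto J atTop (nhds (4 * √3 * Real.pi / (4 * p * (1 - p)))) := by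
    have := (Complex.continuous_re.tendsto _).comp (llt_integral p h0 h1)
    simpa only [Function.comp_def, Complex.ofReal_re] using this
  have hJ1 : Tendsto (fun n : ℕ => J (n + 1)) atTop (nhds (4 * √3 * Real.pi / (4 * p * (1 - p)))) :=
    hJ.comp (tendsto_add_atTop_nat 1)
  have hr : Tendsto (fun n : ℕ => (n : ℝ) / ((n : ℝ) + 1)) atTop (nhds 1) :=
    tendsto_natCast_div_add_atTop 1
  have hh : Tendsto (fun n : ℕ => ((n : ℝ) / ((n : ℝ) + 1)) ^ 2 * (J (n + 1) / Real.pi ^ 2) -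
      4 * √3 / (Real.pi * (4 * p * (1 - p)))) atTop (nhds 0) := by
    have := ((hr.pow 2).mul (hJ1.div_const (Real.pi ^ 2))).sub_const
      (4 * √3 / (Real.pi * (4 * p * (1 - p))))
    convert this using 2
    field_simp; ring
  apply squeeze_zero_norm (a := fun n : ℕ =>
    ‖((n : ℝ) / ((n : ℝ) + 1)) ^ 2 * (J (n + 1) / Real.pi ^ 2) -
      4 * √3 / (Real.pi * (4 * p * (1 - p)))‖) _ (by simpa using hh.norm)
  intro n
  by_cases h4 : 4 ∣ n + 1
  · rw [if_pos h4]
    apply le_of_eq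
    congr 2
    have h := fourier_scaled p (n + 1) (by omega) alt 0 0 (parity_iff (n + 1) h4)
    have h' := congrArg Complex.re h
    rw [Complex.ofReal_re] at h'
    have : J (n + 1) = _ := h'.symm
    rw [this]
    push_cast
    field_simp
  · rw [if_neg h4, parity_empty _ h4, Pr_empty]
    simp

end

section


lemma kr_sum_pow {R : Type*} [CommRing R] {ι : Type*} (s : Finset ι) (f : ι → R) (p : ℕ)
    (hp : p.Prime) : ∃ r, (∑ i ∈ s, f i) ^ p = ∑ i ∈ s, f i ^ p + p * r := by
  classical
  induction s using Finset.induction_on with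
  | empty => exact ⟨0, by simp [hp.ne_zero]⟩
  | insert a s ha ih =>
    obtain ⟨r, hr⟩ := ih
    obtain ⟨t, ht⟩ := exists_add_pow_prime_eq hp (f a) (∑ i ∈ s, f i)
    refine ⟨r + f a * (∑ i ∈ s, f i) * t, ?_⟩
    rw [Finset.sum_insert ha, Finset.sum_insert ha, ht, hr]; ring

lemma kr_cong {ι : Type*} [Fintype ι] (f : ι → ℂ) (hf : ∀ i, IsIntegral ℤ (f i)) (p : ℕ)
    (hp : p.Prime) (a b : ℤ) (ha : (a : ℂ) = ∑ i, f i) (hb : (b : ℂ) = ∑ i, f i ^ p) :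
    (p : ℤ) ∣ b - a := by
  let g : ι → integralClosure ℤ ℂ := fun i => ⟨f i, hf i⟩
  obtain ⟨r, hr⟩ := kr_sum_pow Finset.univ g p hp
  have h1 : (a : ℂ) ^ p = b + p * (r : ℂ) := by
    have := congrArg (fun x : integralClosure ℤ ℂ => (x : ℂ)) hr
    simp only [g] at this
    push_cast at this
    rw [ha, hb]; exact this
  have hp0 : (p : ℂ) ≠ 0 := by exact_mod_cast hp.ne_zero
  have h2 : (r : ℂ) = algebraMap ℚ ℂ (((a ^ p - b : ℤ) : ℚ) / p) := by
    simp only [eq_ratCast]; push_cast; rw [eq_div_iff hp0, h1]; ring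
  have h3 : IsIntegral ℤ (((a ^ p - b : ℤ) : ℚ) / p) := by
    have : IsIntegral ℤ (r : ℂ) := r.2
    rw [h2] at this
    exact (isIntegral_algebraMap_iff (algebraMap ℚ ℂ).injective).1 this
  obtain ⟨c, hc⟩ := IsIntegrallyClosed.isIntegral_iff.1 h3
  have h4 : a ^ p - b = p * c := by
    have hpq : (p : ℚ) ≠ 0 := by exact_mod_cast hp.ne_zero
    rw [eq_div_iff hpq] at hc
    have : (((c * p : ℤ)) : ℚ) = ((a ^ p - b : ℤ) : ℚ) := by push_cast at hc ⊢; simpa using hc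
    have := Int.cast_injective this
    linarith
  have := Fact.mk hp
  have h5 : (p : ℤ) ∣ a ^ p - a := by
    rw [← ZMod.intCast_eq_intCast_iff_dvd_sub]
    push_cast; rw [ZMod.pow_card]
  have : b - a = (a ^ p - a) - (a ^ p - b) := by ring
  rw [this]
  exact dvd_sub h5 ⟨c, h4⟩

lemma kr_poly {ι : Type*} [Fintype ι] (x : ι → ℂ) (p D : ℕ)
    (h : ∀ k ≤ D, ∑ i, x i ^ k = ∑ i, (x i ^ p) ^ k) (g : Polynomial ℂ) (hg : g.natDegree ≤ D) :
    ∑ i, g.eval (x i) = ∑ i, g.eval (x i ^ p) := by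
  simp only [Polynomial.eval_eq_sum_range]
  rw [Finset.sum_comm, Finset.sum_comm (γ := ι)]
  refine Finset.sum_congr rfl fun k hk => ?_
  rw [← Finset.mul_sum, ← Finset.mul_sum, h k (by rw [Finset.mem_range] at hk; omega)]

lemma kr_mem {ι : Type*} [Fintype ι] (x : ι → ℂ) (p : ℕ)
    (h : ∀ k ≤ 2 * Fintype.card ι, ∑ i, x i ^ k = ∑ i, (x i ^ p) ^ k) (i₀ : ι) :
    ∃ i, x i = x i₀ ^ p := by
  classical
  by_contra hc
  push Not at hc
  let T : Finset ℂ := (Finset.univ.image x ∪ Finset.univ.image (fun i => x i ^ p)).erase (x i₀ ^ p)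
  let g : Polynomial ℂ := ∏ t ∈ T, (Polynomial.X - Polynomial.C t)
  have hdeg : g.natDegree ≤ 2 * Fintype.card ι := by
    rw [Polynomial.natDegree_prod_of_monic _ _ (fun t _ => Polynomial.monic_X_sub_C t)]
    simp only [Polynomial.natDegree_X_sub_C, Finset.sum_const, smul_eq_mul, mul_one]
    calc T.card ≤ _ := Finset.card_erase_le
      _ ≤ _ := Finset.card_union_le _ _
      _ ≤ Fintype.card ι + Fintype.card ι := add_le_add Finset.card_image_le Finset.card_image_le
      _ = _ := by ring
  have hz : ∀ t ∈ T, g.eval t = 0 := fun t ht => by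
    simp only [g, Polynomial.eval_prod]
    exact Finset.prod_eq_zero ht (by simp)
  have hnz : g.eval (x i₀ ^ p) ≠ 0 := by
    simp only [g, Polynomial.eval_prod]
    rw [Finset.prod_ne_zero_iff]
    intro t ht
    have := Finset.ne_of_mem_erase ht
    simp only [Polynomial.eval_sub, Polynomial.eval_X, Polynomial.eval_C]
    exact sub_ne_zero.2 this.symm
  have h1 := kr_poly x p _ h g hdeg
  rw [Finset.sum_eq_zero (fun i _ => hz (x i) (by simp [T, hc i]))] at h1
  have h2 : ∀ i, g.eval (x i ^ p) = (if x i ^ p = x i₀ ^ p then 1 else 0) * g.eval (x i₀ ^ p) := by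
    intro i
    split_ifs with hi
    · rw [hi, one_mul]
    · rw [hz _ (by simp [T, hi]), zero_mul]
  rw [Finset.sum_congr rfl (fun i _ => h2 i)] at h1
  rw [← Finset.sum_mul, eq_comm, mul_eq_zero, or_iff_left hnz, Finset.sum_boole] at h1
  have h3 := Nat.cast_eq_zero.1 h1
  rw [Finset.card_eq_zero, Finset.filter_eq_empty_iff] at h3
  exact h3 (Finset.mem_univ i₀) rfl

lemma kr_main {ι : Type*} [Fintype ι] [Nonempty ι] (x : ι → ℂ) (hx0 : ∀ i, x i ≠ 0)
    (hint : ∀ i, IsIntegral ℤ (x i))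
    (s : ℕ → ℤ) (hs : ∀ k, (s k : ℂ) = ∑ i, x i ^ k)
    (hb : ∀ i, ‖x i‖ ^ (16 * Fintype.card ι ^ 2) ≤ 2) (i₀ : ι) : ∃ m, 0 < m ∧ x i₀ ^ m = 1 := by
  set d := Fintype.card ι with hd
  have hdpos : 0 < d := Fintype.card_pos
  obtain ⟨p, hp, hp1, hp2⟩ := Nat.exists_prime_lt_and_le_two_mul (4 * d) (by omega)
  have hsb : ∀ j ≤ 16 * d ^ 2, |s j| ≤ 2 * d := by
    intro j hj
    have h1 : ‖(s j : ℂ)‖ ≤ 2 * d := by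
      rw [hs]
      refine (norm_sum_le _ _).trans ?_
      have : ∀ i, ‖x i ^ j‖ ≤ 2 := by
        intro i
        rw [norm_pow]
        rcases le_total ‖x i‖ 1 with h | h
        · exact (pow_le_one₀ (norm_nonneg _) h).trans (by norm_num)
        · exact (pow_le_pow_right₀ h hj).trans (hb i)
      refine (Finset.sum_le_sum (fun i _ => this i)).trans ?_
      simp [← hd]; linarith
    rw [Complex.norm_intCast] at h1
    exact_mod_cast h1
  have hps : ∀ k ≤ 2 * d, ∑ i, x i ^ k = ∑ i, (x i ^ p) ^ k := by
    intro k hk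
    have hdv : (p : ℤ) ∣ s (k * p) - s k := by
      apply kr_cong (fun i => x i ^ k) (fun i => (hint i).pow k) p hp _ _ (hs k)
      rw [hs]; simp only [pow_mul]
    have hle1 := hsb (k * p) (by nlinarith)
    have hle2 := hsb k (by nlinarith)
    have : s (k * p) - s k = 0 := by
      apply Int.eq_zero_of_abs_lt_dvd hdv
      have := abs_sub (s (k * p)) (s k)
      have h4 : (4 * (d:ℤ)) < p := by exact_mod_cast hp1
      linarith
    have h5 : s (k * p) = s k := by linarith
    rw [← hs, ← h5, hs]
    exact Finset.sum_congr rfl fun i _ => by rw [← pow_mul, mul_comm]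
  have hiter : ∀ j : ℕ, ∃ i, x i = x i₀ ^ (p ^ j) := by
    intro j
    induction j with
    | zero => exact ⟨i₀, by simp⟩
    | succ j ih =>
      obtain ⟨i, hi⟩ := ih
      obtain ⟨i', hi'⟩ := kr_mem x p hps i
      exact ⟨i', by rw [hi', hi, ← pow_mul, pow_succ]⟩
  choose F hF using hiter
  obtain ⟨a, b, hab, hFab⟩ := Finite.exists_ne_map_eq_of_infinite F
  have key : ∀ a b : ℕ, a < b → F a = F b → ∃ m, 0 < m ∧ x i₀ ^ m = 1 := by
    intro a b hlt he
    have h1 : x i₀ ^ (p ^ a) = x i₀ ^ (p ^ b) := by rw [← hF, ← hF, he]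
    have h2 : p ^ a < p ^ b := Nat.pow_lt_pow_right hp.one_lt hlt
    refine ⟨p ^ b - p ^ a, by omega, ?_⟩
    have h3 : x i₀ ^ (p ^ b) = x i₀ ^ (p ^ b - p ^ a) * x i₀ ^ (p ^ a) := by
      rw [← pow_add]; congr 1; omega
    rw [← h1] at h3
    exact (mul_eq_right₀ (pow_ne_zero _ (hx0 i₀))).1 h3.symm
  rcases lt_or_gt_of_ne hab with h | h
  · exact key a b h hFab
  · exact key b a h hFab.symm

open IntermediateField in
lemma kr_final (z : ℂ) (hz : IsIntegral ℤ z) (hz0 : z ≠ 0)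
    (hb : ∀ α : ℂ, Polynomial.aeval α (minpoly ℤ z) = 0 →
      ‖α‖ ^ (16 * (minpoly ℤ z).natDegree ^ 2) ≤ 2) : ∃ m, 0 < m ∧ z ^ m = 1 := by
  have hzQ : IsIntegral ℚ z := hz.tower_top
  have hmin : minpoly ℚ z = (minpoly ℤ z).map (algebraMap ℤ ℚ) :=
    minpoly.isIntegrallyClosed_eq_field_fractions ℚ ℂ hz
  have : FiniteDimensional ℚ ℚ⟮z⟯ := adjoin.finiteDimensional hzQ
  let x : ℚ⟮z⟯ := AdjoinSimple.gen ℚ z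
  have hxz : algebraMap ℚ⟮z⟯ ℂ x = z := AdjoinSimple.algebraMap_gen ℚ z
  have hxi : IsIntegral ℤ x :=
    (isIntegral_algebraMap_iff (algebraMap ℚ⟮z⟯ ℂ).injective).1 (by rw [hxz]; exact hz)
  have hcard : Fintype.card (ℚ⟮z⟯ →ₐ[ℚ] ℂ) = (minpoly ℤ z).natDegree := by
    rw [AlgHom.card, adjoin.finrank hzQ, hmin,
      Polynomial.natDegree_map_eq_of_injective (algebraMap ℤ ℚ).injective_int]
  have hs : ∀ k : ℕ, ∃ s : ℤ, (s : ℂ) = ∑ σ : ℚ⟮z⟯ →ₐ[ℚ] ℂ, σ x ^ k := by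
    intro k
    have h1 : IsIntegral ℤ (Algebra.trace ℚ ℚ⟮z⟯ (x ^ k)) := Algebra.isIntegral_trace (hxi.pow k)
    obtain ⟨s, hs⟩ := IsIntegrallyClosed.isIntegral_iff.1 h1
    refine ⟨s, ?_⟩
    have h2 := trace_eq_sum_embeddings (K := ℚ) (L := ℚ⟮z⟯) ℂ (x := x ^ k)
    rw [← hs] at h2
    simpa using h2
  choose s hs using hs
  have : Nonempty (ℚ⟮z⟯ →ₐ[ℚ] ℂ) := ⟨ℚ⟮z⟯.val⟩
  have h := kr_main (fun σ : ℚ⟮z⟯ →ₐ[ℚ] ℂ => σ x) ?_ ?_ s hs ?_ (ℚ⟮z⟯.val)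
  · obtain ⟨m, hm, h⟩ := h
    exact ⟨m, hm, h⟩
  · intro σ hσ
    have : x = 0 := by simpa using hσ
    rw [this, map_zero] at hxz
    exact hz0 hxz.symm
  · intro σ
    exact hxi.map (σ.restrictScalars ℤ)
  · intro σ
    rw [hcard]
    apply hb
    have h1 : Polynomial.aeval x (minpoly ℤ z) = 0 := by
      apply (algebraMap ℚ⟮z⟯ ℂ).injective
      rw [← Polynomial.aeval_algebraMap_apply, hxz, minpoly.aeval, map_zero]
    have := Polynomial.aeval_algHom_apply (σ.restrictScalars ℤ) x (minpoly ℤ z)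
    rw [h1, map_zero] at this
    exact this

end

section


noncomputable def ipoly (n : ℕ) (a : Fin (n + 1) → ℤˣ) : Polynomial ℤ :=
  ∑ j : Fin (n + 1), Polynomial.C (a j : ℤ) * Polynomial.X ^ (j : ℕ)

lemma fsum_coeff (N : ℕ) (c : Fin N → ℤ) (k : ℕ) :
    (∑ j : Fin N, Polynomial.C (c j) * Polynomial.X ^ (j : ℕ)).coeff k =
      if h : k < N then c ⟨k, h⟩ else 0 := by
  simp only [Polynomial.finsetSum_coeff, Polynomial.coeff_C_mul, Polynomial.coeff_X_pow]
  split_ifs with h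
  · rw [Finset.sum_eq_single (⟨k, h⟩ : Fin N)]
    · simp
    · intro b _ hb
      rw [if_neg, mul_zero]
      rintro rfl
      exact hb rfl
    · simp
  · apply Finset.sum_eq_zero
    intro j _
    rw [if_neg, mul_zero]
    rintro rfl
    exact h j.2

lemma small_root (q : Polynomial ℤ) (hq : q ≠ 0) (hc : ∀ k, |q.coeff k| ≤ 1) (z : ℂ)
    (hz : Polynomial.aeval z q = 0) : ‖z‖ < 2 := by
  have hinj : Function.Injective (algebraMap ℤ ℂ) := (algebraMap ℤ ℂ).injective_int
  have hq' : q.map (algebraMap ℤ ℂ) ≠ 0 := (Polynomial.map_ne_zero_iff hinj).2 hq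
  have h1 : (q.map (algebraMap ℤ ℂ)).IsRoot z := by
    rw [Polynomial.IsRoot.def, Polynomial.eval_map_algebraMap, hz]
  have h2 := h1.norm_lt_cauchyBound hq'
  have h3 : (q.map (algebraMap ℤ ℂ)).cauchyBound ≤ 2 := by
    unfold Polynomial.cauchyBound
    have hl : (1 : NNReal) ≤ ‖(q.map (algebraMap ℤ ℂ)).leadingCoeff‖₊ := by
      rw [Polynomial.leadingCoeff_map_of_injective hinj, ← NNReal.coe_le_coe]
      simp only [algebraMap_int_eq, eq_intCast, coe_nnnorm, Complex.norm_intCast, NNReal.coe_one]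
      have : 1 ≤ |q.leadingCoeff| := Int.one_le_abs (Polynomial.leadingCoeff_ne_zero.2 hq)
      exact_mod_cast this
    have hs : (Finset.range (q.map (algebraMap ℤ ℂ)).natDegree).sup
        (fun i => ‖(q.map (algebraMap ℤ ℂ)).coeff i‖₊) ≤ 1 := by
      apply Finset.sup_le
      intro k _
      rw [← NNReal.coe_le_coe, Polynomial.coeff_map]
      simp only [algebraMap_int_eq, eq_intCast, coe_nnnorm, Complex.norm_intCast, NNReal.coe_one]
      exact_mod_cast hc k
    calc _ ≤ (1 : NNReal) / 1 + 1 := by gcongr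
      _ = 2 := by norm_num
  have h4 := h2.trans_le h3
  exact_mod_cast h4

lemma units_abs (u : ℤˣ) : |(u : ℤ)| = 1 := by
  rcases Int.units_eq_one_or u with h | h <;> rw [h] <;> rfl

lemma ipoly_coeff (n : ℕ) (a : Fin (n + 1) → ℤˣ) (k : ℕ) :
    (ipoly n a).coeff k = if h : k < n + 1 then (a ⟨k, h⟩ : ℤ) else 0 :=
  fsum_coeff (n + 1) (fun j => (a j : ℤ)) k

lemma ipoly_coeff_le (n : ℕ) (a : Fin (n + 1) → ℤˣ) (k : ℕ) : |(ipoly n a).coeff k| ≤ 1 := by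
  rw [ipoly_coeff]
  split_ifs with h
  · rw [units_abs]
  · simp

lemma ipoly_ne_zero (n : ℕ) (a : Fin (n + 1) → ℤˣ) : ipoly n a ≠ 0 := by
  intro h
  have := ipoly_coeff n a 0
  rw [h] at this
  simp at this
  exact (a 0).ne_zero this.symm

lemma ipoly_zero (n : ℕ) (a : Fin (n + 1) → ℤˣ) : (ipoly n a).coeff 0 = a 0 := by
  rw [ipoly_coeff, dif_pos (by omega)]; rfl

lemma ipoly_natDegree (n : ℕ) (a : Fin (n + 1) → ℤˣ) : (ipoly n a).natDegree = n := by
  apply le_antisymm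
  · rw [Polynomial.natDegree_le_iff_coeff_eq_zero]
    intro k hk
    rw [ipoly_coeff, dif_neg (by omega)]
  · apply Polynomial.le_natDegree_of_ne_zero
    rw [ipoly_coeff, dif_pos (by omega)]
    exact (a _).ne_zero

lemma ipoly_lead (n : ℕ) (a : Fin (n + 1) → ℤˣ) :
    (ipoly n a).leadingCoeff = a (Fin.last n) := by
  rw [Polynomial.leadingCoeff, ipoly_natDegree, ipoly_coeff, dif_pos (by omega)]; rfl

lemma ipoly_root_int (n : ℕ) (a : Fin (n + 1) → ℤˣ) (z : ℂ)
    (hz : Polynomial.aeval z (ipoly n a) = 0) : IsIntegral ℤ z := by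
  refine ⟨Polynomial.C ((a (Fin.last n) : ℤˣ) : ℤ) * ipoly n a, ?_, ?_⟩
  · rw [Polynomial.Monic, Polynomial.leadingCoeff_mul, Polynomial.leadingCoeff_C, ipoly_lead]
    rcases Int.units_eq_one_or (a (Fin.last n)) with h | h <;> rw [h] <;> rfl
  · rw [← Polynomial.aeval_def, map_mul, hz, mul_zero]

lemma ipoly_root_ne (n : ℕ) (a : Fin (n + 1) → ℤˣ) (z : ℂ)
    (hz : Polynomial.aeval z (ipoly n a) = 0) : z ≠ 0 := by
  rintro rfl
  rw [← Polynomial.coeff_zero_eq_aeval_zero', ipoly_zero] at hz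
  rcases Int.units_eq_one_or (a 0) with h | h <;> rw [h] at hz <;> simp at hz

lemma ipoly_root_lt (n : ℕ) (a : Fin (n + 1) → ℤˣ) (z : ℂ)
    (hz : Polynomial.aeval z (ipoly n a) = 0) : ‖z‖ < 2 :=
  small_root _ (ipoly_ne_zero n a) (ipoly_coeff_le n a) z hz

lemma ipoly_root_gt (n : ℕ) (a : Fin (n + 1) → ℤˣ) (z : ℂ)
    (hz : Polynomial.aeval z (ipoly n a) = 0) : 1 / 2 < ‖z‖ := by
  have hz0 := ipoly_root_ne n a z hz
  let := invertibleOfNonzero hz0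
  have h1 := (Polynomial.eval₂_reverse_eq_zero_iff (algebraMap ℤ ℂ) z (ipoly n a)).2 hz
  rw [← Polynomial.aeval_def] at h1
  have h2 := small_root (ipoly n a).reverse (by simpa using ipoly_ne_zero n a) (fun k => by
    rw [Polynomial.coeff_reverse]; exact ipoly_coeff_le n a _) _ h1
  rw [invOf_eq_inv, norm_inv] at h2
  have h3 : 0 < ‖z‖ := norm_pos_iff.2 hz0
  have h4 : ‖z‖⁻¹ * ‖z‖ = 1 := inv_mul_cancel₀ h3.ne'
  nlinarith

lemma geo_inj (N : ℕ) (β : ℂ) (hβ : 2 ≤ ‖β‖) (x y : Fin N → ℤˣ)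
    (h : ∑ i : Fin N, ((x i : ℤ) : ℂ) * β ^ (i : ℕ) = ∑ i : Fin N, ((y i : ℤ) : ℂ) * β ^ (i : ℕ)) :
    x = y := by
  by_contra hne
  have hd : ∀ i, ∃ c : ℤ, (x i : ℤ) - y i = 2 * c ∧ |c| ≤ 1 := by
    intro i
    rcases Int.units_eq_one_or (x i) with h | h <;> rcases Int.units_eq_one_or (y i) with h' | h' <;>
      rw [h, h']
    · exact ⟨0, by simp⟩
    · exact ⟨1, by simp⟩
    · exact ⟨-1, by simp⟩
    · exact ⟨0, by simp⟩
  choose c hc hc1 using hd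
  let q : Polynomial ℤ := ∑ j : Fin N, Polynomial.C (c j) * Polynomial.X ^ (j : ℕ)
  have hq : q ≠ 0 := by
    intro hq
    apply hne
    funext i
    have h1 := fsum_coeff N c i
    change q.coeff _ = _ at h1
    rw [hq, dif_pos i.2] at h1
    have h2 := hc i
    simp only [Polynomial.coeff_zero, Fin.eta] at h1
    rw [← h1] at h2
    exact Units.ext (by linarith)
  have h0 : Polynomial.aeval β q = 0 := by
    have h1 : (2 : ℂ) * Polynomial.aeval β q = 0 := by
      simp only [q, map_sum, map_mul, map_pow, Polynomial.aeval_X,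
        eq_intCast, map_intCast, Finset.mul_sum]
      rw [← sub_eq_zero, ← Finset.sum_sub_distrib] at h
      rw [← h]
      refine Finset.sum_congr rfl fun i _ => ?_
      have := congrArg (fun t : ℤ => (t : ℂ)) (hc i)
      push_cast at this
      linear_combination (-β ^ (i:ℕ)) * this
    simpa using h1
  have := small_root q hq (fun k => by
    rw [show q.coeff k = _ from fsum_coeff N c k]
    split_ifs
    · exact hc1 _
    · simp) β h0
  linarith

def isDR (n : ℕ) (a : Fin (n + 1) → ℤˣ) (z : ℂ) : Prop :=
  Polynomial.aeval z (ipoly n a) = 0 ∧ Polynomial.aeval z (Polynomial.derivative (ipoly n a)) = 0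

lemma sq_dvd (n : ℕ) (a : Fin (n + 1) → ℤˣ) (z : ℂ) (h : isDR n a z) :
    (minpoly ℤ z) ^ 2 ∣ ipoly n a := by
  obtain ⟨h1, h2⟩ := h
  have hi := ipoly_root_int n a z h1
  obtain ⟨g, hg⟩ := minpoly.isIntegrallyClosed_dvd hi h1
  rw [hg, Polynomial.derivative_mul, map_add, map_mul, map_mul, minpoly.aeval, zero_mul, add_zero,
    mul_eq_zero] at h2
  have hder : Polynomial.aeval z (Polynomial.derivative (minpoly ℤ z)) ≠ 0 := by
    intro h3
    have h4 := minpoly.isIntegrallyClosed_dvd hi h3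
    have h5 : 0 < (minpoly ℤ z).natDegree := minpoly.natDegree_pos hi
    have h6 : Polynomial.derivative (minpoly ℤ z) ≠ 0 := by
      intro h
      have := Polynomial.derivative_eq_zero.1 h
      omega
    have h7 := Polynomial.natDegree_le_of_dvd h4 h6
    have h8 := Polynomial.natDegree_derivative_lt h5.ne'
    omega
  obtain ⟨g', hg'⟩ := minpoly.isIntegrallyClosed_dvd hi (h2.resolve_left hder)
  exact ⟨g', by rw [hg, hg', ← mul_assoc, sq]⟩

lemma minpoly_root (n : ℕ) (a : Fin (n + 1) → ℤˣ) (z : ℂ) (h : isDR n a z) (α : ℂ)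
    (hα : Polynomial.aeval α (minpoly ℤ z) = 0) : Polynomial.aeval α (ipoly n a) = 0 := by
  obtain ⟨g, hg⟩ := sq_dvd n a z h
  rw [hg, map_mul, map_pow, hα]; simp

lemma minpoly_zero (n : ℕ) (a : Fin (n + 1) → ℤˣ) (z : ℂ) (h : isDR n a z) :
    |(minpoly ℤ z).eval 0| = 1 := by
  obtain ⟨g, hg⟩ := sq_dvd n a z h
  have h1 : (ipoly n a).eval 0 = a 0 := by rw [← Polynomial.coeff_zero_eq_eval_zero, ipoly_zero]
  rw [hg, Polynomial.eval_mul, Polynomial.eval_pow] at h1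
  have h2 : IsUnit ((minpoly ℤ z).eval 0) := by
    apply isUnit_of_dvd_unit _ (a 0).isUnit
    rw [← h1, sq, mul_assoc]; exact dvd_mul_right _ _
  exact Int.isUnit_iff_abs_eq.1 h2

lemma minpoly_three (n : ℕ) (a : Fin (n + 1) → ℤˣ) (z : ℂ) (h : isDR n a z) :
    (1.25 : ℝ) ^ (minpoly ℤ z).natDegree ≤ |(((minpoly ℤ z).eval 3 : ℤ) : ℝ)| := by
  have hi := ipoly_root_int n a z h.1
  set f := minpoly ℤ z with hf
  have hm : f.Monic := minpoly.monic hi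
  set F := f.map (algebraMap ℤ ℂ) with hF
  have hmF : F.Monic := hm.map _
  have hsp : F.Splits := IsAlgClosed.splits F
  have hev : ∀ w : ℂ, F.eval w = (F.roots.map (fun r => w - r)).prod := by
    intro w
    conv_lhs => rw [hsp.eq_prod_roots_of_monic hmF]
    rw [Polynomial.eval_multiset_prod, Multiset.map_map]
    simp
  have hcard : F.roots.card = f.natDegree := by
    rw [← hsp.natDegree_eq_card_roots, hF, hm.natDegree_map]
  have he : ∀ t : ℤ, F.eval (t : ℂ) = ((f.eval t : ℤ) : ℂ) := by
    intro t
    rw [hF, Polynomial.eval_intCast_map]; simp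
  have h0 : ‖F.eval 0‖ = 1 := by
    have := he 0
    rw [Int.cast_zero] at this
    rw [this, Complex.norm_intCast]
    exact_mod_cast minpoly_zero n a z h
  have h3 : ‖F.eval 3‖ = |((f.eval 3 : ℤ) : ℝ)| := by
    have := he 3
    rw [show (((3:ℤ)) : ℂ) = 3 by norm_num] at this
    rw [this, Complex.norm_intCast]
  rw [← h3, ← one_mul ‖F.eval 3‖, ← h0, ← norm_mul, hev, hev, ← Multiset.prod_map_mul, ← hcard]
  have hroot : ∀ r ∈ F.roots, (1.25 : ℝ) ≤ ‖(0 - r) * (3 - r)‖ := by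
    intro r hr
    have hr1 : Polynomial.aeval r f = 0 := by
      have := Polynomial.isRoot_of_mem_roots hr
      rwa [Polynomial.IsRoot.def, hF, Polynomial.eval_map_algebraMap] at this
    have hr2 := minpoly_root n a z h r hr1
    have b1 := ipoly_root_lt n a r hr2
    have b2 := ipoly_root_gt n a r hr2
    rw [norm_mul, zero_sub, norm_neg]
    have b3 : 3 - ‖r‖ ≤ ‖3 - r‖ := by
      have := norm_sub_norm_le (3 : ℂ) r
      simpa using this
    nlinarith
  clear_value F
  generalize F.roots = s at hroot
  clear hcard hev h3 h0 he hsp hmF hF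
  induction s using Multiset.induction_on with
  | empty => simp
  | cons r s ih =>
    rw [Multiset.card_cons, Multiset.map_cons, Multiset.prod_cons, norm_mul, pow_succ, mul_comm]
    exact mul_le_mul (hroot r (by simp)) (ih fun t ht => hroot t (by simp [ht])) (by positivity)
      (norm_nonneg _)

lemma high_deg (n : ℕ) (a : Fin (n + 1) → ℤˣ) (z : ℂ) (h : isDR n a z) (r : ℕ)
    (hr : 3 * r ≤ (minpoly ℤ z).natDegree) :
    ∃ k : ℕ, 3 ^ r ≤ k ^ 2 ∧ ((k ^ 2 : ℕ) : ℤ) ∣ (ipoly n a).eval 3 ∧ k ^ 2 < 3 ^ (n + 1) := by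
  have h1 := minpoly_three n a z h
  set f := minpoly ℤ z with hf
  refine ⟨(f.eval 3).natAbs, ?_, ?_, ?_⟩
  · have h2 : (1.25 : ℝ) ^ (3 * r) ≤ |((f.eval 3 : ℤ) : ℝ)| :=
      (pow_le_pow_right₀ (by norm_num) hr).trans h1
    have h3 : ((1.25 : ℝ) ^ (3 * r)) ^ 2 ≤ |((f.eval 3 : ℤ) : ℝ)| ^ 2 := by gcongr
    have h4 : (3 : ℝ) ^ r ≤ ((1.25 : ℝ) ^ (3 * r)) ^ 2 := by
      rw [← pow_mul, mul_right_comm, pow_mul]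
      apply pow_le_pow_left₀ <;> norm_num
    have h5 : (3 : ℝ) ^ r ≤ (((f.eval 3).natAbs ^ 2 : ℕ) : ℝ) := by
      push_cast
      rw [Nat.cast_natAbs]; push_cast
      exact h4.trans h3
    exact_mod_cast h5
  · obtain ⟨g, hg⟩ := sq_dvd n a z h
    push_cast
    rw [sq_abs, hg, Polynomial.eval_mul, Polynomial.eval_pow]
    exact dvd_mul_right _ _
  · have hne : (ipoly n a).eval 3 ≠ 0 := by
      intro h0
      have : Polynomial.aeval (3 : ℂ) (ipoly n a) = 0 := by
        have := Polynomial.aeval_algebraMap_apply ℂ (3 : ℤ) (ipoly n a)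
        rw [Polynomial.coe_aeval_eq_eval, h0] at this
        simpa using this
      have := ipoly_root_lt n a 3 this
      norm_num at this
    have hdv : (f.eval 3) ^ 2 ∣ (ipoly n a).eval 3 := by
      obtain ⟨g, hg⟩ := sq_dvd n a z h
      rw [hg, Polynomial.eval_mul, Polynomial.eval_pow]
      exact dvd_mul_right _ _
    have h2 : ((f.eval 3).natAbs) ^ 2 ≤ ((ipoly n a).eval 3).natAbs := by
      rw [← Int.natAbs_pow]
      exact Nat.le_of_dvd (Int.natAbs_pos.2 hne) (Int.natAbs_dvd_natAbs.2 hdv)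
    refine h2.trans_lt ?_
    have h3 : |(ipoly n a).eval 3| < 3 ^ (n + 1) := by
      rw [ipoly, Polynomial.eval_finsetSum]
      refine (Finset.abs_sum_le_sum_abs _ _).trans_lt ?_
      simp only [Polynomial.eval_mul, Polynomial.eval_C, Polynomial.eval_pow, Polynomial.eval_X,
        abs_mul, units_abs, one_mul]
      rw [Fin.sum_univ_eq_sum_range (fun j => |(3:ℤ) ^ j|) (n + 1)]
      have : ∀ m : ℕ, ∑ j ∈ Finset.range m, |(3:ℤ) ^ j| < 3 ^ m := by
        intro m
        induction m with
        | zero => simp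
        | succ m ih =>
          rw [Finset.sum_range_succ, pow_succ, abs_of_pos (by positivity : (0:ℤ) < 3 ^ m)]
          linarith [(by positivity : (0:ℤ) < 3 ^ m)]
      exact this _
    zify
    exact_mod_cast h3

end

section


lemma extend_diff {R : Type} [CommRing R] {ι κ : Type} [Fintype ι] [Fintype κ] (e : κ → ι)
    (he : Function.Injective e) (x x' : κ → ℤˣ) (y : ι → ℤˣ) (G : ι → R) :
    ∑ j, (((Function.extend e x y j : ℤˣ) : ℤ) : R) * G j -
      ∑ j, (((Function.extend e x' y j : ℤˣ) : ℤ) : R) * G j =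
    ∑ i, ((x i : ℤ) : R) * G (e i) - ∑ i, ((x' i : ℤ) : R) * G (e i) := by
  rw [← Finset.sum_sub_distrib, ← Finset.sum_sub_distrib]
  symm
  apply Fintype.sum_of_injective e he
  · intro j hj
    have hj' : ¬ ∃ i, e i = j := hj
    rw [Function.extend_apply' _ _ _ hj', Function.extend_apply' _ _ _ hj', sub_self]
  · intro i
    rw [he.extend_apply, he.extend_apply]

lemma ipoly_eval (n : ℕ) (a : Fin (n + 1) → ℤˣ) (t : ℤ) :
    (ipoly n a).eval t = ∑ j : Fin (n + 1), (((a j : ℤˣ) : ℤ) : ℤ) * t ^ (j : ℕ) := by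
  simp [ipoly, Polynomial.eval_finsetSum]

lemma ipoly_aeval (n : ℕ) (a : Fin (n + 1) → ℤˣ) (z : ℂ) :
    Polynomial.aeval z (ipoly n a) = ∑ j : Fin (n + 1), (((a j : ℤˣ) : ℤ) : ℂ) * z ^ (j : ℕ) := by
  simp [ipoly]

lemma ipoly_aeval_der (n : ℕ) (a : Fin (n + 1) → ℤˣ) (z : ℂ) :
    z * Polynomial.aeval z (Polynomial.derivative (ipoly n a)) =
      ∑ j : Fin (n + 1), (((a j : ℤˣ) : ℤ) : ℂ) * ((j : ℕ) * z ^ (j : ℕ)) := by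
  simp only [ipoly, Polynomial.derivative_sum, map_sum, Finset.mul_sum]
  refine Finset.sum_congr rfl fun j _ => ?_
  rw [Polynomial.derivative_C_mul_X_pow]
  rcases Nat.eq_zero_or_pos (j : ℕ) with h | h
  · simp [h]
  · obtain ⟨t, ht⟩ := Nat.exists_eq_succ_of_ne_zero h.ne'
    simp [ht, pow_succ]; ring

lemma Pr_dvd (p M : ℝ) (h0 : 0 ≤ p) (h1 : p ≤ 1) (hp : p ≤ M) (hq : 1 - p ≤ M)
    (n m K : ℕ) (hm : m ≤ n) (hK : 3 ^ m ≤ K) :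
    Pr p {a : Fin (n + 1) → ℤˣ | (K : ℤ) ∣ (ipoly n a).eval 3} ≤ M ^ m := by
  have hmn : m ≤ n + 1 := by omega
  apply Pr_extend_le h0 h1 (Fin.castLE hmn) (Fin.castLE_injective hmn)
  intro y
  have := Pr_subsingleton_le (p := p) h0 h1 hp hq
    {x : Fin m → ℤˣ | Function.extend (Fin.castLE hmn) x y ∈
      {a : Fin (n + 1) → ℤˣ | (K : ℤ) ∣ (ipoly n a).eval 3}} ?_
  · simpa using this
  intro x hx x' hx'
  have hx1 : (K : ℤ) ∣ (ipoly n (Function.extend (Fin.castLE hmn) x y)).eval 3 := hx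
  have hx2 : (K : ℤ) ∣ (ipoly n (Function.extend (Fin.castLE hmn) x' y)).eval 3 := hx'
  have h3 := dvd_sub hx1 hx2
  rw [ipoly_eval, ipoly_eval] at h3
  have h4 := extend_diff (R := ℤ) (Fin.castLE hmn) (Fin.castLE_injective hmn) x x' y
    (fun j => (3:ℤ) ^ (j : ℕ))
  simp only [Int.cast_id, Fin.val_castLE] at h3 h4
  rw [h4] at h3
  have h5 : ∑ i : Fin m, (x i : ℤ) * 3 ^ (i : ℕ) - ∑ i : Fin m, (x' i : ℤ) * 3 ^ (i : ℕ) = 0 := by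
    apply Int.eq_zero_of_abs_lt_dvd h3
    rw [← Finset.sum_sub_distrib]
    have h6 : |∑ i : Fin m, ((x i : ℤ) * 3 ^ (i : ℕ) - (x' i : ℤ) * 3 ^ (i : ℕ))| ≤
        ∑ i : Fin m, 2 * 3 ^ (i : ℕ) := by
      refine (Finset.abs_sum_le_sum_abs _ _).trans (Finset.sum_le_sum fun i _ => ?_)
      rw [← sub_mul, abs_mul, abs_of_pos (by positivity : (0:ℤ) < 3 ^ (i:ℕ))]
      gcongr
      have := abs_sub (x i : ℤ) (x' i : ℤ)
      rw [units_abs, units_abs] at this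
      exact this
    have h7 : ∀ t : ℕ, ∑ i ∈ Finset.range t, (2 : ℤ) * 3 ^ i < 3 ^ t := by
      intro t
      induction t with
      | zero => simp
      | succ t ih => rw [Finset.sum_range_succ, pow_succ]; linarith
    have h8 := h7 m
    rw [← Fin.sum_univ_eq_sum_range (fun i => (2:ℤ) * 3 ^ i) m] at h8
    have h9 : (3 : ℤ) ^ m ≤ K := by exact_mod_cast hK
    linarith
  apply geo_inj m 3 (by norm_num)
  have := congrArg (fun t : ℤ => (t : ℂ)) (sub_eq_zero.1 h5)
  simpa using this

lemma Pr_high (p M : ℝ) (h0 : 0 ≤ p) (h1 : p ≤ 1) (hp : p ≤ M) (hq : 1 - p ≤ M)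
    (hM : √3 * M < 1) (n r : ℕ) :
    Pr p {a : Fin (n + 1) → ℤˣ | ∃ z, isDR n a z ∧ 3 * r ≤ (minpoly ℤ z).natDegree} ≤
      √3 * ((√3 * M) ^ r / (1 - √3 * M)) := by
  have hM0 : 0 ≤ M := h0.trans hp
  have hρ0 : 0 ≤ √3 * M := by positivity
  let B : (Σ _ : ℕ, ℕ) → Set (Fin (n + 1) → ℤˣ) := fun t =>
    {a | 3 ^ t.1 ≤ t.2 ^ 2 ∧ ((t.2 ^ 2 : ℕ) : ℤ) ∣ (ipoly n a).eval 3}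
  let s : Finset (Σ _ : ℕ, ℕ) :=
    (Finset.Icc r n).sigma fun m => Finset.Icc 1 (Nat.sqrt (3 ^ (m + 1)))
  have hsub : {a : Fin (n + 1) → ℤˣ | ∃ z, isDR n a z ∧ 3 * r ≤ (minpoly ℤ z).natDegree} ⊆
      ⋃ t ∈ s, B t := by
    rintro a ⟨z, hz, hd⟩
    obtain ⟨k, hk1, hk2, hk3⟩ := high_deg n a z hz r hd
    have hk0 : k ^ 2 ≠ 0 := by have : 0 < 3 ^ r := by positivity
                               omega
    have hk00 : k ≠ 0 := by rintro rfl; simp at hk0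
    simp only [Set.mem_iUnion]
    refine ⟨⟨Nat.log 3 (k ^ 2), k⟩, ?_, ?_, hk2⟩
    · simp only [s, Finset.mem_sigma, Finset.mem_Icc]
      refine ⟨⟨Nat.le_log_of_pow_le (by norm_num) hk1, ?_⟩, by omega, ?_⟩
      · have := Nat.log_lt_of_lt_pow hk0 hk3
        omega
      · rw [Nat.le_sqrt, ← sq]
        exact (Nat.lt_pow_succ_log_self (by norm_num) _).le
    · exact Nat.pow_log_le_self 3 hk0
  refine (Pr_mono h0 h1 hsub).trans ((Pr_biUnion_le h0 h1 s B).trans ?_)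
  have hB : ∀ t ∈ s, Pr p (B t) ≤ M ^ t.1 := by
    rintro ⟨m, k⟩ ht
    simp only [s, Finset.mem_sigma, Finset.mem_Icc] at ht
    by_cases h : 3 ^ m ≤ k ^ 2
    · exact (Pr_mono h0 h1 (fun a ha => ha.2)).trans
        (Pr_dvd p M h0 h1 hp hq n m (k ^ 2) ht.1.2 h)
    · have : B ⟨m, k⟩ = ∅ := by
        ext a; simp only [B, Set.mem_ofPred_eq, Set.mem_empty_iff_false, iff_false]
        exact fun hh => h hh.1
      rw [this, Pr_empty]; positivity
  refine (Finset.sum_le_sum hB).trans ?_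
  rw [Finset.sum_sigma]
  simp only [Finset.sum_const, Nat.card_Icc, Nat.add_sub_cancel, nsmul_eq_mul]
  have hterm : ∀ m ∈ Finset.Icc r n, (Nat.sqrt (3 ^ (m + 1)) : ℝ) * M ^ m ≤ √3 * (√3 * M) ^ m := by
    intro m _
    have h3 : (Nat.sqrt (3 ^ (m + 1)) : ℝ) ≤ √3 ^ (m + 1) := by
      refine Real.nat_sqrt_le_real_sqrt.trans (le_of_eq ?_)
      push_cast
      rw [Real.sqrt_eq_iff_eq_sq (by positivity) (by positivity), ← pow_mul, mul_comm, pow_mul,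
        Real.sq_sqrt (by norm_num)]
    calc _ ≤ √3 ^ (m + 1) * M ^ m := by gcongr
      _ = _ := by rw [mul_pow]; ring
  refine (Finset.sum_le_sum hterm).trans ?_
  rw [← Finset.mul_sum]
  gcongr
  rw [← Finset.Ico_add_one_right_eq_Icc]
  exact geom_sum_Ico_le_of_lt_one hρ0 hM

lemma Pr_root (p M : ℝ) (h0 : 0 ≤ p) (h1 : p ≤ 1) (hp : p ≤ M) (hq : 1 - p ≤ M)
    (n k : ℕ) (hk : 0 < k) (α : ℂ) (hα : 2 ≤ ‖α‖ ^ k) :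
    Pr p {a : Fin (n + 1) → ℤˣ | Polynomial.aeval α (ipoly n a) = 0} ≤ M ^ (n / k) := by
  let e : Fin (n / k) → Fin (n + 1) := fun i => ⟨k * i, by
    have := Nat.mul_div_le n k
    have := Nat.mul_le_mul_left k i.2.le
    omega⟩
  have he : Function.Injective e := by
    intro i j hij
    have : k * (i : ℕ) = k * j := congrArg Fin.val hij
    exact Fin.ext (Nat.eq_of_mul_eq_mul_left hk this)
  apply Pr_extend_le h0 h1 e he
  intro y
  have := Pr_subsingleton_le (p := p) h0 h1 hp hq
    {x : Fin (n / k) → ℤˣ | Function.extend e x y ∈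
      {a : Fin (n + 1) → ℤˣ | Polynomial.aeval α (ipoly n a) = 0}} ?_
  · simpa using this
  intro x hx x' hx'
  have hx1 : Polynomial.aeval α (ipoly n (Function.extend e x y)) = 0 := hx
  have hx2 : Polynomial.aeval α (ipoly n (Function.extend e x' y)) = 0 := hx'
  rw [ipoly_aeval] at hx1 hx2
  have h4 := extend_diff (R := ℂ) e he x x' y (fun j => α ^ (j : ℕ))
  rw [hx1, hx2, sub_self] at h4
  apply geo_inj (n / k) (α ^ k) (by rwa [norm_pow])
  rw [← sub_eq_zero]
  simp only [← pow_mul]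
  exact h4.symm

lemma minpoly_coeff (n : ℕ) (a : Fin (n + 1) → ℤˣ) (z : ℂ) (h : isDR n a z) (D : ℕ)
    (hD : (minpoly ℤ z).natDegree ≤ D) (i : ℕ) : |(minpoly ℤ z).coeff i| ≤ 4 ^ D := by
  have hi := ipoly_root_int n a z h.1
  have h1 := Polynomial.coeff_bdd_of_roots_le (B := 2) (d := D) (algebraMap ℤ ℂ) (minpoly.monic hi)
    (IsAlgClosed.splits _) hD (fun w hw => by
      have := Polynomial.isRoot_of_mem_roots hw
      rw [Polynomial.IsRoot.def, Polynomial.eval_map_algebraMap] at this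
      exact (ipoly_root_lt n a w (minpoly_root n a z h w this)).le) i
  rw [Polynomial.coeff_map, max_eq_left (by norm_num)] at h1
  simp only [algebraMap_int_eq, eq_intCast, Complex.norm_intCast] at h1
  have h2 : (D.choose (D / 2) : ℝ) ≤ 2 ^ D := by exact_mod_cast Nat.choose_le_two_pow D (D / 2)
  have h3 : |((minpoly ℤ z).coeff i : ℝ)| ≤ 4 ^ D := by
    refine h1.trans ?_
    calc (2:ℝ) ^ D * (D.choose (D / 2) : ℝ) ≤ 2 ^ D * 2 ^ D := by gcongr
      _ = 4 ^ D := by rw [← mul_pow]; norm_num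
  exact_mod_cast h3

lemma Pr_low (p M : ℝ) (h0 : 0 ≤ p) (h1 : p ≤ 1) (hp : p ≤ M) (hq : 1 - p ≤ M)
    (n D : ℕ) (hD : 0 < D) :
    Pr p {a : Fin (n + 1) → ℤˣ | ∃ z, isDR n a z ∧ (minpoly ℤ z).natDegree < D ∧
      ¬ ∃ m, 0 < m ∧ z ^ m = 1} ≤ (4 ^ (D + 1)) ^ D * M ^ (n / (16 * D ^ 2)) := by
  classical
  have hM0 : 0 ≤ M := h0.trans hp
  let s : Finset (Fin D → ℤ) := Fintype.piFinset (fun _ => Finset.Icc (-(4 ^ D)) (4 ^ D))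
  let F : (Fin D → ℤ) → Polynomial ℤ := fun c =>
    ∑ j : Fin D, Polynomial.C (c j) * Polynomial.X ^ (j : ℕ)
  let B : (Fin D → ℤ) → Set (Fin (n + 1) → ℤˣ) := fun c =>
    {a | (∃ α : ℂ, Polynomial.aeval α (F c) = 0 ∧ 2 ≤ ‖α‖ ^ (16 * D ^ 2)) ∧
      ∀ α : ℂ, Polynomial.aeval α (F c) = 0 → Polynomial.aeval α (ipoly n a) = 0}
  have hsub : {a : Fin (n + 1) → ℤˣ | ∃ z, isDR n a z ∧ (minpoly ℤ z).natDegree < D ∧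
      ¬ ∃ m, 0 < m ∧ z ^ m = 1} ⊆ ⋃ c ∈ s, B c := by
    rintro a ⟨z, hz, hd, hnr⟩
    have hF : F (fun j => (minpoly ℤ z).coeff j) = minpoly ℤ z := by
      ext k
      rw [show (F _).coeff k = _ from fsum_coeff D _ k]
      split_ifs with h
      · rfl
      · rw [Polynomial.coeff_eq_zero_of_natDegree_lt (by omega)]
    simp only [Set.mem_iUnion]
    refine ⟨fun j => (minpoly ℤ z).coeff j, ?_, ?_, ?_⟩
    · simp only [s, Fintype.mem_piFinset, Finset.mem_Icc]
      intro j
      exact abs_le.1 (minpoly_coeff n a z hz D hd.le j)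
    · rw [hF]
      by_contra hc
      push Not at hc
      apply hnr
      apply kr_final z (ipoly_root_int n a z hz.1) (ipoly_root_ne n a z hz.1)
      intro α hα
      rcases le_total ‖α‖ 1 with h | h
      · exact (pow_le_one₀ (norm_nonneg _) h).trans (by norm_num)
      · refine (pow_le_pow_right₀ h ?_).trans (hc α hα).le
        gcongr
    · rw [hF]
      exact fun α hα => minpoly_root n a z hz α hα
  refine (Pr_mono h0 h1 hsub).trans ((Pr_biUnion_le h0 h1 s B).trans ?_)
  have hB : ∀ c ∈ s, Pr p (B c) ≤ M ^ (n / (16 * D ^ 2)) := by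
    intro c _
    by_cases h : ∃ α : ℂ, Polynomial.aeval α (F c) = 0 ∧ 2 ≤ ‖α‖ ^ (16 * D ^ 2)
    · obtain ⟨α, ha1, ha2⟩ := h
      exact (Pr_mono h0 h1 (fun a ha => ha.2 α ha1)).trans
        (Pr_root p M h0 h1 hp hq n _ (by positivity) α ha2)
    · have : B c = ∅ := by
        ext a; simp only [B, Set.mem_ofPred_eq, Set.mem_empty_iff_false, iff_false]
        exact fun hh => h hh.1
      rw [this, Pr_empty]; positivity
  refine (Finset.sum_le_sum hB).trans ?_
  rw [Finset.sum_const, nsmul_eq_mul]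
  gcongr
  have hcard : s.card ≤ (4 ^ (D + 1)) ^ D := by
    simp only [s, Fintype.card_piFinset, Finset.prod_const, Finset.card_univ, Fintype.card_fin]
    gcongr
    rw [Int.card_Icc]
    have : (1:ℤ) ≤ 4 ^ D := one_le_pow₀ (by norm_num)
    rw [Int.toNat_le]; push_cast; rw [pow_succ]; linarith
  exact_mod_cast hcard

end

section


lemma totient_aux (m : ℕ) : 0 < m → m ≤ Nat.totient m ^ 2 * Nat.gcd 2 m := by
  induction m using Nat.recOnPosPrimePosCoprime with
  | prime_pow p k hp hk =>
    intro _
    rw [Nat.totient_prime_pow hp hk]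
    obtain ⟨j, rfl⟩ := Nat.exists_eq_succ_of_ne_zero hk.ne'
    rw [Nat.succ_eq_add_one, Nat.add_sub_cancel, mul_pow]
    have hpp : 1 ≤ p ^ j := Nat.one_le_pow _ _ hp.pos
    rcases hp.eq_two_or_odd' with rfl | hodd
    · rw [Nat.gcd_eq_left (dvd_pow_self 2 (by omega))]
      simp only [Nat.add_one_sub_one, one_pow, mul_one, pow_succ]
      nlinarith
    · have h3 : 3 ≤ p := by
        have := hp.two_le
        obtain ⟨t, ht⟩ := hodd
        omega
      obtain ⟨q, rfl⟩ : ∃ q, p = q + 3 := ⟨p - 3, by omega⟩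
      have hg : 1 ≤ Nat.gcd 2 ((q + 3) ^ (j + 1)) := Nat.gcd_pos_of_pos_left _ (by norm_num)
      calc (q + 3) ^ (j + 1) = (q + 3) ^ j * (q + 3) := pow_succ _ _
        _ ≤ ((q + 3) ^ j) ^ 2 * (q + 2) ^ 2 := by
          apply Nat.mul_le_mul <;> nlinarith
        _ ≤ _ := by
          rw [show q + 3 - 1 = q + 2 by omega]
          exact Nat.le_mul_of_pos_right _ hg
  | zero => intro h; omega
  | one => intro _; simp
  | coprime a b ha hb hab iha ihb =>
    intro _
    rw [Nat.totient_mul hab, Nat.Coprime.gcd_mul 2 hab]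
    calc a * b ≤ (Nat.totient a ^ 2 * Nat.gcd 2 a) * (Nat.totient b ^ 2 * Nat.gcd 2 b) :=
          Nat.mul_le_mul (iha (by omega)) (ihb (by omega))
      _ = _ := by ring

lemma totient_bound (m : ℕ) (hm : 0 < m) : m ≤ 2 * Nat.totient m ^ 2 := by
  have h1 := totient_aux m hm
  have h2 : Nat.gcd 2 m ≤ 2 := Nat.gcd_le_left _ (by norm_num)
  nlinarith [Nat.mul_le_mul_left (Nat.totient m ^ 2) h2]

def blk (n m : ℕ) (hm : 2 ≤ m) : Fin (n / m) ⊕ Fin (n / m) → Fin (n + 1) :=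
  Sum.elim (fun i => ⟨m * i, by
      have := Nat.mul_div_le n m
      have := Nat.mul_le_mul_left m i.2
      have := Nat.mul_succ m i
      omega⟩)
    (fun i => ⟨m * i + 1, by
      have := Nat.mul_div_le n m
      have := Nat.mul_le_mul_left m i.2
      have := Nat.mul_succ m i
      omega⟩)

lemma blk_inj (n m : ℕ) (hm : 2 ≤ m) : Function.Injective (blk n m hm) := by
  have h0 : 0 < m := by omega
  have key : ∀ i j : ℕ, m * i ≠ m * j + 1 := by
    intro i j h
    have h1 : m ∣ 1 := (Nat.dvd_add_right (dvd_mul_right m j)).1 (h ▸ dvd_mul_right m i)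
    have := Nat.le_of_dvd (by norm_num) h1
    omega
  rintro (i | i) (j | j) h
  · have : m * (i : ℕ) = m * j := congrArg Fin.val h
    rw [Fin.ext (Nat.eq_of_mul_eq_mul_left h0 this)]
  · exact absurd (congrArg Fin.val h) (key i j)
  · exact absurd (congrArg Fin.val h).symm (key j i)
  · have : m * (i : ℕ) + 1 = m * j + 1 := congrArg Fin.val h
    rw [Fin.ext (Nat.eq_of_mul_eq_mul_left h0 (Nat.succ_injective this))]

lemma block_bound (p : ℝ) (h0 : 0 ≤ p) (h1 : p ≤ 1) (C : ℝ)
    (hC : ∀ N : ℕ, 2 ≤ N → ∀ (e : ℕ → ℤˣ) (A B : ℤ),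
      Pr p {a : Fin N → ℤˣ | Ssum N e a = A ∧ Tsum N e a = B} ≤ C / (N : ℝ) ^ 2)
    (n m : ℕ) (hm : 2 ≤ m) (hn : 2 ≤ n / m) (A : Set (Fin (n + 1) → ℤˣ))
    (hA : ∀ x x' y, Function.extend (blk n m hm) x y ∈ A → Function.extend (blk n m hm) x' y ∈ A →
      (Ssum _ 1 (x ∘ Sum.inl) = Ssum _ 1 (x' ∘ Sum.inl) ∧
        Tsum _ 1 (x ∘ Sum.inl) = Tsum _ 1 (x' ∘ Sum.inl)) ∧
      (Ssum _ 1 (x ∘ Sum.inr) = Ssum _ 1 (x' ∘ Sum.inr) ∧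
        Tsum _ 1 (x ∘ Sum.inr) = Tsum _ 1 (x' ∘ Sum.inr))) :
    Pr p A ≤ (C / ((n / m : ℕ) : ℝ) ^ 2) ^ 2 := by
  apply Pr_extend_le h0 h1 (blk n m hm) (blk_inj n m hm)
  intro y
  rcases Set.eq_empty_or_nonempty {x | Function.extend (blk n m hm) x y ∈ A} with h | ⟨x', hx'⟩
  · rw [h, Pr_empty]; positivity
  · have hsub : {x | Function.extend (blk n m hm) x y ∈ A} ⊆
        {x | x ∘ Sum.inl ∈ {u : Fin (n / m) → ℤˣ | Ssum _ 1 u = Ssum _ 1 (x' ∘ Sum.inl) ∧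
          Tsum _ 1 u = Tsum _ 1 (x' ∘ Sum.inl)} ∧
          x ∘ Sum.inr ∈ {u : Fin (n / m) → ℤˣ | Ssum _ 1 u = Ssum _ 1 (x' ∘ Sum.inr) ∧
          Tsum _ 1 u = Tsum _ 1 (x' ∘ Sum.inr)}} := by
      intro x hx
      exact hA x x' y hx hx'
    refine (Pr_mono h0 h1 hsub).trans ?_
    rw [Pr_sum_prod, sq (C / _)]
    exact mul_le_mul (hC _ hn _ _ _) (hC _ hn _ _ _) (Pr_nonneg h0 h1 _)
      ((Pr_nonneg h0 h1 _).trans (hC _ hn 1 0 0))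

lemma blk_eval (n m : ℕ) (hm : 2 ≤ m) (x : Fin (n / m) ⊕ Fin (n / m) → ℤˣ) (z : ℂ)
    (hz : z ^ m = 1) :
    ∑ i, ((x i : ℤ) : ℂ) * z ^ ((blk n m hm i : Fin (n + 1)) : ℕ) =
      (Ssum _ 1 (x ∘ Sum.inl) : ℤ) + z * (Ssum _ 1 (x ∘ Sum.inr) : ℤ) := by
  rw [Fintype.sum_sum_type]
  simp only [blk, Sum.elim_inl, Sum.elim_inr, pow_succ, pow_mul, hz, one_pow, one_mul, mul_one,
    Ssum, Pi.one_apply, Units.val_one, Function.comp_apply]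
  push_cast
  rw [Finset.mul_sum]
  congr 1
  exact Finset.sum_congr rfl fun i _ => mul_comm _ _

lemma blk_eval_der (n m : ℕ) (hm : 2 ≤ m) (x : Fin (n / m) ⊕ Fin (n / m) → ℤˣ) (z : ℂ)
    (hz : z ^ m = 1) :
    ∑ i, ((x i : ℤ) : ℂ) * (((blk n m hm i : Fin (n + 1)) : ℕ) *
        z ^ ((blk n m hm i : Fin (n + 1)) : ℕ)) =
      m * (Tsum _ 1 (x ∘ Sum.inl) : ℤ) + z * (m * (Tsum _ 1 (x ∘ Sum.inr) : ℤ) +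
        (Ssum _ 1 (x ∘ Sum.inr) : ℤ)) := by
  rw [Fintype.sum_sum_type]
  simp only [blk, Sum.elim_inl, Sum.elim_inr, pow_succ, pow_mul, hz, one_pow, one_mul, mul_one,
    Ssum, Tsum, Pi.one_apply, Units.val_one, Function.comp_apply]
  push_cast
  simp only [Finset.mul_sum, mul_add, ← Finset.sum_add_distrib]
  exact Finset.sum_congr rfl fun i _ => by ring

lemma isDR_diff (n m : ℕ) (hm : 2 ≤ m) (z : ℂ) (hz : z ^ m = 1)
    (x x' : Fin (n / m) ⊕ Fin (n / m) → ℤˣ) (y : Fin (n + 1) → ℤˣ)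
    (h : isDR n (Function.extend (blk n m hm) x y) z)
    (h' : isDR n (Function.extend (blk n m hm) x' y) z) :
    (((Ssum _ 1 (x ∘ Sum.inl) - Ssum _ 1 (x' ∘ Sum.inl) : ℤ) : ℂ) +
      z * ((Ssum _ 1 (x ∘ Sum.inr) - Ssum _ 1 (x' ∘ Sum.inr) : ℤ) : ℂ) = 0) ∧
    (((m * (Tsum _ 1 (x ∘ Sum.inl) - Tsum _ 1 (x' ∘ Sum.inl)) : ℤ) : ℂ) +
      z * ((m * (Tsum _ 1 (x ∘ Sum.inr) - Tsum _ 1 (x' ∘ Sum.inr)) +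
       (Ssum _ 1 (x ∘ Sum.inr) - Ssum _ 1 (x' ∘ Sum.inr)) : ℤ) : ℂ) = 0) := by
  have e1 := extend_diff (R := ℂ) (blk n m hm) (blk_inj n m hm) x x' y (fun j => z ^ (j : ℕ))
  have e2 := extend_diff (R := ℂ) (blk n m hm) (blk_inj n m hm) x x' y
    (fun j => (j : ℕ) * z ^ (j : ℕ))
  rw [← ipoly_aeval, ← ipoly_aeval, h.1, h'.1, blk_eval n m hm x z hz, blk_eval n m hm x' z hz] at e1
  rw [← ipoly_aeval_der, ← ipoly_aeval_der, h.2, h'.2, blk_eval_der n m hm x z hz,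
    blk_eval_der n m hm x' z hz] at e2
  push_cast
  constructor
  · linear_combination -e1
  · linear_combination -e2

lemma nonreal_indep (z : ℂ) (hz : z.im ≠ 0) (u v : ℤ) (h : (u : ℂ) + z * (v : ℂ) = 0) :
    u = 0 ∧ v = 0 := by
  have h1 := congrArg Complex.im h
  simp at h1
  have hv : v = 0 := h1.resolve_left hz
  rw [hv] at h
  simp at h
  exact ⟨h, hv⟩

lemma Pr_nonreal (p : ℝ) (h0 : 0 ≤ p) (h1 : p ≤ 1) (C : ℝ)
    (hC : ∀ N : ℕ, 2 ≤ N → ∀ (e : ℕ → ℤˣ) (A B : ℤ),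
      Pr p {a : Fin N → ℤˣ | Ssum N e a = A ∧ Tsum N e a = B} ≤ C / (N : ℝ) ^ 2)
    (n m : ℕ) (hm : 2 ≤ m) (hn : 2 ≤ n / m) (z : ℂ) (hz : z ^ m = 1) (hzi : z.im ≠ 0) :
    Pr p {a : Fin (n + 1) → ℤˣ | isDR n a z} ≤ (C / ((n / m : ℕ) : ℝ) ^ 2) ^ 2 := by
  apply block_bound p h0 h1 C hC n m hm hn
  intro x x' y hx hx'
  obtain ⟨e1, e2⟩ := isDR_diff n m hm z hz x x' y hx hx'
  obtain ⟨a1, a2⟩ := nonreal_indep z hzi _ _ e1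
  obtain ⟨b1, b2⟩ := nonreal_indep z hzi _ _ e2
  rw [a2, add_zero] at b2
  have hm0 : (m : ℤ) ≠ 0 := by exact_mod_cast (by omega : m ≠ 0)
  have b1 := (mul_eq_zero.1 b1).resolve_left hm0
  have b2 := (mul_eq_zero.1 b2).resolve_left hm0
  exact ⟨⟨by linarith, by linarith⟩, by linarith, by linarith⟩

lemma Pr_both (p : ℝ) (h0 : 0 ≤ p) (h1 : p ≤ 1) (C : ℝ)
    (hC : ∀ N : ℕ, 2 ≤ N → ∀ (e : ℕ → ℤˣ) (A B : ℤ),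
      Pr p {a : Fin N → ℤˣ | Ssum N e a = A ∧ Tsum N e a = B} ≤ C / (N : ℝ) ^ 2)
    (n : ℕ) (hn : 2 ≤ n / 2) :
    Pr p ({a : Fin (n + 1) → ℤˣ | isDR n a 1} ∩ {a | isDR n a (-1)}) ≤
      (C / ((n / 2 : ℕ) : ℝ) ^ 2) ^ 2 := by
  apply block_bound p h0 h1 C hC n 2 le_rfl hn
  intro x x' y hx hx'
  obtain ⟨e1, e2⟩ := isDR_diff n 2 le_rfl 1 (by norm_num) x x' y hx.1 hx'.1
  obtain ⟨f1, f2⟩ := isDR_diff n 2 le_rfl (-1) (by norm_num) x x' y hx.2 hx'.2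
  rw [one_mul] at e1 e2
  rw [neg_one_mul] at f1 f2
  norm_cast at e1 e2 f1 f2
  refine ⟨⟨?_, ?_⟩, ?_, ?_⟩ <;> linarith

end

section


lemma im_ne_zero_of_root (z : ℂ) (m : ℕ) (hm : m ≠ 0) (hz : z ^ m = 1) (h1 : z ≠ 1) (h2 : z ≠ -1) :
    z.im ≠ 0 := by
  intro hi
  have hn := Complex.norm_eq_one_of_pow_eq_one hz hm
  have hre : z = (z.re : ℂ) := Complex.ext (by simp) (by simp [hi])
  rw [hre, Complex.norm_real, Real.norm_eq_abs] at hn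
  rcases eq_or_eq_neg_of_abs_eq hn with h | h
  · exact h1 (by rw [hre, h]; simp)
  · exact h2 (by rw [hre, h]; simp)

lemma order_bound (z : ℂ) (D : ℕ) (hD : (minpoly ℤ z).natDegree < D) (h : ∃ m, 0 < m ∧ z ^ m = 1) :
    0 < orderOf z ∧ orderOf z ≤ 2 * D ^ 2 := by
  have h1 : 0 < orderOf z := orderOf_pos_iff.2 (isOfFinOrder_iff_pow_eq_one.2 h)
  refine ⟨h1, ?_⟩
  rw [← Polynomial.cyclotomic_eq_minpoly (IsPrimitiveRoot.orderOf z) h1,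
    Polynomial.natDegree_cyclotomic] at hD
  refine (totient_bound _ h1).trans ?_
  gcongr

lemma Pr_unity (p : ℝ) (h0 : 0 ≤ p) (h1 : p ≤ 1) (C : ℝ)
    (hC : ∀ N : ℕ, 2 ≤ N → ∀ (e : ℕ → ℤˣ) (A B : ℤ),
      Pr p {a : Fin N → ℤˣ | Ssum N e a = A ∧ Tsum N e a = B} ≤ C / (N : ℝ) ^ 2)
    (n D : ℕ) (hn : 4 * D ^ 2 ≤ n) (hD : 0 < D) :
    Pr p {a : Fin (n + 1) → ℤˣ | ∃ z, isDR n a z ∧ (minpoly ℤ z).natDegree < D ∧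
      (∃ m, 0 < m ∧ z ^ m = 1) ∧ z ≠ 1 ∧ z ≠ -1} ≤
      16 * C ^ 2 * (2 * (D : ℝ) ^ 2) ^ 6 / (n : ℝ) ^ 4 := by
  classical
  have hn0 : 0 < n := by nlinarith
  have hnr : (0 : ℝ) < n := by exact_mod_cast hn0
  let s : Finset (Σ _ : ℕ, ℂ) :=
    (Finset.Icc 2 (2 * D ^ 2)).sigma fun m => Polynomial.nthRootsFinset m (1 : ℂ)
  let B : (Σ _ : ℕ, ℂ) → Set (Fin (n + 1) → ℤˣ) := fun t =>
    {a | t.2.im ≠ 0 ∧ isDR n a t.2}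
  have hsub : {a : Fin (n + 1) → ℤˣ | ∃ z, isDR n a z ∧ (minpoly ℤ z).natDegree < D ∧
      (∃ m, 0 < m ∧ z ^ m = 1) ∧ z ≠ 1 ∧ z ≠ -1} ⊆ ⋃ t ∈ s, B t := by
    rintro a ⟨z, hz, hd, hm, hz1, hz2⟩
    obtain ⟨o1, o2⟩ := order_bound z D hd hm
    simp only [Set.mem_iUnion]
    refine ⟨⟨orderOf z, z⟩, ?_, im_ne_zero_of_root z _ o1.ne' (pow_orderOf_eq_one z) hz1 hz2, hz⟩
    simp only [s, Finset.mem_sigma, Finset.mem_Icc]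
    refine ⟨⟨?_, o2⟩, ?_⟩
    · have : orderOf z ≠ 1 := fun h => hz1 (orderOf_eq_one_iff.1 h)
      omega
    · rw [Polynomial.mem_nthRootsFinset o1]
      exact pow_orderOf_eq_one z
  refine (Pr_mono h0 h1 hsub).trans ((Pr_biUnion_le h0 h1 s B).trans ?_)
  have hB : ∀ t ∈ s, Pr p (B t) ≤ 16 * C ^ 2 * (2 * (D : ℝ) ^ 2) ^ 4 / (n : ℝ) ^ 4 := by
    rintro ⟨m, z⟩ ht
    simp only [s, Finset.mem_sigma, Finset.mem_Icc] at ht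
    obtain ⟨⟨hm1, hm2⟩, hz⟩ := ht
    have hm0 : 0 < m := by omega
    rw [Polynomial.mem_nthRootsFinset hm0] at hz
    by_cases hi : z.im = 0
    · have : B ⟨m, z⟩ = ∅ := by
        ext a; simp only [B, Set.mem_ofPred_eq, Set.mem_empty_iff_false, iff_false]
        exact fun hh => hh.1 hi
      rw [this, Pr_empty]; positivity
    · have hnm : 2 ≤ n / m := by
        rw [Nat.le_div_iff_mul_le hm0]; omega
      have h2 : Pr p (B ⟨m, z⟩) ≤ (C / ((n / m : ℕ) : ℝ) ^ 2) ^ 2 :=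
        (Pr_mono h0 h1 (fun a ha => ha.2)).trans
          (Pr_nonreal p h0 h1 C hC n m hm1 hnm z hz hi)
      refine h2.trans ?_
      have hmr : (0 : ℝ) < m := by exact_mod_cast hm0
      have h3 : (n : ℝ) / (2 * m) ≤ ((n / m : ℕ) : ℝ) := by
        rw [div_le_iff₀ (by positivity)]
        have h4 := Nat.lt_mul_div_succ n hm0
        have h5 : n ≤ (n / m) * (2 * m) := by nlinarith
        exact_mod_cast h5
      have hnp : (0 : ℝ) < (n : ℝ) / (2 * m) := by positivity
      have h6 : (m : ℝ) ≤ 2 * (D : ℝ) ^ 2 := by exact_mod_cast hm2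
      rw [div_pow]
      calc C ^ 2 / (((n / m : ℕ) : ℝ) ^ 2) ^ 2 ≤ C ^ 2 / (((n : ℝ) / (2 * m)) ^ 2) ^ 2 := by gcongr
        _ = 16 * C ^ 2 * (m : ℝ) ^ 4 / (n : ℝ) ^ 4 := by field_simp; ring
        _ ≤ _ := by gcongr
  refine (Finset.sum_le_sum hB).trans ?_
  rw [Finset.sum_const, nsmul_eq_mul]
  have hcard : (s.card : ℝ) ≤ (2 * (D : ℝ) ^ 2) ^ 2 := by
    have : s.card ≤ (2 * D ^ 2) ^ 2 := by
      rw [Finset.card_sigma]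
      calc _ ≤ ∑ m ∈ Finset.Icc 2 (2 * D ^ 2), 2 * D ^ 2 := by
            apply Finset.sum_le_sum
            intro m hm
            rw [Finset.mem_Icc] at hm
            refine le_trans ?_ hm.2
            exact (Multiset.toFinset_card_le _).trans (Polynomial.card_nthRoots m 1)
        _ ≤ _ := by
            rw [Finset.sum_const, smul_eq_mul, pow_two (2 * D ^ 2), Nat.card_Icc]
            exact Nat.mul_le_mul_right _ (by omega)
    exact_mod_cast this
  calc _ ≤ (2 * (D : ℝ) ^ 2) ^ 2 * (16 * C ^ 2 * (2 * (D : ℝ) ^ 2) ^ 4 / (n : ℝ) ^ 4) := by gcongr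
    _ = _ := by ring

lemma isDR_neg_one (n : ℕ) (a : Fin (n + 1) → ℤˣ) :
    isDR n a (-1) ↔ Ssum (n + 1) alt a = 0 ∧ Tsum (n + 1) alt a = 0 := by
  have e1 : Polynomial.aeval (-1 : ℂ) (ipoly n a) = ((Ssum (n + 1) alt a : ℤ) : ℂ) := by
    rw [ipoly_aeval, Ssum]; push_cast
    simp [alt]
  have e2 : (-1) * Polynomial.aeval (-1 : ℂ) (Polynomial.derivative (ipoly n a)) =
      ((Tsum (n + 1) alt a : ℤ) : ℂ) := by
    rw [ipoly_aeval_der, Tsum]; push_cast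
    refine Finset.sum_congr rfl fun j _ => ?_
    simp [alt]; ring
  unfold isDR
  rw [e1, Int.cast_eq_zero]
  constructor
  · rintro ⟨h, h'⟩
    rw [h', mul_zero] at e2
    exact ⟨h, by exact_mod_cast e2.symm⟩
  · rintro ⟨h, h'⟩
    rw [h', Int.cast_zero] at e2
    exact ⟨h, by simpa using e2⟩

lemma isDR_one_alt (n : ℕ) (a : Fin (n + 1) → ℤˣ) :
    isDR n (fun j => a j * alt j) 1 ↔ isDR n a (-1) := by
  have e1 : Polynomial.aeval (1 : ℂ) (ipoly n (fun j => a j * alt j)) =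
      Polynomial.aeval (-1 : ℂ) (ipoly n a) := by
    rw [ipoly_aeval, ipoly_aeval]
    simp [alt]
  have e2 : 1 * Polynomial.aeval (1 : ℂ) (Polynomial.derivative (ipoly n (fun j => a j * alt j))) =
     (-1) * Polynomial.aeval (-1 : ℂ) (Polynomial.derivative (ipoly n a)) := by
    rw [ipoly_aeval_der, ipoly_aeval_der]
    refine Finset.sum_congr rfl fun j _ => ?_
    simp [alt]; ring
  unfold isDR
  rw [e1]
  rw [one_mul] at e2
  rw [e2]; simp

lemma Pr_symm (n : ℕ) : Pr (1 / 2) {a : Fin (n + 1) → ℤˣ | isDR n a 1} =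
    Pr (1 / 2) {a : Fin (n + 1) → ℤˣ | isDR n a (-1)} := by
  classical
  unfold Pr
  symm
  refine Fintype.sum_equiv (Equiv.mulRight (fun j : Fin (n + 1) => alt j)) _ _ ?_
  intro a
  have hw : ∀ u : ℤˣ, wt (1 / 2) u = 1 / 2 := by
    intro u; unfold wt; split_ifs <;> norm_num
  simp only [hw, Set.indicator_apply, Set.mem_ofPred_eq]
  have : (Equiv.mulRight (fun j : Fin (n + 1) => alt j)) a = fun j => a j * alt j := rfl
  rw [this]
  by_cases h : isDR n a (-1)
  · rw [if_pos h, if_pos ((isDR_one_alt n a).2 h)]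
  · rw [if_neg h, if_neg (fun hh => h ((isDR_one_alt n a).1 hh))]

lemma Pr_one_small (p : ℝ) (h0 : 0 < p) (h1 : p < 1) (hp : p ≠ 1 / 2) :
    ∃ c : ℝ, 0 ≤ c ∧ c < 1 ∧ ∀ n, Pr p {a : Fin (n + 1) → ℤˣ | isDR n a 1} ≤ c ^ (n + 1) := by
  classical
  have hq : 0 < 1 - p := by linarith
  set t := √((1 - p) / p) with ht
  have htpos : 0 < t := Real.sqrt_pos.2 (by positivity)
  have ht2 : t ^ 2 = (1 - p) / p := Real.sq_sqrt (by positivity)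
  set s := Real.log t
  have hes : Real.exp s = t := Real.exp_log htpos
  refine ⟨p * t + (1 - p) * t⁻¹, by positivity, ?_, ?_⟩
  · have hpt : p * t ^ 2 = 1 - p := by rw [ht2]; field_simp
    have e : p * t + (1 - p) * t⁻¹ = 2 * (p * t) := by rw [← hpt]; field_simp; ring
    rw [e]
    have e2 : (2 * (p * t)) ^ 2 < 1 := by
      have : (2 * (p * t)) ^ 2 = 4 * p * (1 - p) := by rw [← hpt]; ring
      rw [this]
      have : 0 < (p - 1 / 2) ^ 2 := by have := sub_ne_zero.2 hp; positivity
      nlinarith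
    have : 0 < 2 * (p * t) := by positivity
    nlinarith
  · intro n
    have e := sum_prod_units (ι := Fin (n + 1))
      (fun _ u => wt p u * Real.exp (s * ((u : ℤ) : ℝ)))
    simp only [wt_one, wt_neg_one, Finset.prod_const, Finset.card_univ, Fintype.card_fin,
      Units.val_one, Units.val_neg, Int.cast_one, Int.cast_neg, mul_one, mul_neg,
      Real.exp_neg, hes] at e
    rw [← e]
    unfold Pr
    apply Finset.sum_le_sum
    intro a _
    rw [Set.indicator_apply]
    have hnn : 0 ≤ ∏ i, wt p (a i) := prod_wt_nonneg h0.le h1.le a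
    rw [Finset.prod_mul_distrib, ← Real.exp_sum, ← Finset.mul_sum]
    split_ifs with h
    · have h2 := h.1
      rw [ipoly_aeval] at h2
      simp only [one_pow, mul_one] at h2
      have h3 : ∑ j, ((a j : ℤ) : ℝ) = 0 := by
        have : ((∑ j, (a j : ℤ) : ℤ) : ℂ) = 0 := by push_cast; exact h2
        have := Int.cast_eq_zero.1 this
        exact_mod_cast this
      rw [h3]; simp
    · positivity

end

section


lemma exists_r : ∃ r : ℕ → ℕ, (∀ n, r n ^ 12 ≤ n ∧ n < (r n + 1) ^ 12) ∧ Tendsto r atTop atTop := by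
  have h : ∀ n : ℕ, ∃ r, r ^ 12 ≤ n ∧ n < (r + 1) ^ 12 := by
    intro n
    induction n with
    | zero => exact ⟨0, by norm_num, by norm_num⟩
    | succ n ih =>
      obtain ⟨r, h1, h2⟩ := ih
      rcases Nat.lt_or_ge (n + 1) ((r + 1) ^ 12) with h | h
      · exact ⟨r, by omega, h⟩
      · refine ⟨r + 1, h, ?_⟩
        have : (r + 1) ^ 12 < (r + 1 + 1) ^ 12 := Nat.pow_lt_pow_left (by omega) (by norm_num)
        omega
  choose r hr using h
  refine ⟨r, hr, tendsto_atTop.2 fun b => ?_⟩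
  filter_upwards [eventually_ge_atTop (b ^ 12)] with n hn
  by_contra hc
  have h1 : r n + 1 ≤ b := by omega
  have := Nat.pow_le_pow_left h1 12
  have := (hr n).2
  omega

lemma low_arith (M : ℝ) (hM0 : 0 ≤ M) (hM : M ^ 2 ≤ 1 / 3) (n r : ℕ) (hr : 144 ≤ r)
    (hn : r ^ 12 ≤ n) :
    ((4 : ℝ) ^ (3 * r + 1)) ^ (3 * r) * M ^ (n / (16 * (3 * r) ^ 2)) ≤ (1 / 2) ^ r := by
  have hM1 : M ≤ 1 := by nlinarith
  have hr0 : 0 < r := by omega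
  have h1 : 8 * r ^ 3 ≤ n / (16 * (3 * r) ^ 2) := by
    rw [Nat.le_div_iff_mul_le (by positivity)]
    refine le_trans ?_ hn
    have e1 : 8 * r ^ 3 * (16 * (3 * r) ^ 2) = (144 * 8) * r ^ 5 := by ring
    have e2 : r ^ 12 = r ^ 7 * r ^ 5 := by ring
    rw [e1, e2]
    apply Nat.mul_le_mul_right
    calc 144 * 8 ≤ 144 ^ 7 := by norm_num
      _ ≤ r ^ 7 := Nat.pow_le_pow_left hr 7
  have h2 : (3 * r + 1) * (3 * r) ≤ r ^ 3 := by
    have : r ^ 3 = r * r * r := by ring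
    nlinarith
  calc ((4 : ℝ) ^ (3 * r + 1)) ^ (3 * r) * M ^ (n / (16 * (3 * r) ^ 2))
      ≤ 4 ^ (r ^ 3) * M ^ (8 * r ^ 3) := by
        rw [← pow_mul]
        apply mul_le_mul
        · exact pow_le_pow_right₀ (by norm_num) h2
        · exact pow_le_pow_of_le_one hM0 hM1 h1
        · positivity
        · positivity
    _ = (4 * M ^ 8) ^ (r ^ 3) := by rw [mul_pow, ← pow_mul]
    _ ≤ (1 / 2) ^ (r ^ 3) := by
        apply pow_le_pow_left₀ (by positivity)
        have : M ^ 8 ≤ (1 / 3) ^ 4 := by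
          rw [show M ^ 8 = (M ^ 2) ^ 4 by ring]
          exact pow_le_pow_left₀ (by positivity) hM 4
        nlinarith
    _ ≤ (1 / 2) ^ r := by
        apply pow_le_pow_of_le_one (by norm_num) (by norm_num)
        calc r = r ^ 1 := (pow_one r).symm
          _ ≤ r ^ 3 := Nat.pow_le_pow_right hr0 (by norm_num)

lemma rest_tendsto (p M : ℝ) (h0 : 0 < p) (h1 : p < 1) (hp : p ≤ M) (hq : 1 - p ≤ M)
    (hM : √3 * M < 1) :
    Tendsto (fun n : ℕ => (n : ℝ) ^ 2 *
      Pr p {a : Fin (n + 1) → ℤˣ | ∃ z, isDR n a z ∧ z ≠ 1 ∧ z ≠ -1}) atTop (nhds 0) := by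
  obtain ⟨C, hC0, hC⟩ := Pr_conc p h0 h1
  obtain ⟨r, hr, hrt⟩ := exists_r
  have hM0 : 0 < M := h0.trans_le hp
  have hs3 : √3 ^ 2 = 3 := Real.sq_sqrt (by norm_num)
  have hρ0 : 0 < √3 * M := by positivity
  have hM2 : M ^ 2 ≤ 1 / 3 := by
    have : (√3 * M) ^ 2 ≤ 1 := pow_le_one₀ hρ0.le hM.le
    rw [mul_pow, hs3] at this; linarith
  have hd : 0 < 1 - √3 * M := by linarith
  have hg : Tendsto (fun k : ℕ => 2 ^ 24 * (√3 / (1 - √3 * M)) * ((k : ℝ) ^ 24 * (√3 * M) ^ k) +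
      2 ^ 24 * ((k : ℝ) ^ 24 * (1 / 2) ^ k)) atTop (nhds 0) := by
    have t1 := tendsto_pow_const_mul_const_pow_of_abs_lt_one 24
      (show |√3 * M| < 1 by rw [abs_of_pos hρ0]; exact hM)
    have t2 := tendsto_pow_const_mul_const_pow_of_abs_lt_one 24
      (show |(1 / 2 : ℝ)| < 1 by rw [abs_of_pos] <;> norm_num)
    simpa using (t1.const_mul (2 ^ 24 * (√3 / (1 - √3 * M)))).add (t2.const_mul (2 ^ 24))
  have hk : Tendsto (fun n : ℕ => (16 * C ^ 2 * 18 ^ 6) / (n : ℝ)) atTop (nhds 0) :=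
    tendsto_const_div_atTop_nhds_zero_nat _
  have htot := (hg.comp hrt).add hk
  rw [add_zero] at htot
  refine squeeze_zero' (Eventually.of_forall fun n => mul_nonneg (by positivity)
    (Pr_nonneg h0.le h1.le _)) ?_ htot
  filter_upwards [hrt.eventually_ge_atTop 144, eventually_ge_atTop 1] with n hr144 hn1
  obtain ⟨hrn, hnr⟩ := hr n
  simp only [Function.comp_apply]
  set k := r n
  have hk0 : 0 < k := by omega
  have hn0 : (0 : ℝ) < n := by exact_mod_cast hn1
  have hsub : {a : Fin (n + 1) → ℤˣ | ∃ z, isDR n a z ∧ z ≠ 1 ∧ z ≠ -1} ⊆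
      ({a | ∃ z, isDR n a z ∧ 3 * k ≤ (minpoly ℤ z).natDegree} ∪
      {a | ∃ z, isDR n a z ∧ (minpoly ℤ z).natDegree < 3 * k ∧ ¬ ∃ m, 0 < m ∧ z ^ m = 1}) ∪
      {a | ∃ z, isDR n a z ∧ (minpoly ℤ z).natDegree < 3 * k ∧
      (∃ m, 0 < m ∧ z ^ m = 1) ∧ z ≠ 1 ∧ z ≠ -1} := by
    rintro a ⟨z, hz, hz1, hz2⟩
    rcases Nat.lt_or_ge (minpoly ℤ z).natDegree (3 * k) with h | h
    · by_cases hm : ∃ m, 0 < m ∧ z ^ m = 1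
      · exact Or.inr ⟨z, hz, h, hm, hz1, hz2⟩
      · exact Or.inl (Or.inr ⟨z, hz, h, hm⟩)
    · exact Or.inl (Or.inl ⟨z, hz, h⟩)
  have hk2 : 4 * (3 * k) ^ 2 ≤ n := by
    refine le_trans ?_ hrn
    have e1 : 4 * (3 * k) ^ 2 = 36 * k ^ 2 := by ring
    have e2 : k ^ 12 = k ^ 10 * k ^ 2 := by ring
    rw [e1, e2]
    apply Nat.mul_le_mul_right
    calc 36 ≤ 144 ^ 10 := by norm_num
      _ ≤ k ^ 10 := Nat.pow_le_pow_left hr144 10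
  have b1 := Pr_high p M h0.le h1.le hp hq hM n k
  have b2 := Pr_low p M h0.le h1.le hp hq n (3 * k) (by omega)
  have b3 := Pr_unity p h0.le h1.le C hC n (3 * k) hk2 (by omega)
  have b2' := b2.trans (low_arith M hM0.le hM2 n k hr144 hrn)
  have hall := (Pr_mono h0.le h1.le hsub).trans ((Pr_union_le h0.le h1.le _ _).trans
    (add_le_add ((Pr_union_le h0.le h1.le _ _).trans (add_le_add b1 b2')) b3))
  have hn2 : (n : ℝ) ^ 2 ≤ 2 ^ 24 * (k : ℝ) ^ 24 := by
    have e : n ≤ (2 * k) ^ 12 := hnr.le.trans (Nat.pow_le_pow_left (by omega) 12)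
    have e' : (n : ℝ) ≤ (2 * (k : ℝ)) ^ 12 := by exact_mod_cast e
    calc (n : ℝ) ^ 2 ≤ ((2 * (k : ℝ)) ^ 12) ^ 2 := by gcongr
      _ = _ := by ring
  have hk12 : (k : ℝ) ^ 12 ≤ n := by exact_mod_cast hrn
  calc (n : ℝ) ^ 2 * Pr p {a : Fin (n + 1) → ℤˣ | ∃ z, isDR n a z ∧ z ≠ 1 ∧ z ≠ -1}
      ≤ (n : ℝ) ^ 2 * (√3 * ((√3 * M) ^ k / (1 - √3 * M)) + (1 / 2) ^ k +
          16 * C ^ 2 * (2 * ((3 * k : ℕ) : ℝ) ^ 2) ^ 6 / (n : ℝ) ^ 4) := by gcongr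
    _ = (n : ℝ) ^ 2 * (√3 * ((√3 * M) ^ k / (1 - √3 * M)) + (1 / 2) ^ k) +
          16 * C ^ 2 * 18 ^ 6 * (k : ℝ) ^ 12 / (n : ℝ) ^ 2 := by
        push_cast; field_simp; ring
    _ ≤ (2 ^ 24 * (k : ℝ) ^ 24) * (√3 * ((√3 * M) ^ k / (1 - √3 * M)) + (1 / 2) ^ k) +
          16 * C ^ 2 * 18 ^ 6 * n / (n : ℝ) ^ 2 := by gcongr
    _ = _ := by field_simp

lemma both_tendsto (p : ℝ) (h0 : 0 < p) (h1 : p < 1) :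
    Tendsto (fun n : ℕ => (n : ℝ) ^ 2 *
      Pr p ({a : Fin (n + 1) → ℤˣ | isDR n a 1} ∩ {a | isDR n a (-1)})) atTop (nhds 0) := by
  obtain ⟨C, hC0, hC⟩ := Pr_conc p h0 h1
  have hk : Tendsto (fun n : ℕ => (256 * C ^ 2) / (n : ℝ)) atTop (nhds 0) :=
    tendsto_const_div_atTop_nhds_zero_nat _
  refine squeeze_zero' (Eventually.of_forall fun n => mul_nonneg (by positivity)
    (Pr_nonneg h0.le h1.le _)) ?_ hk
  filter_upwards [eventually_ge_atTop 4] with n hn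
  have hn0 : (1 : ℝ) ≤ n := by exact_mod_cast (by omega : 1 ≤ n)
  have b := Pr_both p h0.le h1.le C hC n (by omega)
  have h3 : (n : ℝ) / 4 ≤ ((n / 2 : ℕ) : ℝ) := by
    have : n ≤ 4 * (n / 2) := by omega
    have : (n : ℝ) ≤ 4 * ((n / 2 : ℕ) : ℝ) := by exact_mod_cast this
    linarith
  calc _ ≤ (n : ℝ) ^ 2 * (C / ((n / 2 : ℕ) : ℝ) ^ 2) ^ 2 := by gcongr
    _ ≤ (n : ℝ) ^ 2 * (C / ((n : ℝ) / 4) ^ 2) ^ 2 := by gcongr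
    _ = 256 * C ^ 2 / (n : ℝ) ^ 2 := by field_simp; ring
    _ ≤ 256 * C ^ 2 / (n : ℝ) := by
        gcongr
        nlinarith

lemma main_Pr (p M : ℝ) (h0 : 0 < p) (h1 : p < 1) (hp : p ≤ M) (hq : 1 - p ≤ M)
    (hM : √3 * M < 1) :
    Tendsto (fun n : ℕ => (n : ℝ) ^ 2 * Pr p {a : Fin (n + 1) → ℤˣ | ∃ z, isDR n a z} -
      (if 4 ∣ n + 1 then (if p = 1 / 2 then 8 * √3 / (Real.pi * (4 * p * (1 - p)))
        else 4 * √3 / (Real.pi * (4 * p * (1 - p)))) else 0)) atTop (nhds 0) := by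
  have hr := rest_tendsto p M h0 h1 hp hq hM
  have hb := both_tendsto p h0 h1
  have hL := llt_Pr p h0 h1
  have hset : ∀ n : ℕ, {a : Fin (n + 1) → ℤˣ | Ssum (n + 1) alt a = 0 ∧ Tsum (n + 1) alt a = 0} =
      {a | isDR n a (-1)} := fun n => by ext a; exact (isDR_neg_one n a).symm
  simp only [hset] at hL
  have hdiff : Tendsto (fun n : ℕ => (n : ℝ) ^ 2 * Pr p {a : Fin (n + 1) → ℤˣ | ∃ z, isDR n a z} -
      (n : ℝ) ^ 2 * (Pr p {a : Fin (n + 1) → ℤˣ | isDR n a 1} +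
        Pr p {a : Fin (n + 1) → ℤˣ | isDR n a (-1)})) atTop (nhds 0) := by
    have hsum := hb.add hr
    rw [add_zero] at hsum
    refine squeeze_zero_norm (fun n => ?_) hsum
    rw [← mul_sub, ← mul_add, norm_mul, Real.norm_eq_abs, Real.norm_eq_abs,
      abs_of_nonneg (by positivity)]
    gcongr
    have u1 : Pr p {a : Fin (n + 1) → ℤˣ | ∃ z, isDR n a z} ≤
        (Pr p {a : Fin (n + 1) → ℤˣ | isDR n a 1} +
        Pr p {a : Fin (n + 1) → ℤˣ | isDR n a (-1)}) +
        Pr p {a : Fin (n + 1) → ℤˣ | ∃ z, isDR n a z ∧ z ≠ 1 ∧ z ≠ -1} := by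
      refine le_trans (Pr_mono h0.le h1.le (?_ : _ ⊆ ({a : Fin (n + 1) → ℤˣ | isDR n a 1} ∪
        {a | isDR n a (-1)}) ∪ {a | ∃ z, isDR n a z ∧ z ≠ 1 ∧ z ≠ -1}))
        ((Pr_union_le h0.le h1.le _ _).trans (add_le_add (Pr_union_le h0.le h1.le _ _) le_rfl))
      rintro a ⟨z, hz⟩
      by_cases e1 : z = 1
      · exact Or.inl (Or.inl (e1 ▸ hz))
      · by_cases e2 : z = -1
        · exact Or.inl (Or.inr (e2 ▸ hz))
        · exact Or.inr ⟨z, hz, e1, e2⟩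
    have u2 : Pr p ({a : Fin (n + 1) → ℤˣ | isDR n a 1} ∪ {a | isDR n a (-1)}) ≤
        Pr p {a : Fin (n + 1) → ℤˣ | ∃ z, isDR n a z} := by
      apply Pr_mono h0.le h1.le
      rintro a (h | h)
      · exact ⟨1, h⟩
      · exact ⟨-1, h⟩
    have u3 := Pr_union_add_inter (p := p) {a : Fin (n + 1) → ℤˣ | isDR n a 1} {a | isDR n a (-1)}
    have u4 := Pr_nonneg (p := p) h0.le h1.le
      ({a : Fin (n + 1) → ℤˣ | isDR n a 1} ∩ {a | isDR n a (-1)})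
    have u5 := Pr_nonneg (p := p) h0.le h1.le
      {a : Fin (n + 1) → ℤˣ | ∃ z, isDR n a z ∧ z ≠ 1 ∧ z ≠ -1}
    rw [abs_le]
    constructor <;> linarith
  by_cases hp2 : p = 1 / 2
  · have hL2 := hL.add hL
    have := hdiff.add hL2
    simp only [add_zero] at this
    refine this.congr fun n => ?_
    rw [if_pos hp2]
    have e : Pr p {a : Fin (n + 1) → ℤˣ | isDR n a 1} =
        Pr p {a : Fin (n + 1) → ℤˣ | isDR n a (-1)} := by rw [hp2]; exact Pr_symm n
    rw [e]
    split_ifs <;> ring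
  · obtain ⟨c, hc0, hc1, hc⟩ := Pr_one_small p h0 h1 hp2
    have h3 : Tendsto (fun n : ℕ => (n : ℝ) ^ 2 * Pr p {a : Fin (n + 1) → ℤˣ | isDR n a 1})
        atTop (nhds 0) := by
      have t := tendsto_pow_const_mul_const_pow_of_abs_lt_one 2
        (show |c| < 1 by rw [abs_of_nonneg hc0]; exact hc1)
      refine squeeze_zero (fun n => mul_nonneg (by positivity) (Pr_nonneg h0.le h1.le _))
        (fun n => ?_) t
      gcongr
      exact (hc n).trans (pow_le_pow_of_le_one hc0 hc1.le (by omega))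
    have := (hdiff.add h3).add hL
    simp only [add_zero] at this
    refine this.congr fun n => ?_
    rw [if_neg hp2]
    ring

end



lemma hdr_iff (n : ℕ) (a : Fin (n + 1) → ℤˣ) :
    hasDoubleRoot n (fun j => (a j : ℤ)) ↔ ∃ z, isDR n a z := by
  have h : polyOf n (fun j => (a j : ℤ)) = (ipoly n a).map (algebraMap ℤ ℂ) := by
    unfold polyOf ipoly
    rw [Polynomial.map_sum]
    refine Finset.sum_congr rfl fun j _ => ?_
    simp
  unfold hasDoubleRoot isDR
  rw [h, Polynomial.derivative_map]
  simp only [Polynomial.eval_map_algebraMap]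

lemma unit_mem_iff (x : ℤ) : x ∈ ({1, -1} : Set ℤ) ↔ ∃ u : ℤˣ, (u : ℤ) = x := by
  constructor
  · rintro (h | h)
    · exact ⟨1, by simp [h]⟩
    · exact ⟨-1, by simp_all⟩
  · rintro ⟨u, rfl⟩
    rcases Int.units_eq_one_or u with h | h <;> simp [h]

lemma pi_bridge (μ : Measure ℤ) [IsProbabilityMeasure μ] (p : ℝ)
    (hc : μ (({1, -1} : Set ℤ)ᶜ) = 0) (h1 : (μ {1}).toReal = p)
    (h2 : (μ {-1}).toReal = 1 - p) (n : ℕ) :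
    ((Measure.pi fun _ : Fin (n + 1) => μ) {a | hasDoubleRoot n a}).toReal =
      Pr p {a : Fin (n + 1) → ℤˣ | ∃ z, isDR n a z} := by
  classical
  set P := Measure.pi fun _ : Fin (n + 1) => μ with hP
  let c : (Fin (n + 1) → ℤˣ) → (Fin (n + 1) → ℤ) := fun a j => (a j : ℤ)
  have hinj : Function.Injective c := by
    intro a b hab
    funext j
    exact Units.ext (congrFun hab j)
  have hF : P (Set.range c)ᶜ = 0 := by
    have hsub : (Set.range c)ᶜ ⊆ ⋃ j : Fin (n + 1), Function.eval j ⁻¹' (({1, -1} : Set ℤ)ᶜ) := by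
      intro x hx
      by_contra hcon
      apply hx
      have h : ∀ j, ∃ u : ℤˣ, (u : ℤ) = x j := by
        intro j
        rw [← unit_mem_iff]
        by_contra hj
        exact hcon (Set.mem_iUnion.2 ⟨j, hj⟩)
      choose u hu using h
      exact ⟨u, funext hu⟩
    refine measure_mono_null hsub (measure_iUnion_null fun j => ?_)
    exact Measure.pi_eval_preimage_null _ hc
  let T : Finset (Fin (n + 1) → ℤˣ) := Finset.univ.filter fun a => ∃ z, isDR n a z
  have hS : P {a | hasDoubleRoot n a} = P ((T.image c : Finset _) : Set (Fin (n + 1) → ℤ)) := by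
    rw [← measure_inter_conull hF]
    congr 1
    ext x
    simp only [Set.mem_inter_iff, Set.mem_range, Finset.coe_image, Set.mem_image, Finset.mem_coe, T,
      Finset.mem_filter, Finset.mem_univ, true_and]
    constructor
    · rintro ⟨hx, a, rfl⟩
      exact ⟨a, (hdr_iff n a).1 hx, rfl⟩
    · rintro ⟨a, ha, rfl⟩
      exact ⟨(hdr_iff n a).2 ha, a, rfl⟩
  have hwt : ∀ u : ℤˣ, (μ {(u : ℤ)}).toReal = wt p u := by
    intro u
    unfold wt
    rcases Int.units_eq_one_or u with h | h
    · simp [h, h1]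
    · subst h
      simpa using h2
  rw [hS, ← sum_measure_singleton, Finset.sum_image (fun a _ b _ h => hinj h),
    ENNReal.toReal_sum (fun a _ => measure_ne_top _ _)]
  unfold Pr
  rw [Finset.sum_filter]
  refine Finset.sum_congr rfl fun a _ => ?_
  rw [Set.indicator_apply]
  simp only [Set.mem_ofPred_eq]
  congr 1
  rw [hP, Measure.pi_singleton, ENNReal.toReal_prod]
  exact Finset.prod_congr rfl fun i _ => hwt (a i)

lemma int_bridge (μ : Measure ℤ) [IsProbabilityMeasure μ] (p : ℝ)
    (hc : μ (({1, -1} : Set ℤ)ᶜ) = 0) (h1 : (μ {1}).toReal = p)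
    (h2 : (μ {-1}).toReal = 1 - p) (f : ℤ → ℝ) :
    ∫ x, f x ∂μ = p * f 1 + (1 - p) * f (-1) := by
  have hr : μ.restrict (({1, -1} : Finset ℤ) : Set ℤ) = μ := by
    apply Measure.restrict_eq_self_of_ae_mem
    rw [ae_iff]
    convert hc using 2
    ext x
    simp
  rw [← hr, setIntegral_finset (hf := IntegrableOn.finset)]
  rw [Finset.sum_pair (by decide)]
  simp [measureReal_def, h1, h2]

/-- Under condition (C) and `μ({0}) = 0`, the probability that `P_n` has a double root is
`L_n / n² + o(n⁻²)`. -/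
theorem double_root_prob_asymptotics (μ : MeasureTheory.Measure ℤ) [IsProbabilityMeasure μ]
    (hsupp : μ (({-1, 0, 1} : Set ℤ)ᶜ) = 0)
    (hC : ∀ x ∈ ({-1, 0, 1} : Set ℤ), (μ {x}).toReal < 1 / Real.sqrt 3)
    (h0 : μ ({0} : Set ℤ) = 0) :
    Tendsto (fun n : ℕ =>
        (n : ℝ) ^ 2 *
          ((Measure.pi fun _ : Fin (n + 1) => μ) {a | hasDoubleRoot n a}).toReal - Lseq μ n)
      atTop (nhds 0) := by
  have hc : μ (({1, -1} : Set ℤ)ᶜ) = 0 := by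
    refine measure_mono_null (t := ({-1, 0, 1} : Set ℤ)ᶜ ∪ {0}) ?_ (measure_union_null hsupp h0)
    intro x hx
    simp only [Set.mem_compl_iff, Set.mem_insert_iff, Set.mem_singleton_iff, Set.mem_union] at hx ⊢
    tauto
  obtain ⟨p, h1⟩ : ∃ p, (μ {1}).toReal = p := ⟨_, rfl⟩
  have h2 : (μ {-1}).toReal = 1 - p := by
    have ha : μ ({1, -1} : Set ℤ) = 1 := (prob_compl_eq_zero_iff (by measurability)).1 hc
    have hb : μ ({1, -1} : Set ℤ) = μ {1} + μ {-1} := by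
      rw [Set.insert_eq, measure_union (by simp) (by measurability)]
    have hd : (μ {1} + μ {-1}).toReal = 1 := by rw [← hb, ha]; simp
    rw [ENNReal.toReal_add (measure_ne_top _ _) (measure_ne_top _ _), h1] at hd
    linarith
  have c1 := hC 1 (by simp)
  have c2 := hC (-1) (by simp)
  rw [h1] at c1
  rw [h2] at c2
  have s3 : (1 : ℝ) < Real.sqrt 3 := by
    rw [Real.lt_sqrt] <;> norm_num
  have s3' : 1 / Real.sqrt 3 < 1 := by
    rw [div_lt_one (by linarith)]; exact s3
  have hM : Real.sqrt 3 * max p (1 - p) < 1 := by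
    have := max_lt c1 c2
    rw [lt_div_iff₀ (by linarith)] at this
    linarith
  have key := main_Pr p (max p (1 - p)) (by linarith) (by linarith) (le_max_left _ _)
    (le_max_right _ _) hM
  have hm : coeffMean μ = 2 * p - 1 := by
    unfold coeffMean
    rw [int_bridge μ p hc h1 h2 (fun x => (x : ℝ))]
    push_cast
    ring
  have hv : coeffVar μ = 4 * p * (1 - p) := by
    unfold coeffVar
    rw [int_bridge μ p hc h1 h2 (fun x => ((x : ℝ) - coeffMean μ) ^ 2), hm]
    push_cast
    ring
  refine key.congr fun n => ?_
  rw [pi_bridge μ p hc h1 h2 n]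
  congr 1
  unfold Lseq
  rw [hv]
  have hiff : coeffMean μ = 0 ↔ p = 1 / 2 := by
    rw [hm]
    constructor <;> intro h <;> linarith
  by_cases h4 : 4 ∣ n + 1
  · rw [if_pos h4, if_pos h4]
    by_cases hp : p = 1 / 2
    · rw [if_pos hp, if_pos (hiff.2 hp)]
    · rw [if_neg hp, if_neg (fun h => hp (hiff.1 h))]
  · rw [if_neg h4, if_neg h4]
end

section
/- Assume condition (C). There exist constants C, c > 0 (depending only on μ) such that for every n ≥ 1 and every integer d with 1 ≤ d ≤ n, the probability that P_n has a double root α ∈ ℂ which is an algebraic number of degree at least d over ℚ is at most C·exp(−c·d). -/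
open MeasureTheory

/-- `z` is a double root of the polynomial with coefficients `a`. -/
def isDoubleRootAt (n : ℕ) (a : Fin (n + 1) → ℤ) (z : ℂ) : Prop :=
  (polyOf n a).eval z = 0 ∧ (Polynomial.derivative (polyOf n a)).eval z = 0

open Polynomial in
/-- Integer version of the polynomial. -/
noncomputable def polyZ (n : ℕ) (a : Fin (n + 1) → ℤ) : Polynomial ℤ :=
  ∑ j : Fin (n + 1), Polynomial.C (a j) * Polynomial.X ^ (j : ℕ)

theorem polyZ_coeff (n : ℕ) (a : Fin (n + 1) → ℤ) (j : Fin (n + 1)) :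
    (polyZ n a).coeff j = a j := by
  simp only [polyZ, Polynomial.finsetSum_coeff, Polynomial.coeff_C_mul, Polynomial.coeff_X_pow]
  rw [Finset.sum_eq_single j]
  · simp
  · intro b _ hb
    have : (j : ℕ) ≠ b := fun h => hb (Fin.ext h.symm)
    simp [this]
  · simp

theorem polyZ_coeff_gt (n : ℕ) (a : Fin (n + 1) → ℤ) (j : ℕ) (hj : n < j) :
    (polyZ n a).coeff j = 0 := by
  simp only [polyZ, Polynomial.finsetSum_coeff, Polynomial.coeff_C_mul, Polynomial.coeff_X_pow]
  refine Finset.sum_eq_zero fun b _ => ?_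
  have : j ≠ b := by have := b.2; omega
  simp [this]

theorem polyZ_natDegree (n : ℕ) (a : Fin (n + 1) → ℤ) : (polyZ n a).natDegree ≤ n := by
  rw [Polynomial.natDegree_le_iff_coeff_eq_zero]
  exact fun j hj => polyZ_coeff_gt n a j hj

theorem polyOf_eq_map (n : ℕ) (a : Fin (n + 1) → ℤ) :
    polyOf n a = (polyZ n a).map (Int.castRingHom ℂ) := by
  simp [polyOf, polyZ, Polynomial.map_sum]

theorem algebraic_part (n : ℕ) (a : Fin (n + 1) → ℤ) (ha : ∀ j, a j ∈ ({-1, 0, 1} : Finset ℤ))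
    (h0 : a ≠ 0) (α : ℂ) (hα : isDoubleRootAt n a α) :
    ∃ g : Polynomial (ZMod 3), g.Monic ∧ g.natDegree = (minpoly ℚ α).natDegree ∧
      2 * g.natDegree ≤ n ∧ g ^ 2 ∣ (polyZ n a).map (Int.castRingHom (ZMod 3)) := by
  set A := polyZ n a with hA
  have hA0 : A ≠ 0 := by
    intro h
    apply h0
    funext j
    rw [← polyZ_coeff n a j, ← hA, h]; simp
  have hlc : A.leadingCoeff = 1 ∨ A.leadingCoeff = -1 := by
    have h1 : A.leadingCoeff ≠ 0 := by simpa using hA0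
    have h2 := polyZ_coeff n a ⟨A.natDegree, Nat.lt_succ_of_le (polyZ_natDegree n a)⟩
    have h3 := ha ⟨A.natDegree, Nat.lt_succ_of_le (polyZ_natDegree n a)⟩
    rw [← h2] at h3
    change A.leadingCoeff ∈ _ at h3
    simp at h3
    tauto
  have e1 : Polynomial.aeval α A = 0 := by
    have := hα.1
    rw [polyOf_eq_map, Polynomial.eval_map] at this
    simpa [Polynomial.aeval_def] using this
  have e2 : Polynomial.aeval α (Polynomial.derivative A) = 0 := by
    have := hα.2
    rw [polyOf_eq_map, Polynomial.derivative_map, Polynomial.eval_map] at this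
    simpa [Polynomial.aeval_def] using this
  have hint : IsIntegral ℤ α := by
    rcases hlc with h | h
    · exact ⟨A, h, by simpa [Polynomial.aeval_def] using e1⟩
    · refine ⟨-A, by simp [Polynomial.Monic, h], ?_⟩
      have : Polynomial.aeval α (-A) = 0 := by simp [e1]
      simpa [Polynomial.aeval_def] using this
  set f := minpoly ℤ α with hf
  have hfm : f.Monic := minpoly.monic hint
  have hdeg : (minpoly ℚ α).natDegree = f.natDegree := by
    rw [minpoly.isIntegrallyClosed_eq_field_fractions' ℚ hint, hfm.natDegree_map]
  have hfpos : 0 < f.natDegree := minpoly.natDegree_pos hint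
  obtain ⟨g, hg⟩ := minpoly.isIntegrallyClosed_dvd hint e1
  have hf' : Polynomial.aeval α (Polynomial.derivative f) ≠ 0 := by
    intro h
    have hd := minpoly.isIntegrallyClosed_dvd hint h
    have hne : Polynomial.derivative f ≠ 0 := by
      intro h
      have := Polynomial.derivative_eq_zero.mp h
      omega
    have : f.natDegree ≤ _ := Polynomial.natDegree_le_of_dvd hd hne
    have h2 := Polynomial.natDegree_derivative_lt (p := f) hfpos.ne'
    omega
  have hgα : Polynomial.aeval α g = 0 := by
    rw [hg, Polynomial.derivative_mul] at e2
    simp only [map_add, map_mul, minpoly.aeval, zero_mul, add_zero] at e2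
    exact (mul_eq_zero.mp e2).resolve_left hf'
  obtain ⟨q, hq⟩ := minpoly.isIntegrallyClosed_dvd hint hgα
  have hdvd : f ^ 2 ∣ A := ⟨q, by rw [hg, hq]; ring⟩
  refine ⟨f.map (Int.castRingHom (ZMod 3)), hfm.map _, ?_, ?_, ?_⟩
  · rw [hfm.natDegree_map, hdeg]
  · rw [hfm.natDegree_map]
    have := Polynomial.natDegree_le_of_dvd hdvd hA0
    rw [hfm.natDegree_pow] at this
    exact this.trans (polyZ_natDegree n a)
  · rw [← Polynomial.map_pow]
    exact Polynomial.map_dvd _ hdvd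

theorem counting {ι : Type*} [Fintype ι] [DecidableEq ι] (w : ℤ → ℝ) (hw0 : ∀ x, 0 ≤ w x)
    (p : ℝ) (hw : ∀ x ∈ ({-1, 0, 1} : Finset ℤ), w x ≤ p)
    (hsum : ∑ x ∈ ({-1, 0, 1} : Finset ℤ), w x = 1)
    (J : Finset ι) (S : Finset (ι → ℤ)) (hS : ∀ a ∈ S, ∀ j, a j ∈ ({-1, 0, 1} : Finset ℤ))
    (hinj : ∀ a ∈ S, ∀ b ∈ S, (∀ j ∉ J, a j = b j) → a = b) :
    ∑ a ∈ S, ∏ j, w (a j) ≤ p ^ J.card := by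
  have hp : 0 ≤ p := (hw0 0).trans (hw 0 (by simp))
  let t : ι → Finset ℤ := fun j => if j ∈ J then {0} else {-1, 0, 1}
  let w' : ι → ℤ → ℝ := fun j x => if j ∈ J then 1 else w x
  let φ : (ι → ℤ) → (ι → ℤ) := fun a j => if j ∈ J then 0 else a j
  have hw'0 : ∀ j x, 0 ≤ w' j x := by
    intro j x; by_cases h : j ∈ J <;> simp [w', h, hw0]
  have h1 : ∀ a ∈ S, ∏ j, w (a j) ≤ p ^ J.card * ∏ j, w' j (φ a j) := by
    intro a ha
    have : p ^ J.card = ∏ j, (if j ∈ J then p else 1) := by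
      rw [Finset.prod_ite]; simp
    rw [this, ← Finset.prod_mul_distrib]
    refine Finset.prod_le_prod (fun j _ => hw0 _) fun j _ => ?_
    by_cases h : j ∈ J
    · simpa [w', h] using hw _ (hS a ha j)
    · simp [w', φ, h]
  have hφ : Set.InjOn φ (S : Set (ι → ℤ)) := by
    intro a ha b hb hab
    refine hinj a ha b hb fun j hj => ?_
    have := congrFun hab j
    simpa [φ, hj] using this
  have h2 : ∑ b ∈ Fintype.piFinset t, ∏ j, w' j (b j) = 1 := by
    rw [← Finset.prod_univ_sum]
    refine Finset.prod_eq_one fun j _ => ?_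
    by_cases h : j ∈ J
    · simp [t, w', h]
    · simp only [t, w', h, if_false]; exact hsum
  calc ∑ a ∈ S, ∏ j, w (a j) ≤ ∑ a ∈ S, p ^ J.card * ∏ j, w' j (φ a j) := Finset.sum_le_sum h1
    _ = p ^ J.card * ∑ b ∈ S.image φ, ∏ j, w' j (b j) := by
      rw [Finset.sum_image hφ, Finset.mul_sum]
    _ ≤ p ^ J.card * ∑ b ∈ Fintype.piFinset t, ∏ j, w' j (b j) := by
      refine mul_le_mul_of_nonneg_left ?_ (pow_nonneg hp _)
      refine Finset.sum_le_sum_of_subset_of_nonneg ?_ fun b _ _ => Finset.prod_nonneg fun j _ => hw'0 _ _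
      intro b hb
      obtain ⟨a, ha, rfl⟩ := Finset.mem_image.mp hb
      rw [Fintype.mem_piFinset]
      intro j
      by_cases h : j ∈ J
      · simp [t, φ, h]
      · simp only [t, φ, h, if_false]; exact hS a ha j
    _ = p ^ J.card := by rw [h2, mul_one]

theorem eq_of_cast3 {x y : ℤ} (hx : x ∈ ({-1, 0, 1} : Finset ℤ)) (hy : y ∈ ({-1, 0, 1} : Finset ℤ))
    (h : (x : ZMod 3) = y) : x = y := by
  have := (ZMod.intCast_eq_intCast_iff_dvd_sub x y 3).mp h
  simp at hx hy
  omega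

theorem inj_part (n m : ℕ) (h : Polynomial (ZMod 3)) (hm : h.Monic) (hd : h.natDegree = m)
    (a b : Fin (n + 1) → ℤ) (ha : ∀ j, a j ∈ ({-1, 0, 1} : Finset ℤ))
    (hb : ∀ j, b j ∈ ({-1, 0, 1} : Finset ℤ))
    (hda : h ∣ (polyZ n a).map (Int.castRingHom (ZMod 3)))
    (hdb : h ∣ (polyZ n b).map (Int.castRingHom (ZMod 3)))
    (hab : ∀ j : Fin (n + 1), ¬ ((j : ℕ) < m) → a j = b j) : a = b := by
  have hdvd := dvd_sub hda hdb
  have hz : (polyZ n a).map (Int.castRingHom (ZMod 3)) - (polyZ n b).map (Int.castRingHom (ZMod 3)) = 0 := by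
    refine Polynomial.eq_zero_of_dvd_of_degree_lt hdvd ?_
    rw [Polynomial.degree_eq_natDegree hm.ne_zero, hd, Polynomial.degree_lt_iff_coeff_zero]
    intro j hj
    simp only [Polynomial.coeff_sub, Polynomial.coeff_map]
    by_cases hjn : n < j
    · rw [polyZ_coeff_gt n a j hjn, polyZ_coeff_gt n b j hjn, sub_self]
    · have e1 := polyZ_coeff n a ⟨j, by omega⟩
      have e2 := polyZ_coeff n b ⟨j, by omega⟩
      simp only at e1 e2
      rw [e1, e2, hab _ (by simpa using hj), sub_self]
  funext j
  refine eq_of_cast3 (ha j) (hb j) ?_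
  have := congrArg (fun q => Polynomial.coeff q (j : ℕ)) hz
  simp only [Polynomial.coeff_sub, Polynomial.coeff_map, polyZ_coeff, Polynomial.coeff_zero] at this
  simpa using sub_eq_zero.mp this

theorem measure_finset (μ : Measure ℤ) [IsProbabilityMeasure μ] (n : ℕ)
    (S : Finset (Fin (n + 1) → ℤ)) :
    (Measure.pi fun _ : Fin (n + 1) => μ).real S = ∑ a ∈ S, ∏ j, μ.real {a j} := by
  rw [← sum_measureReal_singleton]
  refine Finset.sum_congr rfl fun a _ => ?_
  simp [Measure.real, Measure.pi_singleton, ENNReal.toReal_prod]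

/-- Monic polynomial with given lower coefficients. -/
noncomputable def monicOf (k : ℕ) (v : Fin k → ZMod 3) : Polynomial (ZMod 3) :=
  Polynomial.X ^ k + ∑ i : Fin k, Polynomial.C (v i) * Polynomial.X ^ (i : ℕ)

theorem monicOf_deg (k : ℕ) (v : Fin k → ZMod 3) :
    (monicOf k v).Monic ∧ (monicOf k v).natDegree = k := by
  have h : (∑ i : Fin k, Polynomial.C (v i) * Polynomial.X ^ (i : ℕ)).degree < (k : WithBot ℕ) := by
    exact Polynomial.degree_sum_fin_lt v
  refine ⟨Polynomial.monic_X_pow_add h, ?_⟩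
  rw [monicOf, Polynomial.natDegree_add_eq_left_of_degree_lt]
  · simp
  · simpa using h

theorem exists_monicOf (g : Polynomial (ZMod 3)) (hg : g.Monic) :
    ∃ v, g = monicOf g.natDegree v := by
  refine ⟨fun i => g.coeff i, ?_⟩
  conv_lhs => rw [hg.as_sum]
  rw [monicOf, Finset.sum_range]

/-- Under condition (C), the probability that `P_n` has a double root which is an algebraic
number of degree at least `d` over `ℚ` is at most `C·exp(-c·d)`. -/
theorem double_root_high_degree (μ : MeasureTheory.Measure ℤ) [IsProbabilityMeasure μ]
    (hsupp : μ (({-1, 0, 1} : Set ℤ)ᶜ) = 0)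
    (hC : ∀ x ∈ ({-1, 0, 1} : Set ℤ), (μ {x}).toReal < 1 / Real.sqrt 3) :
    ∃ C > (0 : ℝ), ∃ c > (0 : ℝ), ∀ n : ℕ, 1 ≤ n → ∀ d : ℕ, 1 ≤ d → d ≤ n →
      ((Measure.pi fun _ : Fin (n + 1) => μ)
          {a | ∃ α : ℂ, isDoubleRootAt n a α ∧ IsAlgebraic ℚ α ∧
                d ≤ (minpoly ℚ α).natDegree}).toReal
        ≤ C * Real.exp (-c * d) := by
  classical
  set w : ℤ → ℝ := fun x => μ.real {x} with hw_def
  have hw0 : ∀ x, 0 ≤ w x := fun x => measureReal_nonneg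
  have hs3 : (1 : ℝ) / 2 < 1 / Real.sqrt 3 := by
    have : Real.sqrt 3 < 2 := by
      rw [Real.sqrt_lt' (by norm_num)]; norm_num
    have h0 : 0 < Real.sqrt 3 := by positivity
    exact one_div_lt_one_div_of_lt h0 this
  obtain ⟨p, hp12, hps, hwp⟩ : ∃ p : ℝ, 1 / 2 ≤ p ∧ p < 1 / Real.sqrt 3 ∧
      ∀ x ∈ ({-1, 0, 1} : Finset ℤ), w x ≤ p := by
    refine ⟨max (1 / 2) (max (w (-1)) (max (w 0) (w 1))), le_max_left _ _, ?_, ?_⟩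
    · simp only [max_lt_iff]
      exact ⟨hs3, hC _ (by simp), hC _ (by simp), hC _ (by simp)⟩
    · intro x hx
      simp only [Finset.mem_insert, Finset.mem_singleton] at hx
      rcases hx with rfl | rfl | rfl <;> simp
  set r : ℝ := 3 * p ^ 2 with hr
  have hr1 : r < 1 := by
    have h0 : 0 < Real.sqrt 3 := by positivity
    have h1 : p * Real.sqrt 3 < 1 := by rwa [lt_div_iff₀ h0] at hps
    have h2 : (p * Real.sqrt 3) ^ 2 < 1 := by
      have : 0 ≤ p * Real.sqrt 3 := by positivity
      nlinarith
    rw [mul_pow, Real.sq_sqrt (by norm_num)] at h2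
    linarith
  have hpr : p ≤ r := by nlinarith
  have hr0 : 0 < r := by linarith
  have hp1 : p ≤ 1 := by linarith
  have hsum : ∑ x ∈ ({-1, 0, 1} : Finset ℤ), w x = 1 := by
    rw [hw_def, sum_measureReal_singleton]
    have : μ (({-1, 0, 1} : Set ℤ)) = 1 := by
      rw [← prob_compl_eq_zero_iff (MeasurableSet.of_discrete)]; exact hsupp
    simp [Measure.real, this]
  refine ⟨1 + 1 / (1 - r), ?_, -Real.log r, ?_, ?_⟩
  · have : 0 < 1 - r := by linarith
    positivity
  · have := Real.log_neg hr0 hr1; linarith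
  intro n hn d hd hdn
  have hexp : Real.exp (-(-Real.log r) * d) = r ^ d := by
    rw [neg_neg, mul_comm, Real.exp_nat_mul, Real.exp_log hr0]
  rw [hexp]
  set Q := Measure.pi fun _ : Fin (n + 1) => μ with hQ
  let F : Finset (Fin (n + 1) → ℤ) := Fintype.piFinset fun _ => ({-1, 0, 1} : Finset ℤ)
  have hF : ∀ a ∈ F, ∀ j, a j ∈ ({-1, 0, 1} : Finset ℤ) := fun a ha => Fintype.mem_piFinset.mp ha
  have hFull : Q ((F : Set (Fin (n + 1) → ℤ))ᶜ) = 0 := by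
    rw [prob_compl_eq_zero_iff (Finset.measurableSet _)]
    have h1 : Q.real F = 1 := by
      rw [hQ, measure_finset]
      change ∑ a ∈ Fintype.piFinset _, ∏ j, w (a j) = 1
      rw [← Finset.prod_univ_sum (fun _ => ({-1, 0, 1} : Finset ℤ)) (fun _ x => w x)]
      simp only [hsum, Finset.prod_const_one]
    have h2 : (1 : ENNReal) = ENNReal.ofReal (Q.real F) := by rw [h1]; simp
    rw [h2, ofReal_measureReal]
  let D : (k : ℕ) → (Fin k → ZMod 3) → Finset (Fin (n + 1) → ℤ) := fun k v =>
    F.filter fun a => monicOf k v ^ 2 ∣ (polyZ n a).map (Int.castRingHom (ZMod 3))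
  have hD : ∀ k v, 2 * k ≤ n → Q.real (D k v) ≤ p ^ (2 * k) := by
    intro k v hk
    rw [hQ, measure_finset]
    have hc : (Finset.univ.filter fun j : Fin (n + 1) => (j : ℕ) < 2 * k).card = 2 * k := by
      rw [Fin.card_filter_val_lt]; omega
    have := counting w hw0 p hwp hsum
      (Finset.univ.filter fun j : Fin (n + 1) => (j : ℕ) < 2 * k) (D k v)
      (fun a ha => hF a (Finset.mem_filter.mp ha).1) ?_
    · rwa [hc] at this
    · intro a ha b hb hab
      obtain ⟨ha1, ha2⟩ := Finset.mem_filter.mp ha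
      obtain ⟨hb1, hb2⟩ := Finset.mem_filter.mp hb
      refine inj_part n (2 * k) _ ((monicOf_deg k v).1.pow 2) ?_ a b (hF a ha1) (hF b hb1) ha2 hb2 ?_
      · rw [(monicOf_deg k v).1.natDegree_pow, (monicOf_deg k v).2]
      · intro j hj
        exact hab j (by simpa using hj)
  have hzero : Q.real {(0 : Fin (n + 1) → ℤ)} ≤ r ^ d := by
    have h := measure_finset μ n {0}
    have h' : Q.real {(0 : Fin (n + 1) → ℤ)} = w 0 ^ (n + 1) := by
      rw [Finset.coe_singleton] at h
      rw [hQ, h]; simp [hw_def]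
    rw [h']
    calc w 0 ^ (n + 1) ≤ p ^ (n + 1) := pow_le_pow_left₀ (hw0 0) (hwp 0 (by simp)) _
      _ ≤ p ^ d := pow_le_pow_of_le_one (by linarith) hp1 (by omega)
      _ ≤ r ^ d := pow_le_pow_left₀ (by linarith) hpr _
  let K : Finset ℕ := (Finset.Ico d (n + 1)).filter fun k => 2 * k ≤ n
  set E := {a : Fin (n + 1) → ℤ | ∃ α : ℂ, isDoubleRootAt n a α ∧ IsAlgebraic ℚ α ∧
                d ≤ (minpoly ℚ α).natDegree} with hE
  have hsub : E ⊆ ((F : Set (Fin (n + 1) → ℤ))ᶜ) ∪ ({0} ∪ ⋃ k ∈ K, ⋃ v ∈ (Finset.univ : Finset (Fin k → ZMod 3)), (D k v : Set (Fin (n + 1) → ℤ))) := by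
    rintro a ⟨α, h1, _, h3⟩
    by_cases haF : a ∈ F
    swap
    · left; simpa using haF
    right
    by_cases ha0 : a = 0
    · left; exact ha0
    right
    obtain ⟨g, hg1, hg2, hg3, hg4⟩ := algebraic_part n a (hF a haF) ha0 α h1
    obtain ⟨v, hv⟩ := exists_monicOf g hg1
    simp only [Set.mem_iUnion]
    refine ⟨g.natDegree, ?_, v, Finset.mem_univ _, ?_⟩
    · simp only [K, Finset.mem_filter, Finset.mem_Ico]; omega
    · refine Finset.mem_coe.mpr (Finset.mem_filter.mpr ⟨haF, ?_⟩)
      rw [← hv]; exact hg4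
  change Q.real E ≤ _
  have hFull' : Q.real ((F : Set (Fin (n + 1) → ℤ))ᶜ) = 0 := by simp [Measure.real, hFull]
  have hbig : Q.real (⋃ k ∈ K, ⋃ v ∈ (Finset.univ : Finset (Fin k → ZMod 3)), (D k v : Set (Fin (n + 1) → ℤ))) ≤ r ^ d / (1 - r) := by
    calc _ ≤ ∑ k ∈ K, Q.real (⋃ v ∈ (Finset.univ : Finset (Fin k → ZMod 3)), (D k v : Set (Fin (n + 1) → ℤ))) :=
          measureReal_biUnion_finset_le _ _
      _ ≤ ∑ k ∈ K, r ^ k := by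
          refine Finset.sum_le_sum fun k hk => ?_
          refine (measureReal_biUnion_finset_le _ _).trans ?_
          refine (Finset.sum_le_sum fun v _ => hD k v (Finset.mem_filter.mp hk).2).trans ?_
          simp [hr, mul_pow, pow_mul, ZMod.card]
      _ ≤ ∑ k ∈ Finset.Ico d (n + 1), r ^ k :=
          Finset.sum_le_sum_of_subset_of_nonneg (Finset.filter_subset _ _)
            fun _ _ _ => pow_nonneg hr0.le _
      _ ≤ r ^ d / (1 - r) := geom_sum_Ico_le_of_lt_one hr0.le hr1
  calc Q.real E ≤ _ := measureReal_mono hsub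
    _ ≤ _ := measureReal_union_le _ _
    _ ≤ 0 + (r ^ d + r ^ d / (1 - r)) := by
        rw [hFull']
        gcongr
        exact (measureReal_union_le _ _).trans (add_le_add hzero hbig)
    _ = (1 + 1 / (1 - r)) * r ^ d := by ring
end
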